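/- Fix d ≥ 1. There exist constants c₁, c₂ > 0, depending only on d, such that: if p ≤ c₁/n, then w.h.p. the geometric realization of Y_d(n,p) admits a topological embedding into ℝ^{2d}; and if p ≥ c₂/n, then w.h.p. it admits no topological embedding into ℝ^{2d}. -/

import Mathlib

open MeasureTheory Filter Finset Matrix

noncomputable section

/-- Bernoulli measure on `Bool` with success probability `p` (clamped to `[0,1]`). -/
def bernoulliBool (p : ℝ) : Measure Bool :=
  ENNReal.ofReal (max 0 (min p 1)) • Measure.dirac true +
    ENNReal.ofReal (1 - max 0 (min p 1)) • Measure.dirac false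

instance (p : ℝ) : IsFiniteMeasure (bernoulliBool p) := by
  constructor
  simp only [bernoulliBool, Measure.add_apply, Measure.smul_apply, smul_eq_mul,
    measure_univ, mul_one]
  exact ENNReal.add_lt_top.mpr ⟨ENNReal.ofReal_lt_top, ENNReal.ofReal_lt_top⟩

/-- Index type for potential `d`-dimensional faces on vertex set `Fin n`:
the `(d+1)`-element subsets. -/
abbrev FaceIdx (n d : ℕ) : Type := {s : Finset (Fin n) // s.card = d + 1}

/-- The distribution of the random `d`-complex `Y_d(n,p)`: each potential `d`-face
gets an independent Bernoulli(`p`) coin. (For `d = 1` this is the Erdős–Rényi model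
`G(n,p)`.) -/
def YMeasure (n d : ℕ) (p : ℝ) : Measure (FaceIdx n d → Bool) :=
  Measure.pi fun _ => bernoulliBool p

/-- The random `d`-complex: all faces of dimension `≤ d - 1` (i.e. all subsets of
cardinality `≤ d`, including `∅`, so that degree-0 homology below is reduced
homology), together with the chosen `d`-faces. -/
def Ycomplex (n d : ℕ) (ω : FaceIdx n d → Bool) : Finset (Finset (Fin n)) :=
  Finset.univ.filter fun s => s.card ≤ d ∨ ∃ h : s.card = d + 1, ω ⟨s, h⟩ = true

/-- The Erdős–Rényi random graph associated to a configuration of edge coins. -/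
def graphOf (n : ℕ) (ω : FaceIdx n 1 → Bool) : SimpleGraph (Fin n) where
  Adj i j := i ≠ j ∧ ∃ e : FaceIdx n 1, ω e = true ∧ i ∈ e.1 ∧ j ∈ e.1
  symm := ⟨fun i j ⟨hne, e, he, hi, hj⟩ => ⟨hne.symm, e, he, hj, hi⟩⟩
  loopless := ⟨fun i ⟨hne, _⟩ => hne rfl⟩

instance (n : ℕ) (ω : FaceIdx n 1 → Bool) : DecidableRel (graphOf n ω).Adj :=
  fun i j =>
    inferInstanceAs (Decidable (i ≠ j ∧ ∃ e : FaceIdx n 1, ω e = true ∧ i ∈ e.1 ∧ j ∈ e.1))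

/-- The clique complex of the graph determined by the edge coins `ω`:
faces are vertex sets of complete subgraphs (including `∅` and singletons). -/
def cliqueComplex (n : ℕ) (ω : FaceIdx n 1 → Bool) : Finset (Finset (Fin n)) :=
  Finset.univ.filter fun s => ∀ i ∈ s, ∀ j ∈ s, i ≠ j → (graphOf n ω).Adj i j

/-- The group of simplicial `G`-chains of a complex `K`, in cardinality `c`
(i.e. dimension `c - 1`): functions on the faces of `K` of cardinality `c`. -/
abbrev Chains {V : Type} [Fintype V] [DecidableEq V]
    (K : Finset (Finset V)) (c : ℕ) (G : Type) : Type :=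
  {s : Finset V // s ∈ K ∧ s.card = c} → G

/-- The simplicial boundary map, from chains of cardinality `c+1` to chains of
cardinality `c`, with the usual alternating signs coming from the linear order
on the vertices. -/
def chainBoundary {V : Type} [Fintype V] [DecidableEq V] [LinearOrder V]
    (K : Finset (Finset V)) (c : ℕ) {G : Type} [AddCommGroup G]
    (f : Chains K (c + 1) G) : Chains K c G :=
  fun τ => ∑ v : V,
    if h : v ∉ τ.1 ∧ insert v τ.1 ∈ K then
      ((-1 : ℤ) ^ (τ.1.filter (fun u => u < v)).card) •
        f ⟨insert v τ.1, h.2, by rw [Finset.card_insert_of_notMem h.1, τ.2.2]⟩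
    else 0

/-- Vanishing of the simplicial homology of `K` with coefficients in `G` in
degree `i` (faces of cardinality `i+1`): every cycle is a boundary.
If `∅ ∈ K` this is reduced homology (the boundary map to cardinality-0 chains
is the augmentation); in degrees `i ≥ 1` reduced and unreduced homology agree. -/
def HomologyZero {V : Type} [Fintype V] [DecidableEq V] [LinearOrder V]
    (K : Finset (Finset V)) (i : ℕ) (G : Type) [AddCommGroup G] : Prop :=
  ∀ f : Chains K (i + 1) G, chainBoundary K i f = 0 →
    ∃ g : Chains K (i + 2) G, chainBoundary K (i + 1) g = f

/-- Vanishing of top-dimensional homology `H_d(K,G)`, i.e. the kernel of the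
`d`-th boundary map is zero. -/
def TopHomologyZero {V : Type} [Fintype V] [DecidableEq V] [LinearOrder V]
    (K : Finset (Finset V)) (d : ℕ) (G : Type) [AddCommGroup G] : Prop :=
  ∀ f : Chains K (d + 1) G, chainBoundary K d f = 0 → f = 0

/-- The boundary map on real coefficients, as a linear map. -/
def chainBoundaryLin {V : Type} [Fintype V] [DecidableEq V] [LinearOrder V]
    (K : Finset (Finset V)) (c : ℕ) : Chains K (c + 1) ℝ →ₗ[ℝ] Chains K c ℝ where
  toFun := chainBoundary K c
  map_add' f g := by
    funext τ
    simp only [chainBoundary, Pi.add_apply]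
    rw [← Finset.sum_add_distrib]
    refine Finset.sum_congr rfl fun v _ => ?_
    split
    · simp [smul_add]
    · simp
  map_smul' r f := by
    funext τ
    simp only [chainBoundary, Pi.smul_apply, RingHom.id_apply]
    rw [Finset.smul_sum]
    refine Finset.sum_congr rfl fun v _ => ?_
    split
    · exact smul_comm _ _ _
    · simp

/-- The `k`-th Betti number of `K`: the dimension of the `k`-th real simplicial
homology, i.e. of (kernel of `∂_k`) / (image of `∂_{k+1}`). -/
def bettiNumber {V : Type} [Fintype V] [DecidableEq V] [LinearOrder V]
    (K : Finset (Finset V)) (k : ℕ) : ℕ :=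
  Module.finrank ℝ
    (↥(LinearMap.ker (chainBoundaryLin K k)) ⧸
      (LinearMap.range (chainBoundaryLin K (k + 1))).comap
        (LinearMap.ker (chainBoundaryLin K k)).subtype)

/-- The link of a face `σ` in the complex `K`. -/
def linkSet {V : Type} [Fintype V] [DecidableEq V]
    (K : Finset (Finset V)) (σ : Finset V) : Finset (Finset V) :=
  Finset.univ.filter fun τ => τ ∩ σ = ∅ ∧ τ ∪ σ ∈ K

/-- The graph underlying the link of a face `σ`: its vertices are the vertices
of the link, joined when they span an edge of the link. -/
def linkGraph {V : Type} [Fintype V] [DecidableEq V]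
    (K : Finset (Finset V)) (σ : Finset V) :
    SimpleGraph {v : V // {v} ∈ linkSet K σ} where
  Adj a b := a ≠ b ∧ ({a.1, b.1} : Finset V) ∈ linkSet K σ
  symm := ⟨fun a b ⟨hab, h⟩ => ⟨hab.symm, by rwa [Finset.pair_comm]⟩⟩
  loopless := ⟨fun a ⟨hab, _⟩ => hab rfl⟩

instance {V : Type} [Fintype V] [DecidableEq V] (K : Finset (Finset V)) (σ : Finset V) :
    DecidableRel (linkGraph K σ).Adj :=
  fun a b => inferInstanceAs (Decidable (a ≠ b ∧ ({a.1, b.1} : Finset V) ∈ linkSet K σ))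

/-- The normalized Laplacian `I - D^{-1/2} A D^{-1/2}` of a finite graph. -/
def normalizedLaplacian {W : Type} [Fintype W] [DecidableEq W]
    (H : SimpleGraph W) [DecidableRel H.Adj] : Matrix W W ℝ :=
  Matrix.of fun a b =>
    (if a = b then (1 : ℝ) else 0) -
      (if H.Adj a b then 1 / Real.sqrt ((H.degree a : ℝ) * (H.degree b : ℝ)) else 0)

/-- An elementary `d`-collapse step: remove a free `(d-1)`-face `σ` together with
the unique `d`-face `τ` containing it. -/
def CollapseStep {V : Type} [DecidableEq V] (d : ℕ) (K K' : Finset (Finset V)) : Prop :=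
  ∃ σ τ : Finset V, σ ∈ K ∧ τ ∈ K ∧ τ.card = d + 1 ∧ σ ⊆ τ ∧ σ.card = d ∧
    (∀ ρ ∈ K, σ ⊆ ρ → ρ.card = d + 1 → ρ = τ) ∧ K' = K \ {σ, τ}

/-- `K` is `d`-collapsible if some finite sequence of elementary collapses reduces it
to a complex of dimension at most `d-1`. -/
def IsDCollapsible {V : Type} [DecidableEq V] (d : ℕ) (K : Finset (Finset V)) : Prop :=
  ∃ K' : Finset (Finset V),
    Relation.ReflTransGen (CollapseStep d) K K' ∧ ∀ s ∈ K', s.card ≤ d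

/-- The geometric realization of a complex on vertex set `Fin n`, inside `ℝ^n`:
the union over the faces of the convex hulls of the corresponding standard
basis vectors. -/
def geomReal (n : ℕ) (K : Finset (Finset (Fin n))) : Set (Fin n → ℝ) :=
  ⋃ σ ∈ K, convexHull ℝ ((fun i => (Pi.single i 1 : Fin n → ℝ)) '' ↑σ)

/-- The boundary of the simplex on the vertex set `τ`, as a chain of cardinality
`c` (to be used with `τ.card = c + 1`): the alternating sum of the `c`-element
subsets of `τ`. -/
def simplexBoundaryChain {V : Type} [Fintype V] [DecidableEq V] [LinearOrder V]
    (K : Finset (Finset V)) (c : ℕ) (τ : Finset V) : Chains K c ℝ :=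
  fun σ => ∑ v ∈ τ,
    if σ.1 = τ.erase v then ((-1 : ℝ) ^ (τ.filter (fun u => u < v)).card) else 0

/-- Index type for the multiparameter model: all potential faces of dimension `≥ 1`. -/
abbrev MultiIdx (n : ℕ) : Type := {s : Finset (Fin n) // 2 ≤ s.card}

/-- The distribution of the multiparameter random complex `X(n; p₁, p₂, …)`:
a potential face of cardinality `i+1` gets an independent Bernoulli(`p i`) coin. -/
def multiMeasure (n : ℕ) (p : ℕ → ℝ) : Measure (MultiIdx n → Bool) :=
  Measure.pi fun t => bernoulliBool (p (t.1.card - 1))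

/-- The multiparameter random complex: a set `s` is a face iff every subset of `s`
of dimension `≥ 1` has its coin turned on (this is exactly the
inductive-by-dimension construction: a face is present iff its coin is on and all
of its boundary faces are present). -/
def multiComplex (n : ℕ) (ω : MultiIdx n → Bool) : Finset (Finset (Fin n)) :=
  Finset.univ.filter fun s => ∀ t : MultiIdx n, t.1 ⊆ s → ω t = true

/-- The Vietoris–Rips complex of the points `pts` at scale `r`. -/
def VRcomplex (n d : ℕ) (pts : Fin n → EuclideanSpace ℝ (Fin d)) (r : ℝ) :
    Finset (Finset (Fin n)) :=
  Finset.univ.filter fun s => ∀ i ∈ s, ∀ j ∈ s, dist (pts i) (pts j) ≤ r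

end

namespace Emb
open scoped Classical

/-! ### Mod 2 chains -/

abbrev Ch (V : Type*) := Finset V →₀ ZMod 2

noncomputable def sg {V : Type*} (A : Finset V) : Ch V := Finsupp.single A 1

noncomputable def bd {V : Type*} : Ch V →ₗ[ZMod 2] Ch V :=
  Finsupp.linearCombination (ZMod 2) (fun A => ∑ a ∈ A, sg (A.erase a))

noncomputable def cone {V : Type*} (b : V) : Ch V →ₗ[ZMod 2] Ch V :=
  Finsupp.linearCombination (ZMod 2) (fun A => if b ∈ A then 0 else sg (insert b A))

lemma bd_sg {V : Type*} [hV : DecidableEq V] (A : Finset V) : bd (sg A) = ∑ a ∈ A, sg (A.erase a) := by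
  have : hV = fun a b => Classical.propDecidable (a = b) := Subsingleton.elim _ _
  subst this
  simp [bd, sg, Finsupp.linearCombination_single]

lemma cone_sg {V : Type*} [hV : DecidableEq V] (b : V) (A : Finset V) :
    cone b (sg A) = if b ∈ A then 0 else sg (insert b A) := by
  have : hV = fun a b => Classical.propDecidable (a = b) := Subsingleton.elim _ _
  subst this
  simp only [cone, sg, Finsupp.linearCombination_single, one_smul]

lemma ch_add_self {V : Type*} (z : Ch V) : z + z = 0 := ZModModule.add_self z

lemma lin_ext {V M : Type*} [AddCommGroup M] [Module (ZMod 2) M] {f g : Ch V →ₗ[ZMod 2] M}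
    (h : ∀ A, f (sg A) = g (sg A)) : f = g := by
  apply Finsupp.lhom_ext
  intro A b
  have : Finsupp.single A b = b • sg A := by simp [sg]
  rw [this, map_smul, map_smul, h]

lemma bd_cone {V : Type*} (b : V) (z : Ch V) : bd (cone b z) = z + cone b (bd z) := by
  have : bd ∘ₗ cone b = LinearMap.id + cone b ∘ₗ bd (V := V) := by
    apply lin_ext
    intro A
    simp only [LinearMap.comp_apply, LinearMap.add_apply, LinearMap.id_apply]
    rw [cone_sg, bd_sg, map_sum]
    by_cases hb : b ∈ A
    · rw [if_pos hb, map_zero]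
      have : ∑ a ∈ A, cone b (sg (A.erase a)) = sg A := by
        rw [Finset.sum_eq_single_of_mem b hb]
        · rw [cone_sg, if_neg (by simp), Finset.insert_erase hb]
        · intro a _ hab
          rw [cone_sg, if_pos]
          exact Finset.mem_erase.2 ⟨hab.symm, hb⟩
      rw [this, ch_add_self]
    · rw [if_neg hb, bd_sg, Finset.sum_insert hb, Finset.erase_insert hb]
      congr 1
      apply Finset.sum_congr rfl
      intro a ha
      have hab : a ≠ b := fun h => hb (h ▸ ha)
      rw [cone_sg, if_neg (fun h => hb (Finset.mem_of_mem_erase h)),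
        Finset.erase_insert_of_ne hab.symm]
  exact congrArg (fun f => f z) this

lemma bd_bd {V : Type*} (z : Ch V) : bd (bd z) = 0 := by
  have : bd ∘ₗ bd (V := V) = 0 := by
    apply lin_ext
    intro A
    simp only [LinearMap.comp_apply, LinearMap.zero_apply]
    induction A using Finset.induction_on with
    | empty => simp [bd_sg]
    | insert b A hb ih =>
      have h1 : sg (insert b A) = cone b (sg A) := by rw [cone_sg, if_neg hb]
      rw [h1, bd_cone, map_add, bd_cone, ih, map_zero, add_zero, ch_add_self]
  exact congrArg (fun f => f z) this

/-- chains supported on simplices satisfying `P` -/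
abbrev Sup {V : Type*} (P : Set (Finset V)) : Submodule (ZMod 2) (Ch V) :=
  Finsupp.supported (ZMod 2) (ZMod 2) P

lemma sg_mem_Sup {V : Type*} {P : Set (Finset V)} {A : Finset V} (h : A ∈ P) : sg A ∈ Sup P :=
  Finsupp.single_mem_supported _ _ h

lemma Sup_map {V M : Type*} [AddCommGroup M] [Module (ZMod 2) M] {P : Set (Finset V)}
    (f : Ch V →ₗ[ZMod 2] M) (q : Submodule (ZMod 2) M)
    (h : ∀ A ∈ P, f (sg A) ∈ q) {z : Ch V} (hz : z ∈ Sup P) : f z ∈ q := by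
  have hz : z ∈ Finsupp.supported (ZMod 2) (ZMod 2) P := hz
  rw [Finsupp.supported_eq_span_single] at hz
  have : Submodule.span (ZMod 2) ((fun i => Finsupp.single i (1 : ZMod 2)) '' P) ≤ q.comap f := by
    rw [Submodule.span_le]
    rintro _ ⟨A, hA, rfl⟩
    exact h A hA
  exact this hz

lemma Sup_ext {V M : Type*} [AddCommGroup M] [Module (ZMod 2) M] {P : Set (Finset V)}
    (f g : Ch V →ₗ[ZMod 2] M) (h : ∀ A ∈ P, f (sg A) = g (sg A)) {z : Ch V} (hz : z ∈ Sup P) :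
    f z = g z := by
  have := Sup_map (f - g) ⊥ (P := P) (by intro A hA; simp [h A hA]) hz
  simpa [sub_eq_zero] using this

/-- simplices with `k` vertices all in `L` -/
def Sx {V : Type*} (k : ℕ) (L : Set V) : Set (Finset V) := {A | A.card = k ∧ ∀ v ∈ A, v ∈ L}

lemma bd_mem {V : Type*} {k : ℕ} {L : Set V} {z : Ch V} (hz : z ∈ Sup (Sx (k+1) L)) :
    bd z ∈ Sup (Sx k L) := by
  refine Sup_map bd _ ?_ hz
  rintro A ⟨hA, hL⟩
  rw [bd_sg]
  refine Submodule.sum_mem _ fun a ha => sg_mem_Sup ⟨?_, fun v hv => hL v (Finset.mem_of_mem_erase hv)⟩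
  rw [Finset.card_erase_of_mem ha, hA]; rfl

lemma cone_mem {V : Type*} {k : ℕ} {L : Set V} {b : V} (hb : b ∈ L) {z : Ch V}
    (hz : z ∈ Sup (Sx k L)) : cone b z ∈ Sup (Sx (k+1) L) := by
  refine Sup_map (cone b) _ ?_ hz
  rintro A ⟨hA, hL⟩
  rw [cone_sg]
  split_ifs with h
  · exact Submodule.zero_mem _
  · refine sg_mem_Sup ⟨by rw [Finset.card_insert_of_notMem h, hA], fun v hv => ?_⟩
    rcases Finset.mem_insert.1 hv with rfl | hv
    · exact hb
    · exact hL v hv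

lemma Sup_mono {V : Type*} {P Q : Set (Finset V)} (h : P ⊆ Q) {z : Ch V} (hz : z ∈ Sup P) :
    z ∈ Sup Q := Finsupp.supported_mono h hz

lemma Sx_mono {V : Type*} {k : ℕ} {L L' : Set V} (h : L ⊆ L') : Sx k L ⊆ Sx k L' :=
  fun _ hA => ⟨hA.1, fun v hv => h (hA.2 v hv)⟩

/-! ### Positive dependencies -/

def PosDep {V : Type*} {N : ℕ} (y : V → (Fin N → ℝ)) (S : Finset V) : Prop :=
  ∃ l : V → ℝ, (∀ v ∈ S, 0 < l v) ∧ ∑ v ∈ S, l v • y v = 0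

def Gen {V : Type*} {N : ℕ} (y : V → (Fin N → ℝ)) (L : Set V) : Prop :=
  ∀ S : Finset V, (∀ v ∈ S, v ∈ L) → S.card = N → ∀ l : V → ℝ, ∑ v ∈ S, l v • y v = 0 →
    ∀ v ∈ S, l v = 0

lemma exists_dep {V : Type*} {N : ℕ} (y : V → (Fin N → ℝ)) (S : Finset V) (hS : S.card = N + 1) :
    ∃ l : V → ℝ, ∑ v ∈ S, l v • y v = 0 ∧ ∃ v ∈ S, l v ≠ 0 := by
  have h : ¬ LinearIndependent ℝ (fun v : S => y v) := by
    intro h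
    have := h.fintype_card_le_finrank
    simp [hS] at this
  obtain ⟨g, hg, i, hi⟩ := Fintype.not_linearIndependent_iff.1 h
  refine ⟨fun v => if hv : v ∈ S then g ⟨v, hv⟩ else 0, ?_, i, i.2, by simpa using hi⟩
  rw [← Finset.sum_coe_sort]
  simpa using hg

lemma Gen.ne_zero {V : Type*} {N : ℕ} {y : V → (Fin N → ℝ)} {L : Set V} (hy : Gen y L)
    {S : Finset V} (hSL : ∀ v ∈ S, v ∈ L) (hS : S.card = N + 1) {l : V → ℝ}
    (h0 : ∑ v ∈ S, l v • y v = 0) (hl : ∃ v ∈ S, l v ≠ 0) : ∀ v ∈ S, l v ≠ 0 := by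
  intro v hv hv0
  obtain ⟨w, hw, hw0⟩ := hl
  have hwv : w ≠ v := fun h => hw0 (h ▸ hv0)
  apply hw0
  refine hy (S.erase v) (fun u hu => hSL u (Finset.mem_of_mem_erase hu))
    (by rw [Finset.card_erase_of_mem hv, hS]; rfl) l ?_ w (Finset.mem_erase.2 ⟨hwv, hw⟩)
  rw [← Finset.sum_erase_add _ _ hv, hv0] at h0
  simpa using h0

lemma posDep_unique {V : Type*} {N : ℕ} {y : V → (Fin N → ℝ)} {S : Finset V}
    (hy : Gen y (S : Set V)) (hS : S.card = N + 2) {a : V} (ha : a ∈ S)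
    (hpa : PosDep y (S.erase a)) :
    ∃ b ∈ S, b ≠ a ∧ PosDep y (S.erase b) ∧ ∀ c ∈ S, c ≠ a → PosDep y (S.erase c) → c = b := by
  obtain ⟨l, hl, hl0⟩ := hpa
  have hca : (S.erase a).card = N + 1 := by rw [Finset.card_erase_of_mem ha, hS]; rfl
  have hne : (S.erase a).Nonempty := by rw [← Finset.card_pos, hca]; omega
  -- auxiliary: rewriting sums
  have key : ∀ (m : V → ℝ) (b : V), b ∈ S → m b = 0 → (∑ v ∈ S.erase b, m v • y v = 0 ↔ ∑ v ∈ S, m v • y v = 0) := by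
    intro m b hb hm
    rw [← Finset.sum_erase_add _ _ hb, hm]; simp
  set l' : V → ℝ := fun v => if v = a then 0 else l v with hl'
  have hl'a : l' a = 0 := by simp [hl']
  have hl'p : ∀ v ∈ S.erase a, 0 < l' v := by
    intro v hv
    simp only [hl']; rw [if_neg (Finset.ne_of_mem_erase hv)]; exact hl v hv
  have hl'0 : ∑ v ∈ S, l' v • y v = 0 := by
    rw [← key l' a ha hl'a, ← hl0]
    apply Finset.sum_congr rfl
    intro v hv
    simp only [hl']; rw [if_neg (Finset.ne_of_mem_erase hv)]
  -- second dependency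
  obtain ⟨b0, hb0⟩ := hne
  have hb0S := Finset.mem_of_mem_erase hb0
  obtain ⟨m0, hm0, hmne⟩ := exists_dep y (S.erase b0) (by rw [Finset.card_erase_of_mem hb0S, hS]; rfl)
  have hm0a := (Gen.ne_zero hy (fun v hv => Finset.mem_of_mem_erase hv)
    (by rw [Finset.card_erase_of_mem hb0S, hS]; rfl) hm0 hmne) a
      (Finset.mem_erase.2 ⟨(Finset.ne_of_mem_erase hb0).symm, ha⟩)
  set m : V → ℝ := fun v => if v = b0 then 0 else m0 v / m0 a with hm
  have hab0 : a ≠ b0 := (Finset.ne_of_mem_erase hb0).symm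
  have hma : m a = 1 := by simp [hm, hab0, hm0a]
  have hmS : ∑ v ∈ S, m v • y v = 0 := by
    rw [← key m b0 hb0S (by simp [hm])]
    have : ∑ v ∈ S.erase b0, m v • y v = (m0 a)⁻¹ • ∑ v ∈ S.erase b0, m0 v • y v := by
      rw [Finset.smul_sum]
      apply Finset.sum_congr rfl
      intro v hv
      simp only [hm]; rw [if_neg (Finset.ne_of_mem_erase hv), smul_smul, div_eq_inv_mul]
    rw [this, hm0, smul_zero]
  -- argmax
  obtain ⟨b, hb, hbmax⟩ := Finset.exists_max_image (S.erase a) (fun v => - m v / l' v) ⟨b0, hb0⟩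
  have hbS := Finset.mem_of_mem_erase hb
  have hba := Finset.ne_of_mem_erase hb
  -- a combination vanishing at two points is impossible
  have two : ∀ α : ℝ, ∀ c ∈ S.erase a, ∀ e ∈ S.erase a, α * l' c + m c = 0 → α * l' e + m e = 0 → c = e := by
    intro α c hc e he h1 h2
    by_contra hce
    have hcS := Finset.mem_of_mem_erase hc
    have heS := Finset.mem_of_mem_erase he
    have hz : ∑ v ∈ S, (α * l' v + m v) • y v = 0 := by
      simp only [add_smul, Finset.sum_add_distrib, mul_smul, ← Finset.smul_sum, hl'0, hmS]; simp
    have hec : e ∈ S.erase c := Finset.mem_erase.2 ⟨Ne.symm hce, heS⟩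
    have hz2 : ∑ v ∈ (S.erase c).erase e, (α * l' v + m v) • y v = 0 := by
      rw [← Finset.sum_erase_add _ _ hcS, h1, zero_smul, add_zero,
        ← Finset.sum_erase_add _ _ hec, h2, zero_smul, add_zero] at hz
      exact hz
    have := hy _ (fun v hv => Finset.mem_of_mem_erase (Finset.mem_of_mem_erase hv))
      (by rw [Finset.card_erase_of_mem hec, Finset.card_erase_of_mem hcS, hS]; rfl) _ hz2 a
      (Finset.mem_erase.2 ⟨(Finset.ne_of_mem_erase he).symm, Finset.mem_erase.2 ⟨(Finset.ne_of_mem_erase hc).symm, ha⟩⟩)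
    simp [hl'a, hma] at this
  refine ⟨b, hbS, hba, ?_, ?_⟩
  · set α := - m b / l' b with hα
    have hbz : α * l' b + m b = 0 := by
      rw [hα, div_mul_cancel₀ _ (hl'p b hb).ne']; ring
    refine ⟨fun v => α * l' v + m v, ?_, ?_⟩
    · intro v hv
      have hvS := Finset.mem_of_mem_erase hv
      have hvb := Finset.ne_of_mem_erase hv
      by_cases hva : v = a
      · subst hva; simp [hl'a, hma]
      · have hvE : v ∈ S.erase a := Finset.mem_erase.2 ⟨hva, hvS⟩
        have h1 := hbmax v hvE
        have h2 : 0 ≤ α * l' v + m v := by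
          have : - m v ≤ α * l' v := by rwa [div_le_iff₀ (hl'p v hvE)] at h1
          linarith
        rcases h2.lt_or_eq with h | h
        · exact h
        · exact absurd (two α v hvE b hb h.symm hbz) hvb
    · rw [key (fun v => α * l' v + m v) b hbS hbz]
      simp only [add_smul, Finset.sum_add_distrib, mul_smul, ← Finset.smul_sum, hl'0, hmS]; simp
  · intro c hc hca' ⟨n, hn, hn0⟩
    -- n restricted, scaled to value 1 at a
    have hac : a ∈ S.erase c := Finset.mem_erase.2 ⟨Ne.symm hca', ha⟩
    have hna := hn a hac
    have hcE : c ∈ S.erase a := Finset.mem_erase.2 ⟨hca', hc⟩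
    set n' : V → ℝ := fun v => if v = c then 0 else n v / n a with hn'
    have hn'0 : ∑ v ∈ S, n' v • y v = 0 := by
      rw [← key n' c hc (by simp [hn'])]
      have : ∑ v ∈ S.erase c, n' v • y v = (n a)⁻¹ • ∑ v ∈ S.erase c, n v • y v := by
        rw [Finset.smul_sum]
        apply Finset.sum_congr rfl
        intro v hv
        simp only [hn']; rw [if_neg (Finset.ne_of_mem_erase hv), smul_smul, div_eq_inv_mul]
      rw [this, hn0, smul_zero]
    set α := - m c / l' c with hα
    have hcz : α * l' c + m c = 0 := by
      rw [hα, div_mul_cancel₀ _ (hl'p c hcE).ne']; ring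
    -- n' - (α l' + m) vanishes at a and c hence everywhere
    have hn'a : n' a = 1 := by
      simp only [hn']; rw [if_neg (Ne.symm hca'), div_self hna.ne']
    have heq : ∀ v ∈ S, n' v = α * l' v + m v := by
      have hz : ∑ v ∈ S, (n' v - (α * l' v + m v)) • y v = 0 := by
        simp only [sub_smul, add_smul, Finset.sum_add_distrib, Finset.sum_sub_distrib, mul_smul,
          ← Finset.smul_sum, hl'0, hmS, hn'0]; simp
      have hcc : n' c - (α * l' c + m c) = 0 := by rw [hcz]; simp [hn']
      have haa : n' a - (α * l' a + m a) = 0 := by rw [hn'a, hl'a, hma]; ring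
      have hz2 : ∑ v ∈ (S.erase c).erase a, (n' v - (α * l' v + m v)) • y v = 0 := by
        rw [← Finset.sum_erase_add _ _ hc, hcc, zero_smul, add_zero,
          ← Finset.sum_erase_add _ _ hac, haa, zero_smul, add_zero] at hz
        exact hz
      have h3 := hy _ (fun v hv => Finset.mem_of_mem_erase (Finset.mem_of_mem_erase hv))
        (by rw [Finset.card_erase_of_mem hac, Finset.card_erase_of_mem hc, hS]; rfl) _ hz2
      intro v hv
      by_cases hva : v = a
      · subst hva; linarith
      by_cases hvc : v = c
      · subst hvc; linarith
      · have := h3 v (Finset.mem_erase.2 ⟨hva, Finset.mem_erase.2 ⟨hvc, hv⟩⟩)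
        linarith
    by_contra hcb
    have hbc : b ∈ S.erase c := Finset.mem_erase.2 ⟨Ne.symm hcb, hbS⟩
    have h1 : 0 < α * l' b + m b := by
      rw [← heq b hbS]
      simp only [hn']; rw [if_neg (Ne.symm hcb)]
      exact div_pos (hn b hbc) hna
    have h2 := hbmax c hcE
    have h3 : α * l' b ≤ - m b := by
      calc α * l' b ≤ (- m b / l' b) * l' b := by
            apply mul_le_mul_of_nonneg_right h2 (hl'p b hb).le
        _ = - m b := div_mul_cancel₀ _ (hl'p b hb).ne'
    linarith

lemma posDep_even {V : Type*} {N : ℕ} {y : V → (Fin N → ℝ)} {S : Finset V}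
    (hy : Gen y (S : Set V)) (hS : S.card = N + 2) :
    ∑ a ∈ S, (if PosDep y (S.erase a) then (1 : ZMod 2) else 0) = 0 := by
  by_cases h : ∃ a ∈ S, PosDep y (S.erase a)
  · obtain ⟨a, ha, hpa⟩ := h
    obtain ⟨b, hb, hba, hpb, hu⟩ := posDep_unique hy hS ha hpa
    rw [← Finset.sum_subset (s₁ := {a, b})]
    · rw [Finset.sum_pair hba.symm, if_pos hpa, if_pos hpb]; rfl
    · intro v hv; simp only [Finset.mem_insert, Finset.mem_singleton] at hv
      rcases hv with rfl | rfl <;> assumption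
    · intro v hv hv2
      rw [if_neg]
      intro hp
      simp only [Finset.mem_insert, Finset.mem_singleton, not_or] at hv2
      exact hv2.2 (hu v hv hv2.1 hp)
  · apply Finset.sum_eq_zero
    intro a ha
    rw [if_neg fun hp => h ⟨a, ha, hp⟩]

end Emb

namespace Emb
open scoped Classical

def Cross {V : Type*} {N : ℕ} (x : V → (Fin N → ℝ)) (A B : Finset V) : Prop :=
  Disjoint A B ∧ ∃ l : V → ℝ, (∀ a ∈ A, 0 < l a) ∧ (∀ b ∈ B, 0 < l b) ∧
    ∑ a ∈ A, l a • x a = ∑ b ∈ B, l b • x b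

lemma Cross.symm {V : Type*} {N : ℕ} {x : V → (Fin N → ℝ)} {A B : Finset V} (h : Cross x A B) :
    Cross x B A := by
  obtain ⟨h, l, h1, h2, h3⟩ := h
  exact ⟨h.symm, l, h2, h1, h3.symm⟩

noncomputable def JJ {V : Type*} {N : ℕ} (x : V → (Fin N → ℝ)) :
    Ch V →ₗ[ZMod 2] Ch V →ₗ[ZMod 2] ZMod 2 :=
  Finsupp.linearCombination (ZMod 2) (fun A =>
    Finsupp.linearCombination (ZMod 2) (fun B => if Cross x A B then (1 : ZMod 2) else 0))

lemma JJ_sg {V : Type*} {N : ℕ} (x : V → (Fin N → ℝ)) (A B : Finset V) :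
    JJ x (sg A) (sg B) = if Cross x A B then 1 else 0 := by
  simp [JJ, sg, Finsupp.linearCombination_single]

lemma JJ_symm {V : Type*} {N : ℕ} (x : V → (Fin N → ℝ)) (z w : Ch V) :
    JJ x z w = JJ x w z := by
  have : JJ x = (JJ x).flip := by
    apply lin_ext
    intro A
    apply lin_ext
    intro B
    rw [LinearMap.flip_apply, JJ_sg, JJ_sg]
    have : Cross x A B ↔ Cross x B A := ⟨Cross.symm, Cross.symm⟩
    simp only [this]
  conv_lhs => rw [this]
  rfl

lemma cross_iff_posDep {V : Type*} {N : ℕ} (x : V → (Fin N → ℝ)) {A B : Finset V} (B0 : Finset V)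
    (hA : Disjoint A B0) (hB : B ⊆ B0) :
    Cross x A B ↔ PosDep (fun v => if v ∈ B0 then - x v else x v) (A ∪ B) := by
  have hAB : Disjoint A B := Finset.disjoint_of_subset_right hB hA
  have hs : ∀ l : V → ℝ, (∑ v ∈ A ∪ B, l v • (if v ∈ B0 then - x v else x v)) =
      ∑ a ∈ A, l a • x a - ∑ b ∈ B, l b • x b := by
    intro l
    rw [Finset.sum_union hAB, sub_eq_add_neg, ← Finset.sum_neg_distrib]
    congr 1
    · apply Finset.sum_congr rfl
      intro a ha
      rw [if_neg (Finset.disjoint_left.1 hA ha)]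
    · apply Finset.sum_congr rfl
      intro b hb
      rw [if_pos (hB hb), smul_neg]
  constructor
  · rintro ⟨-, l, h1, h2, h3⟩
    refine ⟨l, ?_, ?_⟩
    · intro v hv
      rcases Finset.mem_union.1 hv with h | h
      · exact h1 v h
      · exact h2 v h
    · rw [hs, h3, sub_self]
  · rintro ⟨l, h1, h2⟩
    refine ⟨hAB, l, fun a ha => h1 a (Finset.mem_union_left _ ha),
      fun a ha => h1 a (Finset.mem_union_right _ ha), ?_⟩
    rw [hs, sub_eq_zero] at h2
    exact h2

lemma Gen.mono {V : Type*} {N : ℕ} {y : V → (Fin N → ℝ)} {L L' : Set V} (h : Gen y L) (hL : L' ⊆ L) :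
    Gen y L' := fun S hS => h S fun v hv => hL (hS v hv)

lemma Gen.sign {V : Type*} {N : ℕ} {y : V → (Fin N → ℝ)} {L : Set V} (h : Gen y L) (B : Finset V) :
    Gen (fun v => if v ∈ B then - y v else y v) L := by
  intro S hS hc l hl v hv
  have := h S hS hc (fun v => if v ∈ B then - l v else l v) (by
    rw [← hl]
    apply Finset.sum_congr rfl
    intro v _
    by_cases hB : v ∈ B <;> simp [hB]) v hv
  by_cases hB : v ∈ B <;> simpa [hB] using this

lemma JJ_bd_sg {V : Type*} {N : ℕ} {x : V → (Fin N → ℝ)} {A B : Finset V}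
    (hx : Gen x ((A ∪ B : Finset V) : Set V)) (hd : Disjoint A B) (hc : A.card + B.card = N + 2) :
    JJ x (bd (sg A)) (sg B) = JJ x (sg A) (bd (sg B)) := by
  have h := posDep_even (hx.sign B) (by rw [Finset.card_union_of_disjoint hd, hc])
  rw [Finset.sum_union hd] at h
  rw [bd_sg, bd_sg, map_sum, map_sum, LinearMap.sum_apply, ← CharTwo.add_eq_zero]
  convert h using 1
  congr 1
  · apply Finset.sum_congr rfl
    intro a ha
    rw [JJ_sg, cross_iff_posDep x B (Finset.disjoint_of_subset_left (Finset.erase_subset _ _) hd) subset_rfl,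
      Finset.erase_union_distrib, Finset.erase_eq_of_notMem (Finset.disjoint_left.1 hd ha)]
  · apply Finset.sum_congr rfl
    intro a ha
    rw [JJ_sg, cross_iff_posDep x B hd (Finset.erase_subset _ _),
      Finset.erase_union_distrib, Finset.erase_eq_of_notMem (Finset.disjoint_right.1 hd ha)]

lemma JJ_bd {V : Type*} {N : ℕ} {x : V → (Fin N → ℝ)} {L L1 L2 : Set V} (hx : Gen x L)
    (h1 : L1 ⊆ L) (h2 : L2 ⊆ L) (hd : Disjoint L1 L2) {k l : ℕ} (hkl : k + l = N + 2)
    {z w : Ch V} (hz : z ∈ Sup (Sx k L1)) (hw : w ∈ Sup (Sx l L2)) :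
    JJ x (bd z) w = JJ x z (bd w) := by
  refine Sup_ext (P := Sx l L2) (JJ x (bd z)) (JJ x z ∘ₗ bd) ?_ hw
  rintro B ⟨hB, hBL⟩
  refine Sup_ext (P := Sx k L1) ((JJ x).flip (sg B) ∘ₗ bd) ((JJ x).flip (bd (sg B))) ?_ hz
  rintro A ⟨hA, hAL⟩
  simp only [LinearMap.comp_apply, LinearMap.flip_apply]
  apply JJ_bd_sg
  · apply hx.mono
    intro v hv
    rcases Finset.mem_union.1 (Finset.mem_coe.1 hv) with h | h
    · exact h1 (hAL v h)
    · exact h2 (hBL v h)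
  · rw [Finset.disjoint_left]
    intro v hv hv'
    exact Set.disjoint_left.1 hd (hAL v hv) (hBL v hv')
  · rw [hA, hB, hkl]

lemma dbl_sum_zero {V M : Type*} [hV : DecidableEq V] [AddCommGroup M] [Module (ZMod 2) M] (φ : Finset V → M) (ρ : Finset V) :
    ∑ i ∈ ρ, ∑ j ∈ ρ.erase i, φ ((ρ.erase i).erase j) = 0 := by
  have : hV = fun a b => Classical.propDecidable (a = b) := Subsingleton.elim _ _
  subst this
  have h := congrArg (Finsupp.linearCombination (ZMod 2) φ) (bd_bd (sg ρ))
  rw [bd_sg, map_sum, map_sum, map_zero] at h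
  rw [← h]
  apply Finset.sum_congr rfl
  intro i _
  rw [bd_sg, map_sum]
  apply Finset.sum_congr rfl
  intro j _
  simp [sg, Finsupp.linearCombination_single]

/-! ### The van Kampen number -/

noncomputable def PPo (T d : ℕ) : Finset (Finset (Fin T) × Finset (Fin T)) :=
  Finset.univ.filter fun p => p.1.card = d + 1 ∧ p.2.card = d + 1 ∧ Disjoint p.1 p.2

noncomputable def PP (T d : ℕ) : Finset (Finset (Fin T) × Finset (Fin T)) :=
  (PPo T d).filter fun p => Fintype.equivFin _ p.1 < Fintype.equivFin _ p.2

noncomputable def XX {V : Type*} {N : ℕ} (x : V → (Fin N → ℝ)) (T d : ℕ) (c : Finset (Fin T) → Ch V) : ZMod 2 :=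
  ∑ p ∈ PP T d, JJ x (c p.1) (c p.2)

lemma sum_PPo {M : Type*} [AddCommMonoid M] (T d : ℕ) (f : Finset (Fin T) → Finset (Fin T) → M) :
    ∑ p ∈ PPo T d, f p.1 p.2 = ∑ p ∈ PP T d, (f p.1 p.2 + f p.2 p.1) := by
  rw [Finset.sum_add_distrib,
    ← Finset.sum_filter_add_sum_filter_not (PPo T d) (fun p => Fintype.equivFin _ p.1 < Fintype.equivFin _ p.2)]
  congr 1
  refine Finset.sum_nbij' Prod.swap Prod.swap ?_ ?_ ?_ ?_ ?_
  · rintro ⟨a, b⟩ h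
    simp only [PP, PPo, Finset.mem_filter, Finset.mem_univ, true_and, Prod.swap_prod_mk] at h ⊢
    obtain ⟨⟨h1, h2, h3⟩, h4⟩ := h
    refine ⟨⟨h2, h1, h3.symm⟩, lt_of_le_of_ne (not_lt.1 h4) ?_⟩
    intro h
    have h := (Fintype.equivFin _).injective h
    subst h
    rw [disjoint_self] at h3
    subst h3
    simp at h1
  · rintro ⟨a, b⟩ h
    simp only [PP, PPo, Finset.mem_filter, Finset.mem_univ, true_and, Prod.swap_prod_mk] at h ⊢
    obtain ⟨⟨h1, h2, h3⟩, h4⟩ := h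
    exact ⟨⟨h2, h1, h3.symm⟩, not_lt.2 h4.le⟩
  · intros; rfl
  · intros; rfl
  · rintro ⟨a, b⟩ _; rfl

lemma XX_add {V : Type*} {N : ℕ} (x : V → (Fin N → ℝ)) (T d : ℕ) (c q : Finset (Fin T) → Ch V)
    (hq : ∀ p ∈ PPo T d, q p.1 = 0 ∨ q p.2 = 0) :
    XX x T d (c + q) = XX x T d c + ∑ p ∈ PPo T d, JJ x (q p.1) (c p.2) := by
  rw [sum_PPo T d (fun a b => JJ x (q a) (c b)), XX, XX, ← Finset.sum_add_distrib]
  apply Finset.sum_congr rfl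
  intro p hp
  have h0 : JJ x (q p.1) (q p.2) = 0 := by
    rcases hq p (Finset.mem_filter.1 hp).1 with h | h <;> simp [h]
  simp only [Pi.add_apply, map_add, LinearMap.add_apply, h0, JJ_symm x (q p.2)]
  ring

/-- labels carried by σ -/
def Lab {V : Type*} {T : ℕ} (L : Set V) (S : V → Finset (Fin T)) (σ : Finset (Fin T)) : Set V :=
  {v | v ∈ L ∧ S v ⊆ σ}

lemma Lab_mono {V : Type*} {T : ℕ} {L : Set V} {S : V → Finset (Fin T)} {σ τ : Finset (Fin T)}
    (h : σ ⊆ τ) : Lab L S σ ⊆ Lab L S τ := fun _ hv => ⟨hv.1, hv.2.trans h⟩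

lemma Lab_disj {V : Type*} {T : ℕ} {L : Set V} {S : V → Finset (Fin T)} (hS : ∀ v ∈ L, (S v).Nonempty)
    {σ τ : Finset (Fin T)} (h : Disjoint σ τ) : Disjoint (Lab L S σ) (Lab L S τ) := by
  rw [Set.disjoint_left]
  intro v h1 h2
  obtain ⟨i, hi⟩ := hS v h1.1
  exact Finset.disjoint_left.1 h (h1.2 hi) (h2.2 hi)

structure GoodC {V : Type*} {T : ℕ} (L : Set V) (S : V → Finset (Fin T)) (d : ℕ)
    (c : Finset (Fin T) → Ch V) : Prop where
  car : ∀ σ, σ.card = d + 1 → c σ ∈ Sup (Sx (d+1) (Lab L S σ))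
  cyc : ∀ U : Finset (Fin T), U.card = d + 2 → bd (∑ τ ∈ U.powersetCard (d+1), c τ) = 0

lemma move1 {V : Type*} {d : ℕ} {x : V → (Fin (2*d+1) → ℝ)} {L : Set V}
    {S : V → Finset (Fin (2*d+3))} (hS : ∀ v ∈ L, (S v).Nonempty) (hx : Gen x L)
    {c : Finset (Fin (2*d+3)) → Ch V} (hc : GoodC L S d c) {σ : Finset (Fin (2*d+3))}
    (hσ : σ.card = d + 1) {w : Ch V} (hw : w ∈ Sup (Sx (d+2) (Lab L S σ))) :
    GoodC L S d (c + fun τ => if τ = σ then bd w else 0) ∧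
    XX x (2*d+3) d (c + fun τ => if τ = σ then bd w else 0) = XX x (2*d+3) d c := by
  refine ⟨⟨?_, ?_⟩, ?_⟩
  · intro τ hτ
    refine Submodule.add_mem _ (hc.car τ hτ) ?_
    dsimp only
    split_ifs with h
    · subst h; exact bd_mem hw
    · exact Submodule.zero_mem _
  · intro U hU
    simp only [Pi.add_apply, Finset.sum_add_distrib, map_add, hc.cyc U hU, zero_add, map_sum]
    apply Finset.sum_eq_zero
    intro τ _
    split_ifs
    · exact bd_bd w
    · simp
  · rw [XX_add]
    · have : ∑ p ∈ PPo (2*d+3) d, JJ x (if p.1 = σ then bd w else 0) (c p.2) =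
          ∑ τ ∈ (σᶜ).powersetCard (d+1), JJ x (bd w) (c τ) := by
        rw [← Finset.sum_filter_of_ne (p := fun p => p.1 = σ)]
        · refine Finset.sum_nbij' (fun p => p.2) (fun τ => (σ, τ)) ?_ ?_ ?_ ?_ ?_
          · rintro ⟨a, b⟩ h
            simp only [PPo, Finset.mem_filter, Finset.mem_univ, true_and, Finset.mem_powersetCard] at h ⊢
            obtain ⟨⟨h1, h2, h3⟩, rfl⟩ := h
            exact ⟨Finset.subset_compl_iff_disjoint_left.2 h3, h2⟩
          · intro τ h
            simp only [PPo, Finset.mem_filter, Finset.mem_univ, true_and, Finset.mem_powersetCard, and_true] at h ⊢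
            exact ⟨hσ, h.2, Finset.subset_compl_iff_disjoint_left.1 h.1⟩
          · rintro ⟨a, b⟩ h
            simp only [Finset.mem_filter] at h
            simp [h.2]
          · intros; rfl
          · rintro ⟨a, b⟩ h
            simp only [Finset.mem_filter] at h
            simp [h.2]
        · rintro ⟨a, b⟩ _ h
          by_contra hne
          exact h (by simp only at hne; simp [hne])
      rw [this, ← map_sum]
      have hcard : (σᶜ).card = d + 2 := by
        rw [Finset.card_compl, Fintype.card_fin, hσ]; omega
      rw [JJ_bd (L1 := Lab L S σ) (L2 := Lab L S σᶜ) (k := d+2) (l := d+1) hx (fun v hv => hv.1)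
        (fun v hv => hv.1) (Lab_disj hS disjoint_compl_right) (by omega) hw, hc.cyc _ hcard, map_zero, add_zero]
      refine Submodule.sum_mem _ fun τ hτ => ?_
      rw [Finset.mem_powersetCard] at hτ
      exact Sup_mono (Sx_mono (Lab_mono hτ.1)) (hc.car τ hτ.2)
    · rintro ⟨a, b⟩ h
      simp only [PPo, Finset.mem_filter, Finset.mem_univ, true_and] at h
      by_cases ha : a = σ
      · right
        dsimp only
        rw [if_neg]
        rintro rfl
        subst ha
        have := disjoint_self.1 h.2.2
        rw [this] at hσ
        simp at hσ
      · left; simp [ha]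

lemma card_between {T k : ℕ} {ρ U : Finset (Fin T)} (hρ : ρ ⊆ U) (hk : ρ.card = k) (hU : U.card = k + 2) :
    ((U.powersetCard (k+1)).filter (fun σ => ρ ⊆ σ)).card = 2 := by
  have : (U.powersetCard (k+1)).filter (fun σ => ρ ⊆ σ) = (U \ ρ).image (fun i => insert i ρ) := by
    ext σ
    simp only [Finset.mem_filter, Finset.mem_powersetCard, Finset.mem_image, Finset.mem_sdiff]
    constructor
    · rintro ⟨⟨h1, h2⟩, h3⟩
      have : (σ \ ρ).card = 1 := by rw [Finset.card_sdiff_of_subset h3]; omega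
      obtain ⟨i, hi⟩ := Finset.card_eq_one.1 this
      have hi' : i ∈ σ \ ρ := by rw [hi]; simp
      rw [Finset.mem_sdiff] at hi'
      refine ⟨i, ⟨h1 hi'.1, hi'.2⟩, ?_⟩
      rw [Finset.insert_eq, ← hi, Finset.sdiff_union_of_subset h3]
    · rintro ⟨i, ⟨hi, hi2⟩, rfl⟩
      exact ⟨⟨Finset.insert_subset hi hρ, by rw [Finset.card_insert_of_notMem hi2, hk]⟩, Finset.subset_insert _ _⟩
  rw [this, Finset.card_image_of_injOn, Finset.card_sdiff_of_subset hρ]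
  · omega
  · intro i hi j hj h
    simp only [Finset.coe_sdiff, Set.mem_sdiff, Finset.mem_coe] at hi hj
    have : i ∈ insert j ρ := by rw [← show insert i ρ = insert j ρ from h]; simp
    rcases Finset.mem_insert.1 this with h | h
    · exact h
    · exact absurd h hi.2

lemma two_nsmul_zero {M : Type*} [AddCommGroup M] [Module (ZMod 2) M] (z : M) : (2 : ℕ) • z = 0 := by
  rw [two_nsmul]; exact ZModModule.add_self z

lemma move2 {V : Type*} {d : ℕ} (hd : 1 ≤ d) {x : V → (Fin (2*d+1) → ℝ)} {L : Set V}
    {S : V → Finset (Fin (2*d+3))}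
    {c : Finset (Fin (2*d+3)) → Ch V} (hc : GoodC L S d c) {ρ : Finset (Fin (2*d+3))}
    (hρ : ρ.card = d) {w : Ch V} (hw : w ∈ Sup (Sx (d+1) (Lab L S ρ))) :
    GoodC L S d (c + fun τ => if ρ ⊆ τ then w else 0) ∧
    XX x (2*d+3) d (c + fun τ => if ρ ⊆ τ then w else 0) = XX x (2*d+3) d c := by
  refine ⟨⟨?_, ?_⟩, ?_⟩
  · intro τ hτ
    refine Submodule.add_mem _ (hc.car τ hτ) ?_
    dsimp only
    split_ifs with h
    · exact Sup_mono (Sx_mono (Lab_mono h)) hw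
    · exact Submodule.zero_mem _
  · intro U hU
    simp only [Pi.add_apply, Finset.sum_add_distrib, map_add, hc.cyc U hU, zero_add]
    rw [← Finset.sum_filter, Finset.sum_const]
    by_cases h : ρ ⊆ U
    · rw [card_between h hρ hU, two_nsmul_zero, map_zero]
    · rw [Finset.filter_false_of_mem, Finset.card_empty, zero_smul, map_zero]
      intro σ hσ h'
      exact h (h'.trans (Finset.mem_powersetCard.1 hσ).1)
  · rw [XX_add]
    · have : ∑ p ∈ PPo (2*d+3) d, JJ x (if ρ ⊆ p.1 then w else 0) (c p.2) =
          ∑ τ ∈ (Finset.univ : Finset (Finset (Fin (2*d+3)))).filter (fun τ => τ.card = d+1 ∧ Disjoint ρ τ),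
            ∑ σ ∈ ((τᶜ).powersetCard (d+1)).filter (fun σ => ρ ⊆ σ), JJ x w (c τ) := by
        rw [Finset.sum_sigma']
        rw [← Finset.sum_filter_of_ne (p := fun p => ρ ⊆ p.1)]
        · refine Finset.sum_nbij' (fun p => ⟨p.2, p.1⟩) (fun q => (q.2, q.1)) ?_ ?_ ?_ ?_ ?_
          · rintro ⟨a, b⟩ h
            simp only [PPo, Finset.mem_filter, Finset.mem_univ, true_and, Finset.mem_powersetCard, Finset.mem_sigma] at h ⊢
            obtain ⟨⟨h1, h2, h3⟩, h4⟩ := h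
            exact ⟨⟨h2, Finset.disjoint_of_subset_left h4 h3⟩, ⟨Finset.subset_compl_iff_disjoint_right.2 h3, h1⟩, h4⟩
          · rintro ⟨a, b⟩ h
            simp only [PPo, Finset.mem_filter, Finset.mem_univ, true_and, Finset.mem_powersetCard, Finset.mem_sigma] at h ⊢
            obtain ⟨⟨h1, h2⟩, ⟨h3, h4⟩, h5⟩ := h
            exact ⟨⟨h4, h1, Finset.subset_compl_iff_disjoint_right.1 h3⟩, h5⟩
          · intros; rfl
          · intros; rfl
          · rintro ⟨a, b⟩ h
            simp only [Finset.mem_filter] at h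
            simp [h.2]
        · rintro ⟨a, b⟩ _ h
          by_contra hne
          exact h (by simp only at hne; simp [hne])
      rw [this, Finset.sum_eq_zero, add_zero]
      intro τ hτ
      simp only [Finset.mem_filter, Finset.mem_univ, true_and] at hτ
      rw [Finset.sum_const, card_between (Finset.subset_compl_iff_disjoint_right.2 hτ.2) hρ, two_nsmul_zero]
      rw [Finset.card_compl, Fintype.card_fin, hτ.1]; omega
    · rintro ⟨a, b⟩ h
      simp only [PPo, Finset.mem_filter, Finset.mem_univ, true_and] at h
      by_cases ha : ρ ⊆ a
      · right
        dsimp only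
        rw [if_neg]
        intro hb
        have : ρ.card = 0 := by
          rw [Finset.card_eq_zero, ← Finset.subset_empty]
          intro i hi
          exact absurd (hb hi) (Finset.disjoint_left.1 h.2.2 (ha hi))
        omega
      · left; simp [ha]

/-- carried chain map -/
structure Carried {V : Type*} {T : ℕ} (L : Set V) (S : V → Finset (Fin T)) (d : ℕ)
    (c : Finset (Fin T) → Ch V) : Prop where
  emp : c ∅ = sg ∅
  car : ∀ σ, σ.card ≤ d + 1 → c σ ∈ Sup (Sx σ.card (Lab L S σ))
  map : ∀ σ, σ.card ≤ d + 1 → bd (c σ) = ∑ i ∈ σ, c (σ.erase i)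

lemma Carried.good {V : Type*} {T : ℕ} {L : Set V} {S : V → Finset (Fin T)} {d : ℕ}
    {c : Finset (Fin T) → Ch V} (h : Carried L S d c) : GoodC L S d c := by
  refine ⟨fun σ hσ => ?_, fun U hU => ?_⟩
  · have := h.car σ hσ.le
    rwa [hσ] at this
  · have h2 := dbl_sum_zero c U
    have : U.powersetCard (d+1) = U.image (fun i => U.erase i) := by
      ext τ
      simp only [Finset.mem_powersetCard, Finset.mem_image]
      constructor
      · rintro ⟨h1, h2⟩
        have : (U \ τ).card = 1 := by rw [Finset.card_sdiff_of_subset h1]; omega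
        obtain ⟨i, hi⟩ := Finset.card_eq_one.1 this
        have hi' : i ∈ U \ τ := by rw [hi]; simp
        refine ⟨i, (Finset.mem_sdiff.1 hi').1, ?_⟩
        rw [← Finset.sdiff_singleton_eq_erase, ← hi, Finset.sdiff_sdiff_eq_self h1]
      · rintro ⟨i, hi, rfl⟩
        exact ⟨Finset.erase_subset _ _, by rw [Finset.card_erase_of_mem hi, hU]; rfl⟩
    rw [this, Finset.sum_image (Finset.erase_injOn U), map_sum, ← h2]
    apply Finset.sum_congr rfl
    intro i hi
    rw [h.map]
    rw [Finset.card_erase_of_mem hi, hU]; omega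

noncomputable def hN {V : Type*} {T : ℕ} (a : Finset (Fin T) → V) (c g : Finset (Fin T) → Ch V) :
    ℕ → Finset (Fin T) → Ch V
  | 0, _ => 0
  | k+1, ρ => cone (a ρ) (c ρ + g ρ + ∑ i ∈ ρ, hN a c g k (ρ.erase i))

lemma hN_spec {V : Type*} {T : ℕ} {L : Set V} {S : V → Finset (Fin T)} {d : ℕ}
    {a : Finset (Fin T) → V} (ha : ∀ ρ, ρ.Nonempty → a ρ ∈ Lab L S ρ)
    {c g : Finset (Fin T) → Ch V} (hc : Carried L S d c) (hg : Carried L S d g) (k : ℕ) :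
    ∀ ρ : Finset (Fin T), ρ.card = k → k ≤ d + 1 →
      bd (hN a c g k ρ) = c ρ + g ρ + ∑ i ∈ ρ, hN a c g (k-1) (ρ.erase i) ∧
      hN a c g k ρ ∈ Sup (Sx (k+1) (Lab L S ρ)) := by
  induction k with
  | zero =>
    intro ρ hρ _
    rw [Finset.card_eq_zero] at hρ
    subst hρ
    refine ⟨?_, Submodule.zero_mem _⟩
    simp [hN, hc.emp, hg.emp, ch_add_self]
  | succ k ih =>
    intro ρ hρ hk
    have hne : ρ.Nonempty := by rw [← Finset.card_pos]; omega
    have hce : ∀ i ∈ ρ, (ρ.erase i).card = k := fun i hi => by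
      rw [Finset.card_erase_of_mem hi, hρ]; rfl
    constructor
    · rw [hN, bd_cone]
      suffices h : bd (c ρ + g ρ + ∑ i ∈ ρ, hN a c g k (ρ.erase i)) = 0 by
        rw [h, map_zero, add_zero]; rfl
      rw [map_add, map_add, hc.map ρ (by omega), hg.map ρ (by omega), map_sum,
        Finset.sum_congr rfl (fun i hi => (ih (ρ.erase i) (hce i hi) (by omega)).1),
        Finset.sum_add_distrib, Finset.sum_add_distrib, dbl_sum_zero, add_zero, ch_add_self]
    · rw [hN]
      apply cone_mem (ha ρ hne)
      refine Submodule.add_mem _ (Submodule.add_mem _ ?_ ?_) (Submodule.sum_mem _ fun i hi => ?_)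
      · have := hc.car ρ (by omega); rwa [hρ] at this
      · have := hg.car ρ (by omega); rwa [hρ] at this
      · exact Sup_mono (Sx_mono (Lab_mono (Finset.erase_subset _ _))) (ih (ρ.erase i) (hce i hi) (by omega)).2

theorem XX_eq {V : Type*} {d : ℕ} (hd : 1 ≤ d) {x : V → (Fin (2*d+1) → ℝ)} {L : Set V}
    {S : V → Finset (Fin (2*d+3))} (hS : ∀ v ∈ L, (S v).Nonempty) (hx : Gen x L)
    (hL : ∀ i, ∃ v ∈ L, S v ⊆ {i})
    {c g : Finset (Fin (2*d+3)) → Ch V} (hc : Carried L S d c) (hg : Carried L S d g) :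
    XX x (2*d+3) d c = XX x (2*d+3) d g := by
  have : ∀ ρ : Finset (Fin (2*d+3)), ∃ v, ρ.Nonempty → v ∈ Lab L S ρ := by
    intro ρ
    by_cases h : ρ.Nonempty
    · obtain ⟨i, hi⟩ := h
      obtain ⟨v, hv, hv2⟩ := hL i
      exact ⟨v, fun _ => ⟨hv, hv2.trans (by simpa using hi)⟩⟩
    · obtain ⟨v, hv⟩ := hL 0
      exact ⟨v, fun h' => absurd h' h⟩
  choose a ha using this
  have hspec := hN_spec ha hc hg
  set h := hN a c g with hh
  -- first stage
  have st1 : ∀ R : Finset (Finset (Fin (2*d+3))), (∀ ρ ∈ R, ρ.card = d) →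
      GoodC L S d (g + fun τ => ∑ ρ ∈ R, if ρ ⊆ τ then h d ρ else 0) ∧
      XX x (2*d+3) d (g + fun τ => ∑ ρ ∈ R, if ρ ⊆ τ then h d ρ else 0) = XX x (2*d+3) d g := by
    intro R
    induction R using Finset.induction_on with
    | empty =>
      intro _
      have : (g + fun τ : Finset (Fin (2*d+3)) => ∑ ρ ∈ (∅ : Finset (Finset (Fin (2*d+3)))), if ρ ⊆ τ then h d ρ else 0) = g := by
        ext1 τ; simp
      rw [this]; exact ⟨hg.good, rfl⟩
    | insert ρ R hρ ih =>
      intro hR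
      obtain ⟨i1, i2⟩ := ih fun ρ' h' => hR ρ' (Finset.mem_insert_of_mem h')
      have hρd := hR ρ (Finset.mem_insert_self _ _)
      obtain ⟨m1, m2⟩ := move2 hd (x := x) i1 hρd (hspec d ρ hρd (by omega)).2
      have : (g + fun τ => ∑ ρ ∈ insert ρ R, if ρ ⊆ τ then h d ρ else 0) =
          ((g + fun τ => ∑ ρ ∈ R, if ρ ⊆ τ then h d ρ else 0) + fun τ => if ρ ⊆ τ then h d ρ else 0) := by
        ext1 τ
        simp only [Pi.add_apply, Finset.sum_insert hρ]
        abel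
      rw [this]
      exact ⟨m1, m2.trans i2⟩
  obtain ⟨g1, e1⟩ := st1 (Finset.univ.powersetCard d) (fun ρ h => (Finset.mem_powersetCard.1 h).2)
  set c1 := (g + fun τ => ∑ ρ ∈ Finset.univ.powersetCard d, if ρ ⊆ τ then h d ρ else 0) with hc1
  have st2 : ∀ R : Finset (Finset (Fin (2*d+3))), (∀ ρ ∈ R, ρ.card = d + 1) →
      GoodC L S d (c1 + fun τ => ∑ ρ ∈ R, if τ = ρ then bd (h (d+1) ρ) else 0) ∧
      XX x (2*d+3) d (c1 + fun τ => ∑ ρ ∈ R, if τ = ρ then bd (h (d+1) ρ) else 0) = XX x (2*d+3) d g := by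
    intro R
    induction R using Finset.induction_on with
    | empty =>
      intro _
      have : (c1 + fun τ : Finset (Fin (2*d+3)) => ∑ ρ ∈ (∅ : Finset (Finset (Fin (2*d+3)))), if τ = ρ then bd (h (d+1) ρ) else 0) = c1 := by
        ext1 τ; simp
      rw [this]; exact ⟨g1, e1⟩
    | insert ρ R hρ ih =>
      intro hR
      obtain ⟨i1, i2⟩ := ih fun ρ' h' => hR ρ' (Finset.mem_insert_of_mem h')
      have hρd := hR ρ (Finset.mem_insert_self _ _)
      obtain ⟨m1, m2⟩ := move1 hS hx i1 hρd (hspec (d+1) ρ hρd (by omega)).2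
      have : (c1 + fun τ => ∑ ρ ∈ insert ρ R, if τ = ρ then bd (h (d+1) ρ) else 0) =
          ((c1 + fun τ => ∑ ρ ∈ R, if τ = ρ then bd (h (d+1) ρ) else 0) + fun τ => if τ = ρ then bd (h (d+1) ρ) else 0) := by
        ext1 τ
        simp only [Pi.add_apply, Finset.sum_insert hρ]
        abel
      rw [this]
      exact ⟨m1, m2.trans i2⟩
  obtain ⟨-, e2⟩ := st2 (Finset.univ.powersetCard (d+1)) (fun ρ h => (Finset.mem_powersetCard.1 h).2)
  rw [← e2]
  have key : ∀ τ : Finset (Fin (2*d+3)), τ.card = d + 1 →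
      c τ = (c1 + fun τ => ∑ ρ ∈ Finset.univ.powersetCard (d+1), if τ = ρ then bd (h (d+1) ρ) else 0) τ := by
    intro τ hτ
    have hsp := (hspec (d+1) τ hτ le_rfl).1
    have e3 : (∑ ρ ∈ Finset.univ.powersetCard d, if ρ ⊆ τ then h d ρ else 0) = ∑ i ∈ τ, h d (τ.erase i) := by
      rw [← Finset.sum_filter]
      have : (Finset.univ.powersetCard d).filter (fun ρ => ρ ⊆ τ) = τ.image (fun i => τ.erase i) := by
        ext ρ
        simp only [Finset.mem_filter, Finset.mem_powersetCard, Finset.mem_image, Finset.subset_univ, true_and]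
        constructor
        · rintro ⟨h2, h1⟩
          have : (τ \ ρ).card = 1 := by rw [Finset.card_sdiff_of_subset h1]; omega
          obtain ⟨i, hi⟩ := Finset.card_eq_one.1 this
          have hi' : i ∈ τ \ ρ := by rw [hi]; simp
          refine ⟨i, (Finset.mem_sdiff.1 hi').1, ?_⟩
          rw [← Finset.sdiff_singleton_eq_erase, ← hi, Finset.sdiff_sdiff_eq_self h1]
        · rintro ⟨i, hi, rfl⟩
          exact ⟨by rw [Finset.card_erase_of_mem hi, hτ]; rfl, Finset.erase_subset _ _⟩
      rw [this, Finset.sum_image (Finset.erase_injOn τ)]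
    simp only [hc1, Pi.add_apply, e3]
    rw [Finset.sum_ite_eq, if_pos (by simp [hτ]), hsp]
    have e4 := ch_add_self (g τ)
    have e5 := ch_add_self (∑ i ∈ τ, h d (τ.erase i))
    simp only [Nat.add_sub_cancel]
    calc c τ = c τ + (g τ + g τ) + (∑ i ∈ τ, h d (τ.erase i) + ∑ i ∈ τ, h d (τ.erase i)) := by rw [e4, e5]; simp
      _ = _ := by abel
  unfold XX
  apply Finset.sum_congr rfl
  intro p hp
  simp only [PP, PPo, Finset.mem_filter, Finset.mem_univ, true_and] at hp
  rw [key _ hp.1.1, key _ hp.1.2.1]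

end Emb

namespace Emb
open scoped Classical

/-! ### Moment curve -/

def mom (N : ℕ) (t : ℝ) : Fin N → ℝ := fun k => t ^ (k : ℕ)

lemma mom_poly {V : Type*} {N : ℕ} {t : V → ℝ} {S : Finset V} {l : V → ℝ}
    (h : ∑ v ∈ S, l v • mom N (t v) = 0) {P : Polynomial ℝ} (hP : P.natDegree < N) :
    ∑ v ∈ S, l v * P.eval (t v) = 0 := by
  have : ∀ k : Fin N, ∑ v ∈ S, l v * (t v) ^ (k : ℕ) = 0 := by
    intro k
    have := congrFun h k
    simpa [mom] using this
  simp only [Polynomial.eval_eq_sum_range' hP, Finset.mul_sum]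
  rw [Finset.sum_comm]
  apply Finset.sum_eq_zero
  intro k hk
  have := this ⟨k, Finset.mem_range.1 hk⟩
  simp only at this
  rw [← mul_zero (P.coeff k), ← this, Finset.mul_sum]
  exact Finset.sum_congr rfl fun v _ => by ring

lemma nd_prod {V : Type*} (t : V → ℝ) (S : Finset V) :
    (∏ w ∈ S, (Polynomial.X - Polynomial.C (t w))).natDegree = S.card := by
  rw [Polynomial.natDegree_prod_of_monic _ _ (fun w _ => Polynomial.monic_X_sub_C _)]
  simp

lemma mom_gen {V : Type*} {N : ℕ} {t : V → ℝ} {L : Set V} (ht : Set.InjOn t L) :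
    Gen (fun v => mom N (t v)) L := by
  intro S hS hN l h v hv
  have h2 := mom_poly h (P := ∏ w ∈ S.erase v, (Polynomial.X - Polynomial.C (t w))) (by
    rw [nd_prod, Finset.card_erase_of_mem hv]
    have := Finset.card_pos.2 ⟨v, hv⟩
    omega)
  simp only [Polynomial.eval_prod, Polynomial.eval_sub, Polynomial.eval_X, Polynomial.eval_C] at h2
  rw [Finset.sum_eq_single_of_mem v hv] at h2
  · rcases mul_eq_zero.1 h2 with h | h
    · exact h
    · obtain ⟨w, hw, h⟩ := Finset.prod_eq_zero_iff.1 h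
      exact absurd (ht (hS v hv) (hS w (Finset.mem_of_mem_erase hw)) (sub_eq_zero.1 h)).symm
        (Finset.ne_of_mem_erase hw)
  · intro u hu huv
    rw [Finset.prod_eq_zero (i := u) (Finset.mem_erase.2 ⟨huv, hu⟩) (sub_self _), mul_zero]

noncomputable def ee {V : Type*} (t : V → ℝ) (S : Finset V) (u : V) : ℝ :=
  ∏ w ∈ S.erase u, (t u - t w)

lemma mom_alt {V : Type*} {N : ℕ} {t : V → ℝ} {S : Finset V} (hN : S.card = N + 1) {l : V → ℝ}
    (h : ∑ v ∈ S, l v • mom N (t v) = 0) {u v : V} (hu : u ∈ S) (hv : v ∈ S) :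
    l u * ee t S u = l v * ee t S v := by
  by_cases huv : u = v
  · rw [huv]
  have hvu : v ∈ S.erase u := Finset.mem_erase.2 ⟨Ne.symm huv, hv⟩
  have huv' : u ∈ S.erase v := Finset.mem_erase.2 ⟨huv, hu⟩
  have hc : ((S.erase u).erase v).card + 1 = N := by
    rw [Finset.card_erase_of_mem hvu, Finset.card_erase_of_mem hu]
    have := Finset.card_pos.2 ⟨v, hvu⟩
    rw [Finset.card_erase_of_mem hu] at this
    omega
  have h2 := mom_poly h (P := ∏ w ∈ (S.erase u).erase v, (Polynomial.X - Polynomial.C (t w))) (by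
    rw [nd_prod]; omega)
  simp only [Polynomial.eval_prod, Polynomial.eval_sub, Polynomial.eval_X, Polynomial.eval_C] at h2
  rw [← Finset.add_sum_erase _ _ hu, ← Finset.add_sum_erase _ _ hvu, Finset.sum_eq_zero (s := (S.erase u).erase v), add_zero] at h2
  · rw [ee, ee, ← Finset.mul_prod_erase _ _ hvu, ← Finset.mul_prod_erase _ _ huv', Finset.erase_right_comm (s := S) (a := v)]
    linear_combination (t u - t v) * h2
  · intro w hw
    rw [Finset.prod_eq_zero hw (sub_self _), mul_zero]

noncomputable def ab {T : ℕ} (S : Finset (Fin T)) (u : Fin T) : ℕ := (S.filter (fun w => u < w)).card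

lemma ee_sign {T : ℕ} {t : Fin T → ℝ} (ht : StrictMono t) (S : Finset (Fin T)) (u : Fin T) :
    0 < (-1) ^ (ab S u) * ee t S u := by
  have : ee t S u = (∏ w ∈ S.filter (fun w => w < u), (t u - t w)) * ∏ w ∈ S.filter (fun w => u < w), (t u - t w) := by
    rw [ee, ← Finset.prod_union]
    · congr 1
      ext w
      simp only [Finset.mem_erase, Finset.mem_union, Finset.mem_filter]
      constructor
      · rintro ⟨h1, h2⟩
        rcases lt_or_gt_of_ne h1 with h | h <;> simp [h, h2]
      · rintro (⟨h1, h2⟩ | ⟨h1, h2⟩)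
        · exact ⟨h2.ne, h1⟩
        · exact ⟨h2.ne', h1⟩
    · rw [Finset.disjoint_left]
      intro w h1 h2
      exact lt_asymm (Finset.mem_filter.1 h1).2 (Finset.mem_filter.1 h2).2
  have h2 : ∏ w ∈ S.filter (fun w => u < w), (t u - t w) = (-1) ^ (ab S u) * ∏ w ∈ S.filter (fun w => u < w), (t w - t u) := by
    rw [ab, ← Finset.prod_const, ← Finset.prod_mul_distrib]
    exact Finset.prod_congr rfl fun w _ => by ring
  rw [this, h2]
  have h3 : ((-1 : ℝ) ^ (ab S u)) * (-1) ^ (ab S u) = 1 := by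
    rw [← mul_pow]; simp
  have h4 : 0 < ∏ w ∈ S.filter (fun w => w < u), (t u - t w) :=
    Finset.prod_pos fun w hw => sub_pos.2 (ht (Finset.mem_filter.1 hw).2)
  have h5 : 0 < ∏ w ∈ S.filter (fun w => u < w), (t w - t u) :=
    Finset.prod_pos fun w hw => sub_pos.2 (ht (Finset.mem_filter.1 hw).2)
  calc 0 < _ := mul_pos h4 h5
    _ = ((-1 : ℝ) ^ (ab S u)) * (-1) ^ (ab S u) * ((∏ w ∈ S.filter (fun w => w < u), (t u - t w)) * ∏ w ∈ S.filter (fun w => u < w), (t w - t u)) := by rw [h3, one_mul]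
    _ = _ := by ring

lemma card_ev {T : ℕ} (S : Finset (Fin T)) : (S.filter (fun u => Even (ab S u))).card = (S.card + 1) / 2 := by
  induction S using Finset.induction_on_min with
  | empty => simp
  | insert a S ha ih =>
    have haS : a ∉ S := fun h => lt_irrefl _ (ha a h)
    have h1 : ab (insert a S) a = S.card := by
      rw [ab, Finset.filter_insert, if_neg (lt_irrefl _), Finset.filter_true_of_mem ha]
    have h2 : ∀ u ∈ S, ab (insert a S) u = ab S u := by
      intro u hu
      rw [ab, Finset.filter_insert, if_neg (not_lt.2 (ha u hu).le), ab]
    rw [Finset.filter_insert, h1, Finset.card_insert_of_notMem haS,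
      Finset.filter_congr (fun u hu => by rw [h2 u hu])]
    split_ifs with h
    · rw [Finset.card_insert_of_notMem (fun h => haS (Finset.mem_filter.1 h).1), ih]
      obtain ⟨k, hk⟩ := h
      omega
    · rw [ih]
      rw [Nat.not_even_iff] at h
      omega

noncomputable def Ev {T : ℕ} (k : Fin T) : Finset (Fin T) :=
  (Finset.univ.erase k).filter (fun u => Even (ab (Finset.univ.erase k) u))
noncomputable def Od {T : ℕ} (k : Fin T) : Finset (Fin T) :=
  (Finset.univ.erase k).filter (fun u => ¬ Even (ab (Finset.univ.erase k) u))

lemma EvOd_union {T : ℕ} (k : Fin T) : Ev k ∪ Od k = Finset.univ.erase k := Finset.filter_union_filter_not_eq _ _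
lemma EvOd_disj {T : ℕ} (k : Fin T) : Disjoint (Ev k) (Od k) := Finset.disjoint_filter_filter_not _ _ _

lemma Ev_card {d : ℕ} (k : Fin (2*d+3)) : (Ev k).card = d + 1 := by
  rw [Ev, card_ev, Finset.card_erase_of_mem (Finset.mem_univ _)]
  simp; omega
lemma Od_card {d : ℕ} (k : Fin (2*d+3)) : (Od k).card = d + 1 := by
  have := Finset.card_union_of_disjoint (EvOd_disj k)
  rw [EvOd_union, Finset.card_erase_of_mem (Finset.mem_univ _), Ev_card] at this
  simp at this; omega

lemma ee_pos_iff {T : ℕ} {t : Fin T → ℝ} (ht : StrictMono t) (S : Finset (Fin T)) (u : Fin T) :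
    (Even (ab S u) → 0 < ee t S u) ∧ (¬ Even (ab S u) → ee t S u < 0) := by
  have := ee_sign ht S u
  constructor
  · intro h; rw [h.neg_one_pow] at this; linarith
  · intro h; rw [(Nat.not_even_iff_odd.1 h).neg_one_pow] at this; linarith

lemma cross_ev {d : ℕ} {t : Fin (2*d+3) → ℝ} (ht : StrictMono t) (k : Fin (2*d+3)) :
    Cross (fun i => mom (2*d+1) (t i)) (Ev k) (Od k) := by
  refine ⟨EvOd_disj k, ?_⟩
  set S := Finset.univ.erase k with hS
  have hSc : S.card = 2*d+1+1 := by rw [hS, Finset.card_erase_of_mem (Finset.mem_univ _)]; simp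
  obtain ⟨l, hl, u, hu, hlu⟩ := exists_dep (fun i => mom (2*d+1) (t i)) S hSc
  have hne : ∀ v, ee t S v ≠ 0 := by
    intro v h
    have := ee_sign ht S v
    rw [h] at this; simp at this
  have hc : l u * ee t S u ≠ 0 := mul_ne_zero hlu (hne u)
  refine ⟨fun v => |(ee t S v)⁻¹|, ?_, ?_, ?_⟩
  · intro a _; exact abs_pos.2 (inv_ne_zero (hne a))
  · intro a _; exact abs_pos.2 (inv_ne_zero (hne a))
  · have h0 : ∑ v ∈ S, (ee t S v)⁻¹ • mom (2*d+1) (t v) = 0 := by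
      have : ∀ v ∈ S, (ee t S v)⁻¹ • mom (2*d+1) (t v) = (l u * ee t S u)⁻¹ • l v • mom (2*d+1) (t v) := by
        intro v hv
        rw [mom_alt hSc hl hu hv, smul_smul]
        congr 1
        have h1 : l v ≠ 0 := by
          intro h
          apply hc
          rw [mom_alt hSc hl hu hv, h, zero_mul]
        have := hne v
        field_simp
      rw [Finset.sum_congr rfl this, ← Finset.smul_sum, hl, smul_zero]
    have h0 : ∑ v ∈ Ev k ∪ Od k, (ee t S v)⁻¹ • mom (2*d+1) (t v) = 0 := by rw [EvOd_union]; exact h0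
    rw [Finset.sum_union (EvOd_disj k)] at h0
    rw [← sub_eq_zero, ← h0, sub_eq_add_neg, ← Finset.sum_neg_distrib]
    congr 1
    · apply Finset.sum_congr rfl
      intro v hv
      dsimp only
      rw [abs_of_pos (inv_pos.2 ((ee_pos_iff ht S v).1 (Finset.mem_filter.1 hv).2))]
    · apply Finset.sum_congr rfl
      intro v hv
      dsimp only
      rw [abs_of_neg (inv_lt_zero.2 ((ee_pos_iff ht S v).2 (Finset.mem_filter.1 hv).2)), neg_smul, neg_neg]

lemma cross_mom {d : ℕ} {t : Fin (2*d+3) → ℝ} (ht : StrictMono t) {σ τ : Finset (Fin (2*d+3))}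
    (hσ : σ.card = d + 1) (hτ : τ.card = d + 1) (h : Cross (fun i => mom (2*d+1) (t i)) σ τ) :
    ∃ k, (σ = Ev k ∧ τ = Od k) ∨ (σ = Od k ∧ τ = Ev k) := by
  obtain ⟨hd, l, h1, h2, h3⟩ := h
  have hc : ((σ ∪ τ)ᶜ).card = 1 := by
    rw [Finset.card_compl, Finset.card_union_of_disjoint hd, Fintype.card_fin]; omega
  obtain ⟨k, hk⟩ := Finset.card_eq_one.1 hc
  have hS : σ ∪ τ = Finset.univ.erase k := by
    rw [← compl_compl (σ ∪ τ), hk]; ext; simp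
  have hSc : (σ ∪ τ).card = 2*d+1+1 := by rw [Finset.card_union_of_disjoint hd]; omega
  set l' : Fin (2*d+3) → ℝ := fun v => if v ∈ σ then l v else - l v with hl'
  have h0 : ∑ v ∈ σ ∪ τ, l' v • mom (2*d+1) (t v) = 0 := by
    rw [Finset.sum_union hd, Finset.sum_congr rfl (g := fun v => l v • mom (2*d+1) (t v))
      (fun v hv => by simp [hl', hv]), h3, Finset.sum_congr rfl (s₁ := τ) (f := fun v => l' v • mom (2*d+1) (t v)) (g := fun v => - (l v • mom (2*d+1) (t v)))
      (fun v hv => by simp [hl', Finset.disjoint_right.1 hd hv]), ← Finset.sum_add_distrib]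
    simp
  have hne : (σ ∪ τ).Nonempty := by rw [← Finset.card_pos]; omega
  obtain ⟨u, hu⟩ := hne
  set c := l' u * ee t (σ ∪ τ) u with hcd
  have hcv : ∀ v ∈ σ ∪ τ, l' v * ee t (σ ∪ τ) v = c := fun v hv => mom_alt hSc h0 hv hu
  have hp : ∀ v ∈ σ, 0 < l' v := fun v hv => by simp [hl', hv, h1 v hv]
  have hn : ∀ v ∈ τ, l' v < 0 := fun v hv => by simp [hl', Finset.disjoint_right.1 hd hv, h2 v hv]
  have sub_eq : ∀ {A B C D : Finset (Fin (2*d+3))}, A ⊆ C → B ⊆ D → A.card = C.card → B.card = D.card → A = C ∧ B = D :=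
    fun h1 h2 h3 h4 => ⟨Finset.eq_of_subset_of_card_le h1 h3.ge, Finset.eq_of_subset_of_card_le h2 h4.ge⟩
  refine ⟨k, ?_⟩
  have hc0 : c ≠ 0 := by
    rw [hcd]
    refine mul_ne_zero ?_ ?_
    · rcases Finset.mem_union.1 hu with h | h
      · exact (hp u h).ne'
      · exact (hn u h).ne
    · intro h
      have := ee_sign ht (σ ∪ τ) u
      rw [h] at this; simp at this
  rcases lt_or_gt_of_ne hc0 with hlt | hgt
  · right
    refine sub_eq ?_ ?_ (by rw [hσ, Od_card]) (by rw [hτ, Ev_card])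
    · intro v hv
      have hvS := Finset.mem_union_left τ hv
      rw [Od, ← hS, Finset.mem_filter]
      refine ⟨hvS, fun hE => ?_⟩
      nlinarith [mul_pos (hp v hv) ((ee_pos_iff ht (σ ∪ τ) v).1 hE), hcv v hvS]
    · intro v hv
      have hvS := Finset.mem_union_right σ hv
      rw [Ev, ← hS, Finset.mem_filter]
      refine ⟨hvS, by_contra fun hE => ?_⟩
      nlinarith [mul_pos_of_neg_of_neg (hn v hv) ((ee_pos_iff ht (σ ∪ τ) v).2 hE), hcv v hvS]
  · left
    refine sub_eq ?_ ?_ (by rw [hσ, Ev_card]) (by rw [hτ, Od_card])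
    · intro v hv
      have hvS := Finset.mem_union_left τ hv
      rw [Ev, ← hS, Finset.mem_filter]
      refine ⟨hvS, by_contra fun hE => ?_⟩
      nlinarith [mul_neg_of_pos_of_neg (hp v hv) ((ee_pos_iff ht (σ ∪ τ) v).2 hE), hcv v hvS]
    · intro v hv
      have hvS := Finset.mem_union_right σ hv
      rw [Od, ← hS, Finset.mem_filter]
      refine ⟨hvS, fun hE => ?_⟩
      nlinarith [mul_neg_of_neg_of_pos (hn v hv) ((ee_pos_iff ht (σ ∪ τ) v).1 hE), hcv v hvS]

lemma cross_count {d : ℕ} {t : Fin (2*d+3) → ℝ} (ht : StrictMono t) :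
    ((PPo (2*d+3) d).filter (fun p => Cross (fun i => mom (2*d+1) (t i)) p.1 p.2)).card = 2 * (2*d+3) := by
  have inj : ∀ {k k' : Fin (2*d+3)}, (Finset.univ.erase k) = (Finset.univ.erase k') → k = k' := by
    intro k k' h
    by_contra hne
    have : k ∈ Finset.univ.erase k' := Finset.mem_erase.2 ⟨hne, Finset.mem_univ _⟩
    rw [← h] at this; simp at this
  have : (PPo (2*d+3) d).filter (fun p => Cross (fun i => mom (2*d+1) (t i)) p.1 p.2) =
      (Finset.univ.image (fun k : Fin (2*d+3) => (Ev k, Od k))) ∪ (Finset.univ.image (fun k : Fin (2*d+3) => (Od k, Ev k))) := by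
    ext ⟨a, b⟩
    simp only [PPo, Finset.mem_filter, Finset.mem_univ, true_and, Finset.mem_union, Finset.mem_image, Prod.mk.injEq]
    constructor
    · rintro ⟨⟨h1, h2, h3⟩, h4⟩
      obtain ⟨k, h | h⟩ := cross_mom ht h1 h2 h4
      · exact Or.inl ⟨k, h.1.symm, h.2.symm⟩
      · exact Or.inr ⟨k, h.1.symm, h.2.symm⟩
    · rintro (⟨k, rfl, rfl⟩ | ⟨k, rfl, rfl⟩)
      · exact ⟨⟨Ev_card k, Od_card k, EvOd_disj k⟩, cross_ev ht k⟩
      · exact ⟨⟨Od_card k, Ev_card k, (EvOd_disj k).symm⟩, (cross_ev ht k).symm⟩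
  rw [this, Finset.card_union_of_disjoint, Finset.card_image_of_injective, Finset.card_image_of_injective]
  · simp; ring
  · intro k k' h
    simp only [Prod.mk.injEq] at h
    apply inj; rw [← EvOd_union, ← EvOd_union, h.1, h.2]
  · intro k k' h
    simp only [Prod.mk.injEq] at h
    apply inj; rw [← EvOd_union, ← EvOd_union, h.1, h.2]
  · rw [Finset.disjoint_left]
    rintro ⟨a, b⟩ h1 h2
    simp only [Finset.mem_image, Finset.mem_univ, true_and, Prod.mk.injEq] at h1 h2
    obtain ⟨k, rfl, rfl⟩ := h1
    obtain ⟨k', h3, h4⟩ := h2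
    have : k' = k := by apply inj; rw [← EvOd_union, ← EvOd_union, ← h3, ← h4, Finset.union_comm]
    subst this
    have := EvOd_disj k'
    rw [h3, disjoint_self] at this
    have h := Ev_card k'
    rw [this] at h; simp at h

lemma cross_map {V : Type*} {T N : ℕ} (u : Fin T ↪ V) (x : V → (Fin N → ℝ)) (σ τ : Finset (Fin T)) :
    Cross x (σ.map u) (τ.map u) ↔ Cross (fun i => x (u i)) σ τ := by
  simp only [Cross, Finset.disjoint_map, Finset.sum_map]
  refine and_congr_right fun _ => ⟨?_, ?_⟩
  · rintro ⟨l, h1, h2, h3⟩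
    exact ⟨fun i => l (u i), fun a ha => h1 _ (Finset.mem_map_of_mem _ ha), fun a ha => h2 _ (Finset.mem_map_of_mem _ ha), h3⟩
  · rintro ⟨l, h1, h2, h3⟩
    refine ⟨Function.extend u l 0, ?_, ?_, ?_⟩
    · intro a ha
      obtain ⟨i, hi, rfl⟩ := Finset.mem_map.1 ha
      rw [u.injective.extend_apply]; exact h1 i hi
    · intro a ha
      obtain ⟨i, hi, rfl⟩ := Finset.mem_map.1 ha
      rw [u.injective.extend_apply]; exact h2 i hi
    · simpa only [u.injective.extend_apply] using h3

theorem XX_mom {V : Type*} {d : ℕ} (u : Fin (2*d+3) ↪ V) (x : V → (Fin (2*d+1) → ℝ))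
    {t : Fin (2*d+3) → ℝ} (ht : StrictMono t) (hx : ∀ i, x (u i) = mom (2*d+1) (t i)) :
    XX x (2*d+3) d (fun σ => sg (σ.map u)) = 1 := by
  have h := cross_count ht
  rw [Finset.card_filter, sum_PPo (2*d+3) d (fun a b => if Cross (fun i => mom (2*d+1) (t i)) a b then 1 else 0)] at h
  have h2 : ∑ p ∈ PP (2*d+3) d, (if Cross (fun i => mom (2*d+1) (t i)) p.1 p.2 then 1 else 0) = 2*d+3 := by
    have : ∀ p ∈ PP (2*d+3) d, ((if Cross (fun i => mom (2*d+1) (t i)) p.1 p.2 then 1 else 0) +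
      (if Cross (fun i => mom (2*d+1) (t i)) p.2 p.1 then 1 else 0)) = 2 * (if Cross (fun i => mom (2*d+1) (t i)) p.1 p.2 then 1 else 0) := by
      intro p _
      have : Cross (fun i => mom (2*d+1) (t i)) p.2 p.1 ↔ Cross (fun i => mom (2*d+1) (t i)) p.1 p.2 := ⟨Cross.symm, Cross.symm⟩
      simp only [this]; ring
    rw [Finset.sum_congr rfl this, ← Finset.mul_sum] at h
    omega
  have h3 := congrArg (fun m : ℕ => (m : ZMod 2)) h2
  simp only [Nat.cast_sum, Nat.cast_ite, Nat.cast_one, Nat.cast_zero] at h3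
  have h4 : ((2 * d + 3 : ℕ) : ZMod 2) = 1 := by
    have h2 : (2 : ZMod 2) = 0 := rfl
    have h3 : (3 : ZMod 2) = 1 := rfl
    push_cast
    rw [h2, h3]; ring
  rw [h4] at h3
  rw [← h3, XX]
  apply Finset.sum_congr rfl
  intro p _
  rw [JJ_sg, cross_map]
  simp only [hx]

/-! ### Generic perturbation -/

lemma exists_gen {V : Type*} {N : ℕ} (L : Finset V) (y : V → (Fin N → ℝ)) (t : V → ℝ)
    (ht : Set.InjOn t (L : Set V)) (η : ℝ) (hη : 0 < η) :
    ∃ ε, 0 < ε ∧ ε < η ∧ Gen (fun v => (1 - ε) • y v + ε • mom N (t v)) (L : Set V) := by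
  have fin : ∀ S ∈ L.powersetCard N, {ε : ℝ | ¬ ∀ l : V → ℝ, ∑ v ∈ S, l v • ((1 - ε) • y v + ε • mom N (t v)) = 0 → ∀ v ∈ S, l v = 0}.Finite := by
    intro S hS
    rw [Finset.mem_powersetCard] at hS
    have e : Fin N ≃ S := (finCongr hS.2.symm).trans S.equivFin.symm
    set M : Matrix (Fin N) (Fin N) (Polynomial ℝ) := Matrix.of fun i k =>
      (1 - Polynomial.X) * Polynomial.C (y (e i) k) + Polynomial.X * Polynomial.C (mom N (t (e i)) k) with hM
    have hev : ∀ ε : ℝ, M.det.eval ε = (Matrix.of fun i k => (1 - ε) * y (e i) k + ε * mom N (t (e i)) k).det := by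
      intro ε
      rw [← Polynomial.coe_evalRingHom, RingHom.map_det]
      congr 1
      ext i k
      simp [hM]
      ring
    have h1 : M.det.eval 1 ≠ 0 := by
      rw [hev]
      have : (Matrix.of fun i k => (1 - (1:ℝ)) * y (e i) k + 1 * mom N (t (e i)) k) = Matrix.vandermonde (fun i => t (e i)) := by
        ext i k; simp [mom, Matrix.vandermonde]
      rw [this, Matrix.det_vandermonde_ne_zero_iff]
      intro i j hij
      have := ht (hS.1 (e i).2) (hS.1 (e j).2) hij
      exact e.injective (Subtype.ext this)
    have h0 : M.det ≠ 0 := by rintro h; rw [h] at h1; simp at h1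
    refine (M.det.roots.toFinset.finite_toSet).subset ?_
    intro ε hε
    simp only [Finset.mem_coe, Multiset.mem_toFinset, Polynomial.mem_roots h0, Polynomial.IsRoot.def]
    by_contra hne
    apply hε
    intro l hl v hv
    rw [hev] at hne
    have hv0 : Matrix.vecMul (fun i => l (e i)) (Matrix.of fun i k => (1 - ε) * y (e i) k + ε * mom N (t (e i)) k) = 0 := by
      ext k
      have := congrFun hl k
      rw [← Finset.sum_coe_sort, ← Equiv.sum_comp e] at this
      simpa [Matrix.vecMul, dotProduct, mul_add] using this
    have := congrFun (Matrix.eq_zero_of_vecMul_eq_zero hne hv0) (e.symm ⟨v, hv⟩)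
    simpa using this
  have hfin : (⋃ S ∈ L.powersetCard N, {ε : ℝ | ¬ ∀ l : V → ℝ, ∑ v ∈ S, l v • ((1 - ε) • y v + ε • mom N (t v)) = 0 → ∀ v ∈ S, l v = 0}).Finite :=
    Set.Finite.biUnion (Finset.finite_toSet _) fin
  obtain ⟨ε, hε, hε2⟩ := ((Set.Ioo_infinite hη).sdiff hfin).nonempty
  refine ⟨ε, hε.1, hε.2, ?_⟩
  intro S hS hc
  by_contra hcon
  apply hε2
  simp only [Set.mem_iUnion]
  exact ⟨S, Finset.mem_powersetCard.2 ⟨fun v hv => hS v hv, hc⟩, hcon⟩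

end Emb

namespace Emb
open scoped Classical

/-! ### Barycentric subdivision -/

abbrev EE (n : ℕ) := Fin n → ℝ

noncomputable def bary {n : ℕ} (s : Finset (EE n)) : EE n := (s.card : ℝ)⁻¹ • ∑ v ∈ s, v

noncomputable def sdN {n : ℕ} : ℕ → Finset (EE n) → Ch (EE n)
  | 0, _ => sg ∅
  | k+1, s => cone (bary s) (∑ a ∈ s, sdN k (s.erase a))

noncomputable def sd {n : ℕ} : Ch (EE n) →ₗ[ZMod 2] Ch (EE n) :=
  Finsupp.linearCombination (ZMod 2) (fun s => sdN s.card s)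

lemma sd_sg {n : ℕ} (s : Finset (EE n)) : sd (sg s) = sdN s.card s := by
  simp [sd, sg, Finsupp.linearCombination_single]

lemma sdN_bd {n : ℕ} (k : ℕ) : ∀ s : Finset (EE n), s.card = k →
    bd (sdN k s) = ∑ a ∈ s, sdN (k-1) (s.erase a) := by
  induction k with
  | zero =>
    intro s hs
    rw [Finset.card_eq_zero] at hs
    subst hs
    simp [sdN, bd_sg]
  | succ k ih =>
    intro s hs
    rw [sdN, bd_cone, map_sum, Finset.sum_congr rfl (fun a ha => ih (s.erase a) (by
      rw [Finset.card_erase_of_mem ha, hs]; rfl)), dbl_sum_zero, map_zero, add_zero]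
    rfl

lemma bd_sd {n : ℕ} (z : Ch (EE n)) : bd (sd z) = sd (bd z) := by
  have : bd ∘ₗ sd (n := n) = sd ∘ₗ bd := by
    apply lin_ext
    intro s
    simp only [LinearMap.comp_apply]
    rw [sd_sg, sdN_bd _ s rfl, bd_sg, map_sum]
    refine Finset.sum_congr rfl fun a ha => ?_
    rw [sd_sg, Finset.card_erase_of_mem ha]
  exact congrArg (fun f => f z) this

/-- `k`-simplices in `C` with diameter `≤ δ` -/
def Sm {n : ℕ} (k : ℕ) (C : Set (EE n)) (δ : ℝ) : Set (Finset (EE n)) :=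
  {A | A.card = k ∧ (∀ v ∈ A, v ∈ C) ∧ ∀ v ∈ A, ∀ w ∈ A, dist v w ≤ δ}

lemma Sm_mono {n : ℕ} {k : ℕ} {C C' : Set (EE n)} {δ δ' : ℝ} (h : C ⊆ C') (hδ : δ ≤ δ') :
    Sm k C δ ⊆ Sm k C' δ' :=
  fun _ hA => ⟨hA.1, fun v hv => h (hA.2.1 v hv), fun v hv w hw => (hA.2.2 v hv w hw).trans hδ⟩

lemma bary_dist {n : ℕ} {s : Finset (EE n)} {d : ℕ} (hs : s.card ≤ d + 1) {δ : ℝ}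
    (h : ∀ v ∈ s, ∀ w ∈ s, dist v w ≤ δ) {v : EE n} (hv : v ∈ s) :
    dist v (bary s) ≤ (d / (d+1) : ℝ) * δ := by
  have hc : 0 < s.card := Finset.card_pos.2 ⟨v, hv⟩
  have hc' : (0:ℝ) < s.card := by exact_mod_cast hc
  have h0 : 0 ≤ δ := dist_nonneg.trans (h v hv v hv)
  have : v - bary s = (s.card : ℝ)⁻¹ • ∑ w ∈ s.erase v, (v - w) := by
    have : ∑ w ∈ s.erase v, (v - w) = ∑ w ∈ s, (v - w) := by
      rw [← Finset.add_sum_erase _ _ hv]; simp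
    rw [this, Finset.sum_sub_distrib, smul_sub, bary, Finset.sum_const, ← Nat.cast_smul_eq_nsmul ℝ, smul_smul,
      inv_mul_cancel₀ hc'.ne', one_smul]
  rw [dist_eq_norm, this, norm_smul, norm_inv, Real.norm_natCast]
  have h1 : ‖∑ w ∈ s.erase v, (v - w)‖ ≤ (s.card - 1 : ℝ) * δ := by
    calc _ ≤ ∑ w ∈ s.erase v, ‖v - w‖ := norm_sum_le _ _
      _ ≤ ∑ w ∈ s.erase v, δ := Finset.sum_le_sum fun w hw => by
          rw [← dist_eq_norm]; exact h v hv w (Finset.mem_of_mem_erase hw)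
      _ = _ := by
          rw [Finset.sum_const, Finset.card_erase_of_mem hv, nsmul_eq_mul, Nat.cast_sub hc]; simp
  calc (s.card : ℝ)⁻¹ * ‖∑ w ∈ s.erase v, (v - w)‖ ≤ (s.card : ℝ)⁻¹ * ((s.card - 1 : ℝ) * δ) := by gcongr
    _ = (1 - (s.card : ℝ)⁻¹) * δ := by field_simp
    _ ≤ (1 - ((d:ℝ)+1)⁻¹) * δ := by
        gcongr
        exact_mod_cast hs
    _ = _ := by field_simp; ring

lemma bary_mem {n : ℕ} {s : Finset (EE n)} (hs : s.Nonempty) : bary s ∈ convexHull ℝ (s : Set (EE n)) := by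
  have hc' : (0:ℝ) < s.card := by exact_mod_cast Finset.card_pos.2 hs
  rw [bary, Finset.smul_sum]
  refine (convex_convexHull ℝ _).sum_mem (fun _ _ => by positivity) ?_ (fun i hi => subset_convexHull ℝ _ hi)
  rw [Finset.sum_const, nsmul_eq_mul, mul_inv_cancel₀ hc'.ne']

lemma sdN_mem {n d : ℕ} (k : ℕ) : ∀ (s : Finset (EE n)), s.card = k → k ≤ d + 1 → ∀ δ : ℝ,
    (∀ v ∈ s, ∀ w ∈ s, dist v w ≤ δ) →
    sdN k s ∈ Sup (Sm k (convexHull ℝ (s : Set (EE n))) ((d / (d+1) : ℝ) * δ)) := by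
  induction k with
  | zero =>
    intro s _ _ δ _
    exact sg_mem_Sup ⟨rfl, by simp, by simp⟩
  | succ k ih =>
    intro s hs hk δ hδ
    have hne : s.Nonempty := by rw [← Finset.card_pos]; omega
    rw [sdN, map_sum]
    refine Submodule.sum_mem _ fun a ha => ?_
    refine Sup_map (cone (bary s)) _ ?_ (ih (s.erase a) (by rw [Finset.card_erase_of_mem ha, hs]; rfl) (by omega) δ
      (fun v hv w hw => hδ v (Finset.mem_of_mem_erase hv) w (Finset.mem_of_mem_erase hw)))
    rintro A ⟨h1, h2, h3⟩
    rw [cone_sg]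
    have hb : ∀ y ∈ convexHull ℝ (s : Set (EE n)), dist y (bary s) ≤ (d / (d+1) : ℝ) * δ := by
      have : convexHull ℝ (s : Set (EE n)) ⊆ Metric.closedBall (bary s) ((d / (d+1) : ℝ) * δ) :=
        convexHull_min (fun v hv => bary_dist (by omega) hδ hv) (convex_closedBall _ _)
      exact this
    have h2' : ∀ v ∈ A, v ∈ convexHull ℝ (s : Set (EE n)) := fun v hv =>
      convexHull_mono (by exact_mod_cast Finset.erase_subset _ _) (h2 v hv)
    split_ifs with h
    · exact Submodule.zero_mem _
    · refine sg_mem_Sup ⟨by rw [Finset.card_insert_of_notMem h, h1], ?_, ?_⟩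
      · intro v hv
        rcases Finset.mem_insert.1 hv with rfl | hv
        · exact bary_mem hne
        · exact h2' v hv
      · intro v hv w hw
        rcases Finset.mem_insert.1 hv with rfl | hv <;> rcases Finset.mem_insert.1 hw with rfl | hw
        · rw [dist_self]
          exact dist_nonneg.trans (hb _ (bary_mem hne))
        · rw [dist_comm]; exact hb _ (h2' w hw)
        · exact hb _ (h2' v hv)
        · exact h3 v hv w hw

/-- standard vertex embedding -/
def ev (n : ℕ) : Fin n ↪ EE n := ⟨fun i => Pi.single i 1, fun i j h => by
  by_contra hne
  have := congrFun h i
  simp [hne] at this⟩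

/-- small simplices carried by a face in a family -/
def Fm {n : ℕ} (k : ℕ) (𝒞 : Set (Finset (Fin n))) (δ : ℝ) : Set (Finset (EE n)) :=
  {A | ∃ F ∈ 𝒞, A ∈ Sm k (convexHull ℝ ((fun i => (Pi.single i 1 : EE n)) '' (F : Set (Fin n)))) δ}

lemma sd_mem {n d k : ℕ} (hk : k ≤ d + 1) {𝒞 : Set (Finset (Fin n))} {δ : ℝ} {z : Ch (EE n)}
    (hz : z ∈ Sup (Fm k 𝒞 δ)) : sd z ∈ Sup (Fm k 𝒞 ((d / (d+1) : ℝ) * δ)) := by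
  refine Sup_map sd _ ?_ hz
  rintro A ⟨F, hF, h1, h2, h3⟩
  rw [sd_sg, h1]
  refine Sup_mono ?_ (sdN_mem k A h1 hk δ h3)
  intro B hB
  exact ⟨F, hF, Sm_mono (convexHull_min h2 (convex_convexHull ℝ _)) le_rfl hB⟩

lemma sdr_mem {n d k : ℕ} (hk : k ≤ d + 1) {𝒞 : Set (Finset (Fin n))} (r : ℕ) {z : Ch (EE n)}
    (hz : z ∈ Sup (Fm k 𝒞 1)) : (sd^r) z ∈ Sup (Fm k 𝒞 ((d / (d+1) : ℝ)^r)) := by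
  induction r with
  | zero => simpa using hz
  | succ r ih =>
    rw [pow_succ', pow_succ']
    exact sd_mem hk ih

lemma bd_sdr {n : ℕ} (r : ℕ) (z : Ch (EE n)) : bd ((sd^r) z) = (sd^r) (bd z) := by
  induction r with
  | zero => rfl
  | succ r ih =>
    rw [pow_succ', Module.End.mul_apply, Module.End.mul_apply, bd_sd, ih]

lemma sdr_empty {n : ℕ} (r : ℕ) : (sd^r) (sg (∅ : Finset (EE n))) = sg ∅ := by
  induction r with
  | zero => rfl
  | succ r ih =>
    rw [pow_succ', Module.End.mul_apply, ih, sd_sg]; rfl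

noncomputable def emb {n : ℕ} : Ch (Fin n) →ₗ[ZMod 2] Ch (EE n) :=
  Finsupp.linearCombination (ZMod 2) (fun s => sg (s.map (ev n)))

lemma emb_sg {n : ℕ} (s : Finset (Fin n)) : emb (sg s) = sg (s.map (ev n)) := by
  simp [emb, sg, Finsupp.linearCombination_single]

lemma bd_map_sg {V W : Type*} (u : V ↪ W) [DecidableEq V] (s : Finset V) :
    bd (sg (s.map u)) = ∑ i ∈ s, sg ((s.erase i).map u) := by
  rw [bd_sg, Finset.sum_map]
  refine Finset.sum_congr rfl fun i _ => ?_
  rw [Finset.map_erase]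

lemma bd_emb {n : ℕ} (z : Ch (Fin n)) : bd (emb z) = emb (bd z) := by
  have : bd ∘ₗ emb (n := n) = emb ∘ₗ bd := by
    apply lin_ext
    intro s
    simp only [LinearMap.comp_apply]
    rw [emb_sg, bd_map_sg, bd_sg, map_sum]
    refine Finset.sum_congr rfl fun i _ => ?_
    rw [emb_sg]
  exact congrArg (fun f => f z) this

lemma mem_conv {n : ℕ} (F : Finset (Fin n)) (w : EE n) :
    w ∈ convexHull ℝ ((fun i => (Pi.single i 1 : EE n)) '' (F : Set (Fin n))) ↔
      (∀ i, 0 ≤ w i) ∧ (∀ i, i ∉ F → w i = 0) ∧ ∑ i, w i = 1 := by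
  constructor
  · have : convexHull ℝ ((fun i => (Pi.single i 1 : EE n)) '' (F : Set (Fin n))) ⊆
      {w | (∀ i, 0 ≤ w i) ∧ (∀ i, i ∉ F → w i = 0) ∧ ∑ i, w i = 1} := by
      apply convexHull_min
      · rintro _ ⟨i, hi, rfl⟩
        refine ⟨fun j => ?_, fun j hj => ?_, by simp⟩
        · by_cases h : j = i
          · subst h; simp
          · simp [h]
        · have : j ≠ i := fun h => hj (h ▸ hi)
          simp [this]
      · rintro x ⟨h1, h2, h3⟩ y ⟨h4, h5, h6⟩ a b ha hb hab
        refine ⟨fun i => ?_, fun i hi => ?_, ?_⟩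
        · have := h1 i; have := h4 i
          simp only [Pi.add_apply, Pi.smul_apply, smul_eq_mul]; positivity
        · simp [h2 i hi, h5 i hi]
        · simp [Finset.sum_add_distrib, ← Finset.mul_sum, h3, h6, hab]
    exact fun h => this h
  · rintro ⟨h1, h2, h3⟩
    have hs : ∑ i ∈ F, w i = 1 := by
      rw [← h3]; exact Finset.sum_subset (Finset.subset_univ _) fun i _ hi => h2 i hi
    have hw : w = ∑ i ∈ F, w i • (Pi.single i 1 : EE n) := by
      ext j
      simp only [Finset.sum_apply, Pi.smul_apply, smul_eq_mul, Pi.single_apply, mul_ite, mul_one, mul_zero]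
      rw [Finset.sum_ite_eq]
      split_ifs with h
      · rfl
      · exact h2 j h
    rw [hw]
    exact (convex_convexHull ℝ _).sum_mem (fun i _ => h1 i) hs
      (fun i hi => subset_convexHull ℝ _ ⟨i, hi, rfl⟩)

lemma mem_geomReal {n : ℕ} (K : Finset (Finset (Fin n))) (w : EE n) :
    w ∈ geomReal n K ↔ ∃ F ∈ K, (∀ i, 0 ≤ w i) ∧ (∀ i, i ∉ F → w i = 0) ∧ ∑ i, w i = 1 := by
  simp only [geomReal, Set.mem_iUnion, exists_prop]
  exact exists_congr fun F => and_congr_right fun _ => mem_conv F w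

lemma isCompact_face {n : ℕ} (F : Finset (Fin n)) :
    IsCompact (convexHull ℝ ((fun i => (Pi.single i 1 : EE n)) '' (F : Set (Fin n)))) :=
  (F.finite_toSet.image _).isCompact_convexHull ℝ

lemma isCompact_geomReal {n : ℕ} (K : Finset (Finset (Fin n))) : IsCompact (geomReal n K) :=
  K.finite_toSet.isCompact_biUnion fun F _ => isCompact_face F

end Emb

namespace Emb
open scoped Classical

lemma exists_t {V : Type*} {T : ℕ} (u : Fin T ↪ V) (L : Finset V) :
    ∃ t : V → ℝ, Set.InjOn t (L : Set V) ∧ ∀ i, t (u i) = (i : ℕ) := by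
  have : ∃ e : V → ℕ, Set.InjOn e (L : Set V) := by
    refine ⟨fun v => if h : v ∈ L then L.equivFin ⟨v, h⟩ else 0, ?_⟩
    intro v hv w hw h
    have hv' : v ∈ L := hv
    have hw' : w ∈ L := hw
    simp only [hv', hw', dif_pos] at h
    have := L.equivFin.injective (Fin.ext h)
    exact congrArg Subtype.val this
  obtain ⟨e, he⟩ := this
  refine ⟨fun v => if h : ∃ i, u i = v then ((h.choose : ℕ) : ℝ) else ((T + e v : ℕ) : ℝ), ?_, ?_⟩
  · intro v hv w hw h
    dsimp only at h
    split_ifs at h with h1 h2 h2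
    · rw [← h1.choose_spec, ← h2.choose_spec]
      have : h1.choose = h2.choose := Fin.ext (by exact_mod_cast h)
      rw [this]
    · have h3 := h1.choose.2
      have : (h1.choose : ℕ) = T + e w := by exact_mod_cast h
      omega
    · have h3 := h2.choose.2
      have : T + e v = (h2.choose : ℕ) := by exact_mod_cast h
      omega
    · have : T + e v = T + e w := by exact_mod_cast h
      exact he hv hw (by omega)
  · intro i
    have h : ∃ j, u j = u i := ⟨i, rfl⟩
    simp only [dif_pos h]
    rw [u.injective h.choose_spec]

lemma JJ_ne {V : Type*} {N : ℕ} {x : V → (Fin N → ℝ)} {z w : Ch V} (h : JJ x z w ≠ 0) :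
    ∃ A ∈ z.support, ∃ B ∈ w.support, Cross x A B := by
  by_contra hcon
  push Not at hcon
  apply h
  refine Sup_ext (P := (w.support : Set (Finset V))) (JJ x z) 0 ?_ ((Finsupp.mem_supported _ _).2 subset_rfl)
  intro B hB
  refine Sup_ext (P := (z.support : Set (Finset V))) ((JJ x).flip (sg B)) 0 ?_ ((Finsupp.mem_supported _ _).2 subset_rfl)
  intro A hA
  rw [LinearMap.flip_apply, JJ_sg, if_neg (hcon A hA B hB)]; rfl

/-- crossing of small simplices gives nearby images -/
lemma cross_close {V : Type*} {m : ℕ} {x : V → (Fin (m+1) → ℝ)} {A B : Finset V}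
    (h : Cross x A B) (hA : A.Nonempty) (x0 : ∀ v ∈ A ∪ B, x v 0 = 1)
    {η : ℝ} {a0 b0 : Fin m → ℝ} (h1 : ∀ v ∈ A, ∀ j, |x v (Fin.succ j) - a0 j| ≤ η)
    (h2 : ∀ v ∈ B, ∀ j, |x v (Fin.succ j) - b0 j| ≤ η) (j : Fin m) : |a0 j - b0 j| ≤ 2 * η := by
  obtain ⟨-, l, l1, l2, h⟩ := h
  have e0 := congrFun h 0
  have ej := congrFun h (Fin.succ j)
  simp only [Finset.sum_apply, Pi.smul_apply, smul_eq_mul] at e0 ej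
  rw [Finset.sum_congr rfl (fun v hv => by rw [x0 v (Finset.mem_union_left _ hv), mul_one]),
    Finset.sum_congr rfl (s₁ := B) (fun v hv => by rw [x0 v (Finset.mem_union_right _ hv), mul_one])] at e0
  have hpos : 0 < ∑ v ∈ A, l v := Finset.sum_pos l1 hA
  have key : ∀ (C : Finset V) (c0 : ℝ), (∀ v ∈ C, 0 < l v) → (∀ v ∈ C, |x v (Fin.succ j) - c0| ≤ η) →
      |∑ v ∈ C, l v * x v (Fin.succ j) - (∑ v ∈ C, l v) * c0| ≤ (∑ v ∈ C, l v) * η := by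
    intro C c0 hl hc
    rw [Finset.sum_mul, ← Finset.sum_sub_distrib, Finset.sum_mul]
    refine (Finset.abs_sum_le_sum_abs _ _).trans (Finset.sum_le_sum fun v hv => ?_)
    rw [← mul_sub, abs_mul, abs_of_pos (hl v hv)]
    exact mul_le_mul_of_nonneg_left (hc v hv) (hl v hv).le
  have k1 := abs_le.1 (key A (a0 j) l1 (fun v hv => h1 v hv j))
  have k2 := abs_le.1 (key B (b0 j) l2 (fun v hv => h2 v hv j))
  rw [← e0, ← ej] at k2
  rw [abs_le]
  constructor <;> refine le_of_mul_le_mul_left ?_ hpos <;> nlinarith [k1.1, k1.2, k2.1, k2.2]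

lemma exists_gap {n m : ℕ} (K : Finset (Finset (Fin n))) (f : EE n → (Fin m → ℝ))
    (hf : ContinuousOn f (geomReal n K)) (hinj : Set.InjOn f (geomReal n K)) :
    ∃ γ > 0, ∀ F ∈ K, ∀ G ∈ K, Disjoint F G →
      ∀ a ∈ convexHull ℝ ((fun i => (Pi.single i 1 : EE n)) '' (F : Set (Fin n))),
      ∀ b ∈ convexHull ℝ ((fun i => (Pi.single i 1 : EE n)) '' (G : Set (Fin n))), γ ≤ dist (f a) (f b) := by
  have each : ∀ p ∈ K ×ˢ K, ∃ γ > 0, (Disjoint p.1 p.2 →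
      ∀ a ∈ convexHull ℝ ((fun i => (Pi.single i 1 : EE n)) '' (p.1 : Set (Fin n))),
      ∀ b ∈ convexHull ℝ ((fun i => (Pi.single i 1 : EE n)) '' (p.2 : Set (Fin n))), γ ≤ dist (f a) (f b)) := by
    rintro ⟨F, G⟩ hp
    rw [Finset.mem_product] at hp
    by_cases hd : Disjoint F G
    swap
    · exact ⟨1, one_pos, fun h => absurd h hd⟩
    have sub : ∀ F ∈ K, convexHull ℝ ((fun i => (Pi.single i 1 : EE n)) '' (F : Set (Fin n))) ⊆ geomReal n K :=
      fun F hF => Set.subset_biUnion_of_mem (u := fun F : Finset (Fin n) => convexHull ℝ ((fun i => (Pi.single i 1 : EE n)) '' (F : Set (Fin n)))) hF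
    have hcF := (isCompact_face F).image_of_continuousOn (hf.mono (sub F hp.1))
    have hcG := (isCompact_face G).image_of_continuousOn (hf.mono (sub G hp.2))
    have hdis : Disjoint (f '' convexHull ℝ ((fun i => (Pi.single i 1 : EE n)) '' (F : Set (Fin n))))
        (f '' convexHull ℝ ((fun i => (Pi.single i 1 : EE n)) '' (G : Set (Fin n)))) := by
      rw [Set.disjoint_left]
      rintro _ ⟨a, ha, rfl⟩ ⟨b, hb, hab⟩
      have := hinj (sub G hp.2 hb) (sub F hp.1 ha) hab
      subst this
      rw [mem_conv] at ha hb
      have : ∑ i, b i = 0 := Finset.sum_eq_zero fun i _ => by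
        by_cases hi : i ∈ F
        · exact hb.2.1 i (Finset.disjoint_left.1 hd hi)
        · exact ha.2.1 i hi
      rw [ha.2.2] at this; norm_num at this
    obtain ⟨δ, hδ, h⟩ := hdis.exists_thickenings hcF hcG.isClosed
    refine ⟨δ, hδ, fun _ a ha b hb => ?_⟩
    by_contra hlt
    push Not at hlt
    have q1 : f b ∈ Metric.thickening δ (f '' convexHull ℝ ((fun i => (Pi.single i 1 : EE n)) '' (F : Set (Fin n)))) :=
      Metric.mem_thickening_iff.2 ⟨f a, ⟨a, ha, rfl⟩, by rw [dist_comm]; exact hlt⟩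
    exact Set.disjoint_left.1 h q1 (Metric.self_subset_thickening hδ _ ⟨b, hb, rfl⟩)
  choose! γ hγ hγ2 using each
  by_cases hne : (K ×ˢ K).Nonempty
  · refine ⟨(K ×ˢ K).inf' hne γ, ?_, ?_⟩
    · exact (Finset.lt_inf'_iff hne).2 fun p hp => hγ p hp
    · intro F hF G hG hd a ha b hb
      exact (Finset.inf'_le γ (Finset.mk_mem_product hF hG)).trans
        (hγ2 (F, G) (Finset.mk_mem_product hF hG) hd a ha b hb)
  · refine ⟨1, one_pos, fun F hF G hG => absurd ⟨(F, G), Finset.mk_mem_product hF hG⟩ hne⟩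

lemma ev_apply {n : ℕ} (i : Fin n) : ev n i = Pi.single i 1 := rfl

lemma ev_dist {n : ℕ} (i j : Fin n) : dist (ev n i) (ev n j) ≤ 1 := by
  rw [dist_pi_le_iff zero_le_one]
  intro k
  simp only [ev_apply, Pi.single_apply, Real.dist_eq]
  split_ifs <;> simp

lemma sg_map_mem {n : ℕ} {𝒞 : Set (Finset (Fin n))} {F : Finset (Fin n)} (hF : F ∈ 𝒞) :
    sg (F.map (ev n)) ∈ Sup (Fm F.card 𝒞 1) := by
  refine sg_mem_Sup ⟨F, hF, by simp, ?_, ?_⟩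
  · intro v hv
    obtain ⟨i, hi, rfl⟩ := Finset.mem_map.1 hv
    exact subset_convexHull ℝ _ ⟨i, hi, rfl⟩
  · intro v hv w hw
    obtain ⟨i, hi, rfl⟩ := Finset.mem_map.1 hv
    obtain ⟨j, hj, rfl⟩ := Finset.mem_map.1 hw
    exact ev_dist i j

set_option maxHeartbeats 2000000 in
theorem nonEmb {n d : ℕ} (hd : 1 ≤ d) (K : Finset (Finset (Fin n))) (β : Fin n → Fin (2*d+3))
    (v : Fin (2*d+3) → Fin n) (hv : ∀ i, β (v i) = i) (hK : ∀ s : Finset (Fin n), s.card ≤ d → s ∈ K)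
    (M : Finset (Fin (2*d+3)) → Ch (Fin n))
    (hM : ∀ σ, σ.card = d + 1 → M σ ∈ Sup {F | F ∈ K ∧ F.card = d + 1 ∧ ∀ i ∈ F, β i ∈ σ})
    (hbd : ∀ σ, σ.card = d + 1 → bd (M σ) = bd (sg (σ.image v)))
    (f : EE n → (Fin (2*d) → ℝ)) (hf : ContinuousOn f (geomReal n K))
    (hinj : Set.InjOn f (geomReal n K)) : False := by
  have vinj : Function.Injective v := fun i j h => by rw [← hv i, h, hv]
  obtain ⟨γ, hγ, gap⟩ := exists_gap K f hf hinj
  have huc := (isCompact_geomReal K).uniformContinuousOn_of_continuous hf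
  obtain ⟨δ, hδ, hδ2⟩ := Metric.uniformContinuousOn_iff_le.1 huc (γ/8) (by positivity)
  have hθ : (d / (d+1) : ℝ) < 1 := by rw [div_lt_one (by positivity)]; linarith
  obtain ⟨r, hr⟩ := exists_pow_lt_of_lt_one hδ hθ
  -- the chain map
  set 𝒞 : Finset (Fin (2*d+3)) → Set (Finset (Fin n)) := fun σ => {F | F ∈ K ∧ ∀ i ∈ F, β i ∈ σ} with h𝒞
  set c0 : Finset (Fin (2*d+3)) → Ch (EE n) := fun σ =>
    if σ.card ≤ d then sg ((σ.map ⟨v, vinj⟩).map (ev n)) else emb (M σ) with hc0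
  have c0car : ∀ σ, σ.card ≤ d + 1 → c0 σ ∈ Sup (Fm σ.card (𝒞 σ) 1) := by
    intro σ hσ
    simp only [hc0]
    split_ifs with h
    · have := sg_map_mem (𝒞 := 𝒞 σ) (F := σ.map ⟨v, vinj⟩) ⟨hK _ (by simpa using h), by
        intro i hi
        obtain ⟨j, hj, rfl⟩ := Finset.mem_map.1 hi
        simpa [hv] using hj⟩
      simpa using this
    · have hσ' : σ.card = d + 1 := by omega
      refine Sup_map emb _ ?_ (hM σ hσ')
      rintro F ⟨h1, h2, h3⟩
      rw [emb_sg, hσ', ← h2]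
      exact sg_map_mem ⟨h1, h3⟩
  have c0map : ∀ σ, σ.card ≤ d + 1 → bd (c0 σ) = ∑ i ∈ σ, c0 (σ.erase i) := by
    intro σ hσ
    have e1 : ∀ i ∈ σ, c0 (σ.erase i) = sg (((σ.erase i).map ⟨v, vinj⟩).map (ev n)) := by
      intro i hi
      simp only [hc0]
      rw [if_pos]
      rw [Finset.card_erase_of_mem hi]; omega
    have e2 : bd (sg ((σ.map ⟨v, vinj⟩).map (ev n))) = ∑ i ∈ σ, c0 (σ.erase i) := by
      rw [Finset.sum_congr rfl e1, Finset.map_map, bd_map_sg]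
      simp only [Finset.map_map]
    rw [← e2]
    simp only [hc0]
    split_ifs with h
    · rfl
    · rw [bd_emb, hbd σ (by omega), ← bd_emb, emb_sg]
      have : σ.image v = σ.map ⟨v, vinj⟩ := by ext; simp
      rw [this]
  set c : Finset (Fin (2*d+3)) → Ch (EE n) := fun σ => (sd^r) (c0 σ) with hc
  have ccar : ∀ σ, σ.card ≤ d + 1 → ∀ A ∈ (c σ).support, A ∈ Fm σ.card (𝒞 σ) ((d / (d+1) : ℝ)^r) := by
    intro σ hσ A hA
    exact sdr_mem hσ r (c0car σ hσ) hA
  -- reference labels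
  set u : Fin (2*d+3) ↪ EE n := ⟨fun i => Pi.single (v i) 2, fun i j h => by
    by_contra hne
    have := congrFun h (v i)
    simp [vinj.ne hne] at this⟩ with hu
  have uap : ∀ i, u i = Pi.single (v i) 2 := fun _ => rfl
  have uK : ∀ i, u i ∉ geomReal n K := by
    intro i h
    obtain ⟨F, -, -, -, h⟩ := (mem_geomReal K _).1 h
    rw [uap] at h
    simp at h
  have convK : ∀ F ∈ K, convexHull ℝ ((fun i => (Pi.single i 1 : EE n)) '' (F : Set (Fin n))) ⊆ geomReal n K :=
      fun F hF => Set.subset_biUnion_of_mem (u := fun F : Finset (Fin n) => convexHull ℝ ((fun i => (Pi.single i 1 : EE n)) '' (F : Set (Fin n)))) hF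
  set L0 : Finset (EE n) := (Finset.univ.filter (fun σ : Finset (Fin (2*d+3)) => σ.card ≤ d + 1)).biUnion fun σ => (c σ).support.biUnion id with hL0
  set L : Finset (EE n) := L0 ∪ Finset.univ.map u with hL
  have L0K : ∀ w ∈ L0, w ∈ geomReal n K := by
    intro w hw
    simp only [hL0, Finset.mem_biUnion, Finset.mem_filter, Finset.mem_univ, true_and, id] at hw
    obtain ⟨σ, hσ, A, hA, hwA⟩ := hw
    obtain ⟨F, hF, h⟩ := ccar σ hσ A hA
    exact convK F hF.1 (h.2.1 w hwA)
  obtain ⟨t, tinj, tu⟩ := exists_t u L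
  set y : EE n → (Fin (2*d+1) → ℝ) := fun w => if w ∈ geomReal n K then Fin.cons 1 (f w) else mom (2*d+1) (t w) with hy
  -- perturbation size
  obtain ⟨η, hη, hη2⟩ : ∃ η > 0, ∀ ε, 0 < ε → ε < η → ∀ w ∈ L, ∀ j, |ε * (mom (2*d+1) (t w) j - y w j)| ≤ γ/8 := by
    set B := ∑ w ∈ L, ∑ j, |mom (2*d+1) (t w) j - y w j| with hB
    have hB0 : 0 ≤ B := Finset.sum_nonneg fun _ _ => Finset.sum_nonneg fun _ _ => abs_nonneg _
    refine ⟨γ / 8 / (B + 1), by positivity, fun ε h0 h1 w hw j => ?_⟩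
    have h2 : |mom (2*d+1) (t w) j - y w j| ≤ B := by
      refine le_trans ?_ (Finset.single_le_sum (f := fun w => ∑ j, |mom (2*d+1) (t w) j - y w j|) (fun _ _ => Finset.sum_nonneg fun _ _ => abs_nonneg _) hw)
      exact Finset.single_le_sum (f := fun j => |mom (2*d+1) (t w) j - y w j|) (fun _ _ => abs_nonneg _) (Finset.mem_univ j)
    rw [abs_mul, abs_of_pos h0]
    rw [lt_div_iff₀ (by positivity)] at h1
    nlinarith [abs_nonneg (mom (2*d+1) (t w) j - y w j)]
  obtain ⟨ε, ε0, ε1, hgen⟩ := exists_gen L y t tinj η hη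
  set x : EE n → (Fin (2*d+1) → ℝ) := fun w => (1 - ε) • y w + ε • mom (2*d+1) (t w) with hx
  have xu : ∀ i, x (u i) = mom (2*d+1) ((i : ℕ) : ℝ) := by
    intro i
    simp only [hx, hy, if_neg (uK i), tu]
    rw [← add_smul]; simp
  have x0 : ∀ w, x w 0 = 1 := by
    intro w
    have h1 : y w 0 = 1 := by
      simp only [hy]; split_ifs
      · rfl
      · simp [mom]
    simp [hx, h1, mom]
  have xf : ∀ w ∈ L0, ∀ j, |x w (Fin.succ j) - f w j| ≤ γ/8 := by
    intro w hw j
    have h := hη2 ε ε0 ε1 w (Finset.mem_union_left _ hw) (Fin.succ j)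
    have h1 : y w (Fin.succ j) = f w j := by simp only [hy, if_pos (L0K w hw), Fin.cons_succ]
    rw [h1] at h
    convert h using 2
    simp only [hx, Pi.add_apply, Pi.smul_apply, smul_eq_mul, h1]; ring
  -- labels
  set S : EE n → Finset (Fin (2*d+3)) := fun w => (Finset.univ.filter (fun i => w i ≠ 0)).image β with hS
  have Su : ∀ i, S (u i) = {i} := by
    intro i
    ext j
    simp only [hS, uap, Finset.mem_image, Finset.mem_filter, Finset.mem_univ, true_and, Finset.mem_singleton,
      Pi.single_apply]
    constructor
    · rintro ⟨k, hk, rfl⟩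
      have : k = v i := by by_contra h; simp [h] at hk
      rw [this, hv]
    · rintro rfl
      exact ⟨v j, by simp, hv j⟩
  have hSne : ∀ w ∈ (L : Set (EE n)), (S w).Nonempty := by
    intro w hw
    rcases Finset.mem_union.1 (Finset.mem_coe.1 hw) with h | h
    · obtain ⟨F, -, -, -, h⟩ := (mem_geomReal K _).1 (L0K w h)
      have : ∃ i, w i ≠ 0 := by
        by_contra hcon
        push Not at hcon
        rw [Finset.sum_eq_zero (fun i _ => hcon i)] at h
        norm_num at h
      obtain ⟨i, hi⟩ := this
      exact ⟨β i, Finset.mem_image_of_mem _ (by simpa using hi)⟩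
    · obtain ⟨i, -, rfl⟩ := Finset.mem_map.1 h
      rw [Su]; simp
  have hLl : ∀ i, ∃ w ∈ (L : Set (EE n)), S w ⊆ {i} :=
    fun i => ⟨u i, Finset.mem_union_right _ (Finset.mem_map_of_mem _ (Finset.mem_univ _)), by rw [Su]⟩
  have Cc : Carried (L : Set (EE n)) S d c := by
    refine ⟨?_, ?_, ?_⟩
    · simp only [hc, hc0]
      simp [sdr_empty]
    · intro σ hσ A hA
      obtain ⟨F, hF, h⟩ := ccar σ hσ A hA
      refine ⟨h.1, fun w hw => ⟨?_, ?_⟩⟩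
      · apply Finset.mem_union_left
        simp only [hL0, Finset.mem_biUnion, Finset.mem_filter, Finset.mem_univ, true_and, id]
        exact ⟨σ, hσ, A, hA, hw⟩
      · intro j hj
        obtain ⟨i, hi, rfl⟩ := Finset.mem_image.1 hj
        apply hF.2
        by_contra hiF
        exact (Finset.mem_filter.1 hi).2 (((mem_conv F w).1 (h.2.1 w hw)).2.1 i hiF)
    · intro σ hσ
      simp only [hc]
      rw [bd_sdr, c0map σ hσ, map_sum]
  have Cg : Carried (L : Set (EE n)) S d (fun σ => sg (σ.map u)) := by
    refine ⟨by simp, ?_, ?_⟩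
    · intro σ _
      refine sg_mem_Sup ⟨by simp, ?_⟩
      intro w hw
      obtain ⟨i, hi, rfl⟩ := Finset.mem_map.1 hw
      exact ⟨Finset.mem_union_right _ (Finset.mem_map_of_mem _ (Finset.mem_univ _)), by rw [Su]; simpa using hi⟩
    · intro σ _
      rw [bd_map_sg]
  have hX := XX_eq hd hSne hgen hLl Cc Cg
  rw [XX_mom u _ (t := fun i => ((i : ℕ) : ℝ)) (fun i j h => by show ((i : ℕ) : ℝ) < ((j : ℕ) : ℝ); exact_mod_cast h) xu] at hX
  have : ∃ p ∈ PP (2*d+3) d, JJ x (c p.1) (c p.2) ≠ 0 := by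
    by_contra hcon
    push Not at hcon
    rw [XX, Finset.sum_eq_zero hcon] at hX
    exact zero_ne_one hX
  obtain ⟨⟨σ, τ⟩, hp, hJ⟩ := this
  simp only [PP, PPo, Finset.mem_filter, Finset.mem_univ, true_and] at hp
  obtain ⟨⟨hσ, hτ, hdis⟩, -⟩ := hp
  obtain ⟨A, hA, B, hB, hcr⟩ := JJ_ne hJ
  obtain ⟨F, hF, hA1, hA2, hA3⟩ := ccar σ hσ.le A hA
  obtain ⟨G, hG, hB1, hB2, hB3⟩ := ccar τ hτ.le B hB
  have AL : ∀ w ∈ A, w ∈ L0 := fun w hw => by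
    simp only [hL0, Finset.mem_biUnion, Finset.mem_filter, Finset.mem_univ, true_and, id]
    exact ⟨σ, hσ.le, A, hA, hw⟩
  have BL : ∀ w ∈ B, w ∈ L0 := fun w hw => by
    simp only [hL0, Finset.mem_biUnion, Finset.mem_filter, Finset.mem_univ, true_and, id]
    exact ⟨τ, hτ.le, B, hB, hw⟩
  have hAne : A.Nonempty := by rw [← Finset.card_pos, hA1, hσ]; omega
  have hBne : B.Nonempty := by rw [← Finset.card_pos, hB1, hτ]; omega
  obtain ⟨a, ha⟩ := hAne
  obtain ⟨b, hb⟩ := hBne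
  have close : ∀ (A : Finset (EE n)) (a : EE n), a ∈ A → (∀ w ∈ A, w ∈ L0) →
      (∀ v ∈ A, ∀ w ∈ A, dist v w ≤ (d / (d+1) : ℝ)^r) → ∀ w ∈ A, ∀ j, |x w (Fin.succ j) - f a j| ≤ γ/4 := by
    intro A a ha hAL hA3 w hw j
    have h1 := xf w (hAL w hw) j
    have h2 := (dist_le_pi_dist (f w) (f a) j).trans (hδ2 w (L0K w (hAL w hw)) a (L0K a (hAL a ha)) ((hA3 w hw a ha).trans hr.le))
    rw [Real.dist_eq] at h2
    have := abs_sub_le (x w (Fin.succ j)) (f w j) (f a j)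
    linarith
  have h3 := cross_close hcr ⟨a, ha⟩ (fun w _ => x0 w) (close A a ha AL hA3) (close B b hb BL hB3)
  have h4 : dist (f a) (f b) ≤ γ/2 := by
    rw [dist_pi_le_iff (by positivity)]
    intro j
    rw [Real.dist_eq]
    linarith [h3 j]
  have hFG : Disjoint F G := by
    rw [Finset.disjoint_left]
    intro i hi hi'
    exact Finset.disjoint_left.1 hdis (hF.2 i hi) (hG.2 i hi')
  have h5 := gap F hF.1 G hG.1 hFG a (hA2 a ha) b (hB2 b hb)
  linarith

end Emb

namespace Emb
open scoped Classical

noncomputable def pc (p : ℝ) : ℝ := max 0 (min p 1)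

lemma pc_nonneg (p : ℝ) : 0 ≤ pc p := le_max_left _ _
lemma pc_le_one (p : ℝ) : pc p ≤ 1 := max_le zero_le_one (min_le_right _ _)

lemma bern_true (p : ℝ) : bernoulliBool p {true} = ENNReal.ofReal (pc p) := by
  simp [bernoulliBool, pc]

lemma bern_false (p : ℝ) : bernoulliBool p {false} = ENNReal.ofReal (1 - pc p) := by
  simp [bernoulliBool, pc]

instance bern_prob (p : ℝ) : IsProbabilityMeasure (bernoulliBool p) := by
  constructor
  simp only [bernoulliBool, Measure.add_apply, Measure.smul_apply, smul_eq_mul,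
    measure_univ, mul_one]
  change ENNReal.ofReal (pc p) + ENNReal.ofReal (1 - pc p) = 1
  rw [← ENNReal.ofReal_add (pc_nonneg p) (sub_nonneg.2 (pc_le_one p))]
  simp

instance Y_prob (n d : ℕ) (p : ℝ) : IsProbabilityMeasure (YMeasure n d p) := by
  unfold YMeasure; infer_instance

lemma Y_cyl (n d : ℕ) (p : ℝ) (A B : Finset (FaceIdx n d)) (h : Disjoint A B) :
    YMeasure n d p {ω | (∀ i ∈ A, ω i = true) ∧ ∀ i ∈ B, ω i = false} =
      ENNReal.ofReal (pc p ^ A.card * (1 - pc p) ^ B.card) := by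
  have e : {ω : FaceIdx n d → Bool | (∀ i ∈ A, ω i = true) ∧ ∀ i ∈ B, ω i = false} =
      Set.pi Set.univ (fun i => if i ∈ A then {true} else if i ∈ B then {false} else Set.univ) := by
    ext ω
    simp only [Set.mem_ofPred_eq, Set.mem_pi, Set.mem_univ, true_imp_iff]
    constructor
    · rintro ⟨h1, h2⟩ i
      split_ifs with hA hB
      · exact h1 i hA
      · exact h2 i hB
      · trivial
    · intro hi
      refine ⟨fun i hA => ?_, fun i hB => ?_⟩
      · have := hi i; rw [if_pos hA] at this; exact this
      · have := hi i
        rw [if_neg (Finset.disjoint_right.1 h hB), if_pos hB] at this; exact this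
  rw [e, YMeasure, Measure.pi_pi]
  have : ∀ i : FaceIdx n d, bernoulliBool p (if i ∈ A then {true} else if i ∈ B then {false} else Set.univ)
      = (if i ∈ A then ENNReal.ofReal (pc p) else 1) * (if i ∈ B then ENNReal.ofReal (1 - pc p) else 1) := by
    intro i
    split_ifs with hA hB hB
    · exact absurd hB (Finset.disjoint_left.1 h hA)
    · rw [bern_true, mul_one]
    · rw [bern_false, one_mul]
    · rw [measure_univ, mul_one]
  rw [Finset.prod_congr rfl (fun i _ => this i), Finset.prod_mul_distrib, Finset.prod_ite_mem, Finset.prod_ite_mem,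
    Finset.univ_inter, Finset.univ_inter, Finset.prod_const, Finset.prod_const,
    ENNReal.ofReal_mul (pow_nonneg (pc_nonneg p) _), ENNReal.ofReal_pow (pc_nonneg p),
    ENNReal.ofReal_pow (sub_nonneg.2 (pc_le_one p))]

lemma Y_all (n d : ℕ) (p : ℝ) (A : Finset (FaceIdx n d)) :
    YMeasure n d p {ω | ∀ i ∈ A, ω i = true} = ENNReal.ofReal (pc p ^ A.card) := by
  have := Y_cyl n d p A ∅ (Finset.disjoint_empty_right _)
  simpa using this

lemma whp (d : ℕ) (p : ℕ → ℝ) (G : ∀ n, Set (FaceIdx n d → Bool)) (g : ℕ → ℝ)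
    (hg : Tendsto g atTop (nhds 0))
    (h : ∀ᶠ n in atTop, YMeasure n d (p n) (G n)ᶜ ≤ ENNReal.ofReal (g n)) :
    Tendsto (fun n => YMeasure n d (p n) (G n)) atTop (nhds 1) := by
  have h0 : Tendsto (fun n => YMeasure n d (p n) (G n)ᶜ) atTop (nhds 0) := by
    refine tendsto_of_tendsto_of_tendsto_of_le_of_le' tendsto_const_nhds ?_ (Eventually.of_forall fun _ => zero_le) h
    simpa using ENNReal.tendsto_ofReal hg
  have h1 : Tendsto (fun n => 1 - YMeasure n d (p n) (G n)ᶜ) atTop (nhds (1 - 0)) :=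
    ENNReal.Tendsto.sub tendsto_const_nhds h0 (Or.inl ENNReal.one_ne_top)
  rw [tsub_zero] at h1
  refine h1.congr fun n => ?_
  rw [← prob_compl_eq_one_sub (Set.toFinite _).measurableSet, compl_compl]

/-- union bound over independent sets -/
lemma rank_bound {E : Type*} [AddCommGroup E] [Module (ZMod 2) E] (n d : ℕ) (p : ℝ)
    (g : FaceIdx n d → E) (P : Submodule (ZMod 2) E) [FiniteDimensional (ZMod 2) P] (r : ℕ)
    (hr : Module.finrank (ZMod 2) P ≤ r) (hg : ∀ i, g i ∈ P) (Fa : Finset (FaceIdx n d))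
    (u : ℕ) (l : ℝ) (l0 : 0 < l) (l1 : l ≤ 1) :
    YMeasure n d p {ω | u ≤ (Fa.filter (fun i => g i ∉ Submodule.span (ZMod 2) (g '' {j | j ∈ Fa ∧ ω j = true}))).card}
      ≤ ENNReal.ofReal (l⁻¹ ^ r * Real.exp (l * pc p * Fa.card) * Real.exp (- (pc p * u))) := by
  set U : Finset (FaceIdx n d) → Finset (FaceIdx n d) := fun B =>
    Fa.filter (fun i => g i ∉ Submodule.span (ZMod 2) (g '' (B : Set (FaceIdx n d)))) with hU
  have UB : ∀ B, Disjoint B (U B) := by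
    intro B
    rw [Finset.disjoint_left]
    intro i hi hiU
    exact (Finset.mem_filter.1 hiU).2 (Submodule.subset_span ⟨i, hi, rfl⟩)
  set Bs := Fa.powerset.filter (fun B => B.card ≤ r ∧ u ≤ (U B).card) with hBs
  have sub : {ω | u ≤ (Fa.filter (fun i => g i ∉ Submodule.span (ZMod 2) (g '' {j | j ∈ Fa ∧ ω j = true}))).card}
      ⊆ ⋃ B ∈ Bs, {ω : FaceIdx n d → Bool | (∀ i ∈ B, ω i = true) ∧ ∀ i ∈ U B, ω i = false} := by
    intro ω hω
    rw [Set.mem_ofPred_eq] at hω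
    obtain ⟨κ, a, ainj, hspan, hli⟩ := exists_linearIndependent' (ZMod 2) (fun j : {j // j ∈ Fa ∧ ω j = true} => g j)
    have : Finite κ := Finite.of_injective a ainj
    have := Fintype.ofFinite κ
    set B : Finset (FaceIdx n d) := Finset.univ.image (fun k => (a k : FaceIdx n d)) with hB
    have e1 : Submodule.span (ZMod 2) (g '' (B : Set (FaceIdx n d))) =
        Submodule.span (ZMod 2) (g '' {j | j ∈ Fa ∧ ω j = true}) := by
      have h1 : g '' (B : Set (FaceIdx n d)) = Set.range ((fun j : {j // j ∈ Fa ∧ ω j = true} => g j) ∘ a) := by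
        ext x; simp [hB]
      have h2 : g '' {j | j ∈ Fa ∧ ω j = true} = Set.range (fun j : {j // j ∈ Fa ∧ ω j = true} => g j) := by
        ext x; simp
      rw [h1, h2, hspan]
    have hUB : U B = Fa.filter (fun i => g i ∉ Submodule.span (ZMod 2) (g '' {j | j ∈ Fa ∧ ω j = true})) := by
      simp only [hU, e1]
    have cB : B.card ≤ r := by
      have : B.card ≤ Fintype.card κ := Finset.card_image_le
      refine this.trans ?_
      rw [← finrank_span_eq_card hli]
      refine (Submodule.finrank_mono ?_).trans hr
      rw [Submodule.span_le]
      rintro _ ⟨k, rfl⟩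
      exact hg _
    have hBt : ∀ i ∈ B, i ∈ Fa ∧ ω i = true := by
      intro i hi
      obtain ⟨k, -, rfl⟩ := Finset.mem_image.1 hi
      exact (a k).2
    refine Set.mem_biUnion (x := B) ?_ ?_
    · exact Finset.mem_filter.2 ⟨Finset.mem_powerset.2 fun i hi => (hBt i hi).1, cB, by rw [hUB]; exact hω⟩
    · refine ⟨fun i hi => (hBt i hi).2, fun i hi => ?_⟩
      rw [hUB, Finset.mem_filter] at hi
      by_contra hne
      exact hi.2 (Submodule.subset_span ⟨i, ⟨hi.1, by simpa using hne⟩, rfl⟩)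
  refine (measure_mono sub).trans ((measure_biUnion_finset_le _ _).trans ?_)
  rw [Finset.sum_congr rfl (fun B _ => Y_cyl n d p B (U B) (UB B)),
    ← ENNReal.ofReal_sum_of_nonneg (fun B _ => mul_nonneg (pow_nonneg (pc_nonneg p) _) (pow_nonneg (sub_nonneg.2 (pc_le_one p)) _))]
  apply ENNReal.ofReal_le_ofReal
  have p0 := pc_nonneg p
  have p1 : 0 ≤ 1 - pc p := sub_nonneg.2 (pc_le_one p)
  calc ∑ B ∈ Bs, pc p ^ B.card * (1 - pc p) ^ (U B).card
      ≤ ∑ B ∈ Bs, (l⁻¹ ^ r * (l * pc p) ^ B.card) * Real.exp (- (pc p * u)) := by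
        refine Finset.sum_le_sum fun B hB => ?_
        obtain ⟨-, h1, h2⟩ := Finset.mem_filter.1 hB
        apply mul_le_mul _ _ (pow_nonneg p1 _) (by positivity)
        · rw [mul_pow, ← mul_assoc]
          have : 1 ≤ l⁻¹ ^ r * l ^ B.card := by
            rw [inv_pow, inv_mul_eq_div, one_le_div (by positivity)]
            exact pow_le_pow_of_le_one l0.le l1 h1
          nlinarith [pow_nonneg p0 B.card]
        · calc (1 - pc p) ^ (U B).card ≤ (1 - pc p) ^ u := pow_le_pow_of_le_one p1 (by linarith) h2
            _ ≤ (Real.exp (- pc p)) ^ u := pow_le_pow_left₀ p1 (by linarith [Real.add_one_le_exp (- pc p)]) _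
            _ = _ := by rw [← Real.exp_nat_mul]; congr 1; ring
    _ ≤ ∑ B ∈ Fa.powerset, (l⁻¹ ^ r * (l * pc p) ^ B.card) * Real.exp (- (pc p * u)) :=
        Finset.sum_le_sum_of_subset_of_nonneg (Finset.filter_subset _ _) (fun _ _ _ => by positivity)
    _ = l⁻¹ ^ r * (l * pc p + 1) ^ Fa.card * Real.exp (- (pc p * u)) := by
        rw [← Finset.sum_mul, ← Finset.mul_sum]
        congr 2
        have := Finset.sum_pow_mul_eq_add_pow (l * pc p) 1 Fa
        simpa using this
    _ ≤ _ := by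
        gcongr
        calc (l * pc p + 1) ^ Fa.card ≤ (Real.exp (l * pc p)) ^ Fa.card :=
              pow_le_pow_left₀ (by positivity) (Real.add_one_le_exp _) _
          _ = _ := by rw [← Real.exp_nat_mul]; congr 1; ring

end Emb

namespace Emb
open scoped Classical

def blk (n d : ℕ) (x : Fin n) : Fin (2*d+3) := ⟨x % (2*d+3), Nat.mod_lt _ (by omega)⟩

def vtx (n d : ℕ) (i : Fin (2*d+3)) (a : Fin (n/(2*d+3))) : Fin n :=
  ⟨a * (2*d+3) + i, by
    have h1 : (a + 1 : ℕ) * (2*d+3) ≤ n/(2*d+3) * (2*d+3) := Nat.mul_le_mul_right _ a.2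
    have h2 := Nat.div_mul_le_self n (2*d+3)
    have := i.2
    nlinarith⟩

lemma blk_vtx (n d : ℕ) (i : Fin (2*d+3)) (a : Fin (n/(2*d+3))) : blk n d (vtx n d i a) = i := by
  apply Fin.ext
  simp only [blk, vtx]
  rw [Nat.mul_add_mod_self_right]
  exact Nat.mod_eq_of_lt i.2

lemma vtx_inj (n d : ℕ) (i : Fin (2*d+3)) (a b : Fin (n/(2*d+3))) (h : vtx n d i a = vtx n d i b) : a = b := by
  have := congrArg Fin.val h
  simp only [vtx] at this
  apply Fin.ext
  have h2 : (a:ℕ) * (2*d+3) = b * (2*d+3) := by omega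
  exact Nat.eq_of_mul_eq_mul_right (by omega) h2

def face (n d : ℕ) (S : Finset (Fin (2*d+3))) (a : Fin (2*d+3) → Fin (n/(2*d+3))) : Finset (Fin n) :=
  S.image (fun i => vtx n d i (a i))

lemma face_card (n d : ℕ) (S : Finset (Fin (2*d+3))) (a : Fin (2*d+3) → Fin (n/(2*d+3))) :
    (face n d S a).card = S.card := by
  apply Finset.card_image_of_injective
  intro i j h
  have := congrArg (blk n d) h
  simpa [blk_vtx] using this

lemma face_count (n d : ℕ) (S : Finset (Fin (2*d+3))) (hS : S.card = d + 1) (U : Finset (FaceIdx n d)) :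
    (Finset.univ.filter (fun a : Fin (2*d+3) → Fin (n/(2*d+3)) => (⟨face n d S a, by rw [face_card, hS]⟩ : FaceIdx n d) ∈ U)).card
      ≤ U.card * (n/(2*d+3)) ^ (d+2) := by
  have : U.card * (n/(2*d+3)) ^ (d+2) = (U ×ˢ (Finset.univ : Finset ({i // i ∉ S} → Fin (n/(2*d+3))))).card := by
    rw [Finset.card_product, Finset.card_univ, Fintype.card_fun, Fintype.card_fin, Fintype.card_subtype_compl]
    simp [hS]
    left; congr 1; omega
  rw [this]
  refine Finset.card_le_card_of_injOn (fun a => (⟨face n d S a, by rw [face_card, hS]⟩, fun i => a i)) ?_ ?_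
  · intro a ha
    simpa using ha
  · intro a _ b _ h
    simp only [Prod.mk.injEq, Subtype.mk.injEq] at h
    obtain ⟨h1, h2⟩ := h
    funext i
    by_cases hi : i ∈ S
    · have : vtx n d i (a i) ∈ face n d S b := by
        rw [← h1]; exact Finset.mem_image_of_mem _ hi
      obtain ⟨j, hj, hj2⟩ := Finset.mem_image.1 this
      have h3 := congrArg (blk n d) hj2
      simp only [blk_vtx] at h3
      subst h3
      exact (vtx_inj _ _ _ _ _ hj2).symm
    · exact congrFun h2 ⟨i, hi⟩

def FaS (n d : ℕ) (S : Finset (Fin (2*d+3))) : Finset (FaceIdx n d) :=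
  Finset.univ.filter (fun F => ∀ i ∈ F.1, blk n d i ∈ S)

noncomputable def US (n d : ℕ) (S : Finset (Fin (2*d+3))) (ω : FaceIdx n d → Bool) : Finset (FaceIdx n d) :=
  (FaS n d S).filter (fun i => bd (sg i.1) ∉ Submodule.span (ZMod 2)
    ((fun F : FaceIdx n d => bd (sg F.1)) '' {j | j ∈ FaS n d S ∧ ω j = true}))

lemma no_emb_of_good {n d : ℕ} (hd : 1 ≤ d) (hn : 2*d+3 ≤ n) (ω : FaceIdx n d → Bool)
    (hg : ∀ S : Finset (Fin (2*d+3)), S.card = d + 1 → (US n d S ω).card ≤ (n/(2*d+3))^(d+1) / (2^(2*d+3)+1)) :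
    ¬ ∃ φ : ↥(geomReal n (Ycomplex n d ω)) → (Fin (2 * d) → ℝ), Topology.IsEmbedding φ := by
  set K := Ycomplex n d ω with hK
  rintro ⟨φ, hφ⟩
  have hq : 0 < n/(2*d+3) := Nat.div_pos hn (by omega)
  have : ∃ a : Fin (2*d+3) → Fin (n/(2*d+3)), ∀ S (hS : S.card = d + 1),
      (⟨face n d S a, by rw [face_card, hS]⟩ : FaceIdx n d) ∉ US n d S ω := by
    by_contra hcon
    push Not at hcon
    set bad : Finset (Fin (2*d+3)) → Finset (Fin (2*d+3) → Fin (n/(2*d+3))) := fun S =>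
      Finset.univ.filter (fun a => ∃ hS : S.card = d+1, (⟨face n d S a, by rw [face_card, hS]⟩ : FaceIdx n d) ∈ US n d S ω) with hbad
    have h1 : (Finset.univ : Finset (Fin (2*d+3) → Fin (n/(2*d+3)))) ⊆ Finset.univ.biUnion bad := by
      intro a _
      obtain ⟨S, hS, h⟩ := hcon a
      exact Finset.mem_biUnion.2 ⟨S, Finset.mem_univ _, Finset.mem_filter.2 ⟨Finset.mem_univ _, hS, h⟩⟩
    have h2 : ∀ S ∈ (Finset.univ : Finset (Finset (Fin (2*d+3)))), (bad S).card ≤ (n/(2*d+3))^(d+1) / (2^(2*d+3)+1) * (n/(2*d+3))^(d+2) := by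
      intro S _
      by_cases hS : S.card = d+1
      · refine le_trans (le_of_eq ?_) ((face_count n d S hS (US n d S ω)).trans (Nat.mul_le_mul_right _ (hg S hS)))
        congr 1
        ext a
        simp [hbad, hS]
      · have : bad S = ∅ := by
          ext a; simp [hbad, hS]
        rw [this]; simp
    have h3 := (Finset.card_le_card h1).trans (Finset.card_biUnion_le.trans (Finset.sum_le_sum h2))
    simp only [Finset.card_univ, Fintype.card_fun, Fintype.card_fin, Finset.sum_const, Fintype.card_finset, smul_eq_mul] at h3
    set q := n/(2*d+3)
    set x := q^(d+1) / (2^(2*d+3)+1)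
    have h4 : x * (2^(2*d+3)+1) ≤ q^(d+1) := Nat.div_mul_le_self _ _
    have h5 : q^(2*d+3) = q^(d+1) * q^(d+2) := by rw [← pow_add]; congr 1; omega
    rw [h5] at h3
    have h6 : 0 < q^(d+2) := by positivity
    have h7 : q^(d+1) ≤ 2^(2*d+3) * x := by
      by_contra hlt
      push Not at hlt
      have := Nat.mul_lt_mul_of_pos_right hlt h6
      linarith
    have h8 : 0 < q^(d+1) := by positivity
    have : x = 0 := by nlinarith
    rw [this] at h7
    omega
  obtain ⟨a, ha⟩ := this
  set v : Fin (2*d+3) → Fin n := fun i => vtx n d i (a i) with hv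
  have hM : ∀ σ : Finset (Fin (2*d+3)), ∃ z : Ch (Fin n), σ.card = d + 1 →
      (z ∈ Sup {F | F ∈ K ∧ F.card = d + 1 ∧ ∀ i ∈ F, blk n d i ∈ σ}) ∧ bd z = bd (sg (σ.image v)) := by
    intro σ
    by_cases hσ : σ.card = d + 1
    swap
    · exact ⟨0, fun h => absurd h hσ⟩
    have h1 := ha σ hσ
    simp only [US, Finset.mem_filter, not_and, not_not] at h1
    have h2 := h1 (by
      simp only [FaS, Finset.mem_filter, Finset.mem_univ, true_and, face]
      intro i hi
      obtain ⟨j, hj, rfl⟩ := Finset.mem_image.1 hi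
      rwa [blk_vtx])
    have h3 : Submodule.span (ZMod 2) ((fun F : FaceIdx n d => bd (sg F.1)) '' {j | j ∈ FaS n d σ ∧ ω j = true}) ≤
        Submodule.map bd (Sup {F | F ∈ K ∧ F.card = d + 1 ∧ ∀ i ∈ F, blk n d i ∈ σ}) := by
      rw [Submodule.span_le]
      rintro _ ⟨F, ⟨hF1, hF2⟩, rfl⟩
      refine ⟨sg F.1, sg_mem_Sup ⟨?_, F.2, (Finset.mem_filter.1 hF1).2⟩, rfl⟩
      exact Finset.mem_filter.2 ⟨Finset.mem_univ _, Or.inr ⟨F.2, hF2⟩⟩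
    obtain ⟨z, hz, hz2⟩ := h3 h2
    exact ⟨z, fun _ => ⟨hz, hz2⟩⟩
  choose M hM using hM
  set f : EE n → (Fin (2*d) → ℝ) := fun x => if h : x ∈ geomReal n K then φ ⟨x, h⟩ else 0 with hf
  have hfr : (geomReal n K).domRestrict f = φ := by
    funext x
    simp [hf, Set.domRestrict, x.2]
  refine nonEmb hd K (blk n d) v (fun i => blk_vtx n d i (a i)) (fun s hs => Finset.mem_filter.2 ⟨Finset.mem_univ _, Or.inl hs⟩) M
    (fun σ hσ => (hM σ hσ).1) (fun σ hσ => (hM σ hσ).2) f ?_ ?_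
  · rw [continuousOn_iff_continuous_domRestrict, hfr]
    exact hφ.continuous
  · rw [Set.injOn_iff_injective, hfr]
    exact hφ.injective

lemma good_prob {n d : ℕ} (S : Finset (Fin (2*d+3))) (p : ℝ) (u : ℕ) (l : ℝ) (l0 : 0 < l) (l1 : l ≤ 1)  :
    YMeasure n d p {ω | u ≤ (US n d S ω).card} ≤
      ENNReal.ofReal (l⁻¹ ^ (n^d) * Real.exp (l * pc p * n^(d+1)) * Real.exp (- (pc p * u))) := by
  set P : Submodule (ZMod 2) (Ch (Fin n)) := Submodule.span (ZMod 2) (((Finset.univ.powersetCard d).image sg : Finset (Ch (Fin n))) : Set (Ch (Fin n))) with hP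
  have : FiniteDimensional (ZMod 2) P := FiniteDimensional.span_finset _ _
  have hr : Module.finrank (ZMod 2) P ≤ n^d := by
    refine (finrank_span_finset_le_card _).trans (Finset.card_image_le.trans ?_)
    rw [Finset.card_powersetCard, Finset.card_univ, Fintype.card_fin]
    exact Nat.choose_le_pow n d
  have := rank_bound n d p (fun F : FaceIdx n d => bd (sg F.1)) P (n^d) hr ?_ (FaS n d S) u l l0 l1
  · refine this.trans (ENNReal.ofReal_le_ofReal ?_)
    have hc : ((FaS n d S).card : ℝ) ≤ n^(d+1) := by
      have h1 : (FaS n d S).card ≤ n^(d+1) := by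
        refine (Finset.card_filter_le _ _).trans ?_
        rw [Finset.card_univ, Fintype.card_finset_len, Fintype.card_fin]
        exact Nat.choose_le_pow n (d+1)
      exact_mod_cast h1
    have := pc_nonneg p
    gcongr
  · intro F
    rw [bd_sg]
    refine Submodule.sum_mem _ fun i hi => Submodule.subset_span ?_
    rw [Finset.mem_coe]
    refine Finset.mem_image_of_mem _ ?_
    rw [Finset.mem_powersetCard, Finset.card_erase_of_mem hi, F.2]
    exact ⟨Finset.subset_univ _, rfl⟩

theorem part2 (d : ℕ) (hd : 1 ≤ d) : ∃ c₂ : ℝ, 0 < c₂ ∧ ∀ p : ℕ → ℝ, (∀ n : ℕ, c₂ / n ≤ p n) →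
        Tendsto (fun n : ℕ => YMeasure n d (p n)
            {ω | ¬ ∃ φ : ↥(geomReal n (Ycomplex n d ω)) → (Fin (2 * d) → ℝ),
              Topology.IsEmbedding φ})
          atTop (nhds (1 : ENNReal)) := by
  set e : ℝ := ((2 * (2*d+3))^(d+1) * (2^(2*d+3)+1))⁻¹ with he
  have hX : (1:ℝ) ≤ (2 * (2*d+3))^(d+1) * (2^(2*d+3)+1) := by
    have h1 : (1:ℝ) ≤ (2 * (2*d+3))^(d+1) := one_le_pow₀ (by linarith [Nat.cast_nonneg (α := ℝ) d])
    have h2 : (1:ℝ) ≤ (2^(2*d+3)+1) := by linarith [pow_pos (two_pos : (0:ℝ) < 2) (2*d+3)]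
    nlinarith
  have e0 : 0 < e := inv_pos.2 (by linarith)
  have e1 : e ≤ 1 := inv_le_one_of_one_le₀ hX
  set l := e / 2 with hl
  have l0 : 0 < l := by positivity
  have l1 : l ≤ 1 := by linarith
  have hlog : 0 ≤ Real.log l⁻¹ := Real.log_nonneg ((one_le_inv₀ l0).2 l1)
  set c := (Real.log l⁻¹ + 1) / l with hc
  have c0 : 0 < c := by positivity
  refine ⟨c, c0, fun p hp => ?_⟩
  refine whp d p _ (fun n => 2^(2*d+3) * Real.exp (-(n:ℝ))) ?_ ?_
  · have : Tendsto (fun n : ℕ => Real.exp (-(n:ℝ))) atTop (nhds 0) :=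
      Real.tendsto_exp_neg_atTop_nhds_zero.comp tendsto_natCast_atTop_atTop
    simpa using this.const_mul ((2:ℝ)^(2*d+3))
  · filter_upwards [eventually_ge_atTop (2*d+3), eventually_ge_atTop ⌈c⌉₊] with n hn hn2
    have hnc : c ≤ n := (Nat.le_ceil c).trans (by exact_mod_cast hn2)
    have hn0 : (0:ℝ) < n := by linarith
    have hp1 : c ≤ pc (p n) * n := by
      have : c / n ≤ pc (p n) := le_max_of_le_right (le_min (hp n) ((div_le_one hn0).2 hnc))
      rwa [div_le_iff₀ hn0] at this
    set u := (n/(2*d+3))^(d+1) / (2^(2*d+3)+1) + 1 with hu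
    have hue : e * n^(d+1) ≤ u := by
      have h1 : (n:ℝ) / (2 * (2*d+3)) ≤ ((n/(2*d+3) : ℕ) : ℝ) := by
        rw [div_le_iff₀ (by positivity)]
        have h3 : n ≤ n/(2*d+3) * (2 * (2*d+3)) := by
          have := Nat.div_add_mod n (2*d+3)
          have h4 := Nat.mod_lt n (show 0 < 2*d+3 by omega)
          have h5 : 1 ≤ n/(2*d+3) := Nat.div_pos hn (by omega)
          nlinarith
        exact_mod_cast h3
      have h2 : (((n/(2*d+3))^(d+1) : ℕ) : ℝ) / ((2^(2*d+3)+1 : ℕ) : ℝ) ≤ u := by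
        rw [hu]; push_cast
        rw [div_le_iff₀ (by positivity)]
        have := Nat.lt_div_mul_add (a := (n/(2*d+3))^(d+1)) (b := 2^(2*d+3)+1) (by positivity)
        have h4 : (n/(2*d+3))^(d+1) ≤ ((n/(2*d+3))^(d+1) / (2^(2*d+3)+1) + 1) * (2^(2*d+3)+1) := by
          linarith
        exact_mod_cast h4
      refine le_trans ?_ h2
      push_cast
      rw [he, mul_inv, mul_comm, ← mul_assoc, ← div_eq_mul_inv, ← div_eq_mul_inv, ← div_pow]
      gcongr
    have sub : {ω : FaceIdx n d → Bool | ¬ ∃ φ : ↥(geomReal n (Ycomplex n d ω)) → (Fin (2 * d) → ℝ), Topology.IsEmbedding φ}ᶜ ⊆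
        ⋃ S ∈ (Finset.univ : Finset (Finset (Fin (2*d+3)))), {ω | u ≤ (US n d S ω).card} := by
      intro ω hω
      by_contra hcon
      apply hω
      refine no_emb_of_good hd hn ω fun S hS => ?_
      by_contra hlt
      push Not at hlt
      exact hcon (Set.mem_biUnion (Finset.mem_coe.2 (Finset.mem_univ S)) hlt)
    refine (measure_mono sub).trans ((measure_biUnion_finset_le _ _).trans ?_)
    have each : ∀ S ∈ (Finset.univ : Finset (Finset (Fin (2*d+3)))),
        YMeasure n d (p n) {ω | u ≤ (US n d S ω).card} ≤ ENNReal.ofReal (Real.exp (-(n:ℝ))) := by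
      intro S _
      refine (good_prob S (p n) u l l0 l1).trans (ENNReal.ofReal_le_ofReal ?_)
      have : l⁻¹ ^ (n^d) = Real.exp (n^d * Real.log l⁻¹) := by
        rw [← Real.exp_log (inv_pos.2 l0), Real.log_exp, ← Real.exp_nat_mul]; push_cast; rfl
      rw [this, ← Real.exp_add, ← Real.exp_add]
      apply Real.exp_le_exp.2
      have q0 := pc_nonneg (p n)
      have h1 : pc (p n) * (2 * l * n^(d+1)) ≤ pc (p n) * u := by
        refine mul_le_mul_of_nonneg_left (le_trans (le_of_eq ?_) hue) q0
        rw [hl]; ring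
      have h2 : (n:ℝ)^d * (Real.log l⁻¹ + 1) ≤ l * pc (p n) * n^(d+1) := by
        have h3 : Real.log l⁻¹ + 1 ≤ l * (pc (p n) * n) := by
          have := mul_le_mul_of_nonneg_left hp1 l0.le
          rwa [hc, mul_div_cancel₀ _ l0.ne'] at this
        calc (n:ℝ)^d * (Real.log l⁻¹ + 1) ≤ (n:ℝ)^d * (l * (pc (p n) * n)) := by gcongr
          _ = _ := by ring
      have h4 : (n:ℝ) ≤ n^d := by
        have h5 : n ≤ n^d := Nat.le_self_pow (by omega) n
        exact_mod_cast h5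
      nlinarith
    refine (Finset.sum_le_sum each).trans ?_
    rw [Finset.sum_const, Finset.card_univ, Fintype.card_finset, Fintype.card_fin,
      ENNReal.ofReal_mul (by positivity), nsmul_eq_mul, ENNReal.ofReal_pow (by norm_num)]
    simp

end Emb

namespace Emb
open scoped Classical

def EmbPL (n d : ℕ) (K : Finset (Finset (Fin n))) : Prop :=
  ∃ f : EE n → (Fin (2*d) → ℝ), ContinuousOn f (geomReal n K) ∧ Set.InjOn f (geomReal n K) ∧
    ∃ 𝒜 : Finset (EE n →ₗ[ℝ] (Fin (2*d) → ℝ)), ∀ x ∈ geomReal n K, ∃ A ∈ 𝒜, f x = A x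

lemma geomReal_mono {n : ℕ} {K K' : Finset (Finset (Fin n))} (h : K ⊆ K') : geomReal n K ⊆ geomReal n K' := by
  intro x hx
  rw [mem_geomReal] at hx ⊢
  obtain ⟨F, hF, h2⟩ := hx
  exact ⟨F, h hF, h2⟩

lemma EmbPL.mono {n d : ℕ} {K K' : Finset (Finset (Fin n))} (h : K ⊆ K') : EmbPL n d K' → EmbPL n d K := by
  rintro ⟨f, h1, h2, 𝒜, h3⟩
  have := geomReal_mono h
  exact ⟨f, h1.mono this, h2.mono this, 𝒜, fun x hx => h3 x (this hx)⟩

lemma EmbPL.isEmb {n d : ℕ} {K : Finset (Finset (Fin n))} (h : EmbPL n d K) :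
    ∃ φ : ↥(geomReal n K) → (Fin (2 * d) → ℝ), Topology.IsEmbedding φ := by
  obtain ⟨f, h1, h2, -⟩ := h
  have : CompactSpace (geomReal n K) := isCompact_iff_compactSpace.1 (isCompact_geomReal K)
  refine ⟨(geomReal n K).domRestrict f, Topology.IsClosedEmbedding.isEmbedding ?_⟩
  exact (continuousOn_iff_continuous_domRestrict.1 h1).isClosedEmbedding (Set.injOn_iff_injective.1 h2)

noncomputable def Dsp {n : ℕ} (G : Finset (Fin n)) (g0 : Fin n) : Finset (EE n) :=
  (G.erase g0).image (fun g => (Pi.single g 1 - Pi.single g0 1 : EE n))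

lemma mem_Dsp {n : ℕ} {G : Finset (Fin n)} {g0 : Fin n} (h0 : g0 ∈ G) (c : EE n) (hc : ∀ i, i ∉ G → c i = 0)
    (hs : ∑ i, c i = 0) : c ∈ Submodule.span ℝ (Dsp G g0 : Set (EE n)) := by
  have : c = ∑ g ∈ G.erase g0, c g • (Pi.single g 1 - Pi.single g0 1 : EE n) := by
    have h1 : c = ∑ g, c g • (Pi.single g 1 - Pi.single g0 1 : EE n) := by
      simp only [smul_sub, Finset.sum_sub_distrib]
      rw [← Finset.sum_smul, hs, zero_smul, sub_zero]
      ext i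
      simp [Finset.sum_apply, Pi.single_apply]
    nth_rewrite 1 [h1]
    symm
    apply Finset.sum_subset (Finset.subset_univ _)
    intro g _ hg
    by_cases hgG : g ∈ G
    · have : g = g0 := by
        by_contra hne
        exact hg (Finset.mem_erase.2 ⟨hne, hgG⟩)
      rw [this]; simp
    · rw [hc g hgG, zero_smul]
  rw [this]
  refine Submodule.sum_mem _ fun g hg => Submodule.smul_mem _ _ (Submodule.subset_span ?_)
  exact Finset.mem_coe.2 (Finset.mem_image_of_mem _ hg)

lemma exists_generic {m : ℕ} {ι : Type*} (I : Finset ι) (P : ι → Submodule ℝ (Fin m → ℝ)) (h : ∀ i ∈ I, P i ≠ ⊤) :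
    ∃ w, ∀ i ∈ I, w ∉ P i := by
  have := Subspace.biUnion_ne_univ_of_top_notMem (k := ℝ) (s := I.image P) (by
    intro hmem
    obtain ⟨i, hi, h2⟩ := Finset.mem_image.1 hmem
    exact h i hi h2)
  rw [Set.ne_univ_iff_exists_notMem] at this
  obtain ⟨w, hw⟩ := this
  refine ⟨w, fun i hi hwi => hw ?_⟩
  exact Set.mem_biUnion (Finset.mem_coe.2 (Finset.mem_image_of_mem P hi)) hwi

/-- pushing off in a generic direction -/
lemma push_off {n d : ℕ} (hd : 1 ≤ d) (K : Finset (Finset (Fin n))) (hK : ∀ F ∈ K, F.card ≤ d + 1)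
    (𝒜 : Finset (EE n →ₗ[ℝ] (Fin (2*d) → ℝ))) :
    ∃ w : Fin (2*d) → ℝ, ∃ ε : ℝ, 0 < ε ∧ ∀ G ∈ K, G.card ≤ d → ∀ F ∈ K, ∀ A ∈ 𝒜, ∀ B ∈ 𝒜, ∀ b z : EE n,
      (∀ i, i ∉ G → b i = 0) → ∑ i, b i = 1 → (∀ i, i ∉ F → z i = 0) → ∑ i, z i = 1 →
      ∀ t, 0 < t → t ≤ ε → A b + t • w ≠ B z := by
  set I := (((K.filter (fun G => G.card ≤ d)) ×ˢ (Finset.univ : Finset (Fin n))) ×ˢ (K ×ˢ (Finset.univ : Finset (Fin n)))) ×ˢ (𝒜 ×ˢ 𝒜) with hI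
  set I' := I.filter (fun i => i.1.1.2 ∈ i.1.1.1 ∧ i.1.2.2 ∈ i.1.2.1) with hI'
  set gens : (((Finset (Fin n) × Fin n) × (Finset (Fin n) × Fin n)) × ((EE n →ₗ[ℝ] (Fin (2*d) → ℝ)) × (EE n →ₗ[ℝ] (Fin (2*d) → ℝ)))) → Finset (Fin (2*d) → ℝ) :=
    fun i => (Dsp i.1.1.1 i.1.1.2).image i.2.1 ∪ (Dsp i.1.2.1 i.1.2.2).image i.2.2 with hgens
  obtain ⟨w, hw⟩ := exists_generic I' (fun i => Submodule.span ℝ (gens i : Set (Fin (2*d) → ℝ))) (by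
    intro i hi htop
    simp only [hI', hI, Finset.mem_filter, Finset.mem_product] at hi
    have h1 : Module.finrank ℝ (Submodule.span ℝ (gens i : Set (Fin (2*d) → ℝ))) = 2 * d := by
      rw [htop, finrank_top]; simp
    have h2 := finrank_span_finset_le_card (R := ℝ) (gens i)
    unfold Set.finrank at h2
    rw [h1] at h2
    have h3 : (gens i).card ≤ (d - 1) + d := by
      refine (Finset.card_union_le _ _).trans (add_le_add ?_ ?_)
      · refine Finset.card_image_le.trans (Finset.card_image_le.trans ?_)
        rw [Finset.card_erase_of_mem hi.2.1]
        have := hi.1.1.1.1.2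
        omega
      · refine Finset.card_image_le.trans (Finset.card_image_le.trans ?_)
        rw [Finset.card_erase_of_mem hi.2.2]
        have := hK _ hi.1.1.2.1
        omega
    omega)
  set bad : (((Finset (Fin n) × Fin n) × (Finset (Fin n) × Fin n)) × ((EE n →ₗ[ℝ] (Fin (2*d) → ℝ)) × (EE n →ₗ[ℝ] (Fin (2*d) → ℝ)))) → Set ℝ :=
    fun i => {t | ∃ b z : EE n, (∀ j, j ∉ i.1.1.1 → b j = 0) ∧ ∑ j, b j = 1 ∧ (∀ j, j ∉ i.1.2.1 → z j = 0) ∧ ∑ j, z j = 1 ∧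
      i.2.1 b + t • w = i.2.2 z} with hbad
  have hsub : ∀ i ∈ I', (bad i).Subsingleton := by
    intro i hi t ⟨b, z, hb, hb1, hz, hz1, e⟩ t' ⟨b', z', hb', hb1', hz', hz1', e'⟩
    by_contra hne
    apply hw i hi
    simp only [hI', hI, Finset.mem_filter, Finset.mem_product] at hi
    have m1 := mem_Dsp hi.2.1 (b - b') (fun j hj => by simp [hb j hj, hb' j hj]) (by simp [hb1, hb1'])
    have m2 := mem_Dsp hi.2.2 (z - z') (fun j hj => by simp [hz j hj, hz' j hj]) (by simp [hz1, hz1'])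
    have n1 : i.2.1 (b - b') ∈ Submodule.span ℝ (gens i : Set (Fin (2*d) → ℝ)) := by
      have := Submodule.mem_map_of_mem (f := i.2.1) m1
      rw [Submodule.map_span] at this
      refine Submodule.span_mono ?_ this
      rw [hgens]; push_cast; exact Set.subset_union_left
    have n2 : i.2.2 (z - z') ∈ Submodule.span ℝ (gens i : Set (Fin (2*d) → ℝ)) := by
      have := Submodule.mem_map_of_mem (f := i.2.2) m2
      rw [Submodule.map_span] at this
      refine Submodule.span_mono ?_ this
      rw [hgens]; push_cast; exact Set.subset_union_right
    have h3 : w = (t - t')⁻¹ • (i.2.2 (z - z') - i.2.1 (b - b')) := by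
      have hne' : t - t' ≠ 0 := sub_ne_zero.2 hne
      rw [eq_inv_smul_iff₀ hne', map_sub, map_sub, ← e, ← e', sub_smul]
      abel
    rw [h3]
    exact Submodule.smul_mem _ _ (Submodule.sub_mem _ n2 n1)
  have hfin : (⋃ i ∈ I', bad i).Finite := I'.finite_toSet.biUnion fun i hi => (hsub i hi).finite
  have hcl : IsClosed ((⋃ i ∈ I', bad i) \ {0}) := (hfin.subset Set.sdiff_subset).isClosed
  obtain ⟨ε, hε, hball⟩ := Metric.isOpen_iff.1 hcl.isOpen_compl 0 (by simp)
  refine ⟨w, ε/2, by positivity, ?_⟩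
  intro G hG hGd F hF A hA B hB b z hb hb1 hz hz1 t ht htε e
  have hn1 : ∀ (H : Finset (Fin n)) (c : EE n), (∀ i, i ∉ H → c i = 0) → ∑ i, c i = 1 → ∃ g, g ∈ H := by
    intro H c h1 h2
    by_contra hcon
    push Not at hcon
    rw [Finset.sum_eq_zero (fun i _ => h1 i (hcon i))] at h2
    norm_num at h2
  obtain ⟨g0, hg0⟩ := hn1 G b hb hb1
  obtain ⟨f0, hf0⟩ := hn1 F z hz hz1
  have hmem : (((G, g0), (F, f0)), (A, B)) ∈ I' := by
    simp only [hI', hI, Finset.mem_filter, Finset.mem_product, Finset.mem_univ, and_true]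
    exact ⟨⟨⟨⟨hG, hGd⟩, hF⟩, hA, hB⟩, hg0, hf0⟩
  refine hball (show t ∈ Metric.ball 0 ε from ?_) ⟨?_, ?_⟩
  · rw [Metric.mem_ball, Real.dist_eq, sub_zero, abs_of_pos ht]; linarith
  · exact Set.mem_biUnion (Finset.mem_coe.2 hmem) ⟨b, z, hb, hb1, hz, hz1, e⟩
  · exact ht.ne'

end Emb

namespace Emb
open scoped Classical

lemma expand {n d : ℕ} (hd : 1 ≤ d) (K : Finset (Finset (Fin n))) (hK : ∀ F ∈ K, F.card ≤ d + 1)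
    (hdown : ∀ F ∈ K, ∀ G, G ⊆ F → G ∈ K) (σ : Finset (Fin n)) (v : Fin n) (hv : v ∉ σ) (hσ : σ.card = d)
    (hτK : insert v σ ∈ K) (hfree : ∀ ρ ∈ K, σ ⊆ ρ → ρ = σ ∨ ρ = insert v σ)
    (h : EmbPL n d (K \ {σ, insert v σ})) : EmbPL n d K := by
  set K' := K \ {σ, insert v σ} with hK'
  obtain ⟨f, fc, finj, 𝒜, hA⟩ := h
  have hne : σ.Nonempty := by rw [← Finset.card_pos]; omega
  obtain ⟨w, ε, hε, hpush⟩ := push_off hd K hK 𝒜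
  set m : EE n → ℝ := fun y => σ.inf' hne y with hm
  set q : EE n := fun i => if i ∈ σ then 1 else if i = v then -(d:ℝ) else 0 with hq
  have hqs : ∑ i, q i = 0 := by
    have : q = fun i => (if i ∈ σ then (1:ℝ) else 0) + (if i = v then -(d:ℝ) else 0) := by
      funext i
      simp only [hq]
      by_cases h1 : i ∈ σ
      · have : i ≠ v := fun h => hv (h ▸ h1)
        simp [h1, this]
      · simp [h1]
    rw [this, Finset.sum_add_distrib]
    simp [hσ]
  set π : EE n → EE n := fun y => y - m y • q with hπ
  have mc : Continuous m := by
    exact Continuous.finset_inf'_apply hne (fun i _ => continuous_apply i)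
  have πc : Continuous π := by
    simp only [hπ]; fun_prop
  have m_mem : ∀ y, ∃ u ∈ σ, m y = y u := fun y => by
    obtain ⟨u, hu, h⟩ := Finset.exists_mem_eq_inf' hne y
    exact ⟨u, hu, h⟩
  have m_le : ∀ y, ∀ u ∈ σ, m y ≤ y u := fun y u hu => Finset.inf'_le _ hu
  have m0 : ∀ y ∈ geomReal n K, 0 ≤ m y := by
    intro y hy
    obtain ⟨F, -, h1, -⟩ := (mem_geomReal K y).1 hy
    obtain ⟨u, -, h⟩ := m_mem y
    rw [h]; exact h1 u
  have m1 : ∀ y ∈ geomReal n K, m y ≤ 1 := by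
    intro y hy
    obtain ⟨F, -, h1, -, h2⟩ := (mem_geomReal K y).1 hy
    obtain ⟨u, -, h⟩ := m_mem y
    rw [h, ← h2]; exact Finset.single_le_sum (fun i _ => h1 i) (Finset.mem_univ u)
  have key : ∀ y ∈ geomReal n K, ∃ G ∈ K', (0 < m y → G.card ≤ d) ∧ (∀ i, 0 ≤ π y i) ∧ (∀ i, i ∉ G → π y i = 0) ∧ ∑ i, π y i = 1 := by
    intro y hy
    obtain ⟨F, hF, h1, h2, h3⟩ := (mem_geomReal K y).1 hy
    have hs : ∑ i, π y i = 1 := by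
      simp only [hπ, Pi.sub_apply, Pi.smul_apply, smul_eq_mul, Finset.sum_sub_distrib, ← Finset.mul_sum, hqs, h3]
      ring
    by_cases hσF : σ ⊆ F
    · obtain ⟨u, hu, hmu⟩ := m_mem y
      have huv : u ≠ v := fun h => hv (h ▸ hu)
      refine ⟨(insert v σ).erase u, ?_, fun _ => ?_, ?_, ?_, hs⟩
      · simp only [hK', Finset.mem_sdiff, Finset.mem_insert, Finset.mem_singleton]
        refine ⟨hdown _ hτK _ (Finset.erase_subset _ _), ?_⟩
        rintro (h | h)
        · have : v ∈ (insert v σ).erase u := Finset.mem_erase.2 ⟨huv.symm, Finset.mem_insert_self _ _⟩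
          rw [h] at this; exact hv this
        · have : u ∉ (insert v σ).erase u := Finset.notMem_erase _ _
          rw [h] at this; exact this (Finset.mem_insert_of_mem hu)
      · rw [Finset.card_erase_of_mem (Finset.mem_insert_of_mem hu), Finset.card_insert_of_notMem hv, hσ]; omega
      · intro i
        simp only [hπ, hq, Pi.sub_apply, Pi.smul_apply, smul_eq_mul]
        split_ifs with ha hb
        · have := m_le y i ha; linarith
        · have := h1 i; have := m0 y hy
          have : 0 ≤ m y * d := by positivity
          linarith
        · have := h1 i; linarith
      · intro i hi
        simp only [hπ, hq, Pi.sub_apply, Pi.smul_apply, smul_eq_mul]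
        by_cases hiu : i = u
        · subst hiu; rw [if_pos hu, hmu]; ring
        · have hi' : i ∉ insert v σ := fun h => hi (Finset.mem_erase.2 ⟨hiu, h⟩)
          have hiF : i ∉ F := by
            rcases hfree F hF hσF with h | h
            · rw [h]; exact fun h => hi' (Finset.mem_insert_of_mem h)
            · rw [h]; exact hi'
          rw [Finset.mem_insert, not_or] at hi'
          rw [if_neg hi'.2, if_neg hi'.1, h2 i hiF]; ring
    · have hm0 : m y = 0 := by
        obtain ⟨u, hu, huF⟩ := Finset.not_subset.1 hσF
        exact le_antisymm ((m_le y u hu).trans (h2 u huF).le) (m0 y hy)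
      have hπy : π y = y := by simp [hπ, hm0]
      rw [hπy]
      refine ⟨F, ?_, fun h => absurd h (by rw [hm0]; exact lt_irrefl _), h1, h2, h3⟩
      simp only [hK', Finset.mem_sdiff, Finset.mem_insert, Finset.mem_singleton]
      refine ⟨hF, ?_⟩
      rintro (h | h)
      · exact hσF h.ge
      · exact hσF (h ▸ Finset.subset_insert _ _)
  have πmaps : ∀ y ∈ geomReal n K, π y ∈ geomReal n K' := by
    intro y hy
    obtain ⟨G, hG, -, h⟩ := key y hy
    exact (mem_geomReal K' _).2 ⟨G, hG, h⟩
  have push2 : ∀ y ∈ geomReal n K, 0 < m y → ∀ z ∈ geomReal n K', ∀ t, 0 < t → t ≤ ε → f (π y) + t • w ≠ f z := by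
    intro y hy hmy z hz t t0 t1
    obtain ⟨G, hG, hGd, -, h1, h2⟩ := key y hy
    obtain ⟨F, hF, -, h3, h4⟩ := (mem_geomReal K' z).1 hz
    obtain ⟨A, hA1, hA2⟩ := hA _ (πmaps y hy)
    obtain ⟨B, hB1, hB2⟩ := hA _ hz
    rw [hA2, hB2]
    exact hpush G (Finset.mem_sdiff.1 hG).1 (hGd hmy) F (Finset.mem_sdiff.1 hF).1 A hA1 B hB1 _ _ h1 h2 h3 h4 t t0 t1
  refine ⟨fun y => f (π y) + (ε * m y) • w, ?_, ?_, ?_⟩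
  · apply ContinuousOn.add
    · exact fc.comp πc.continuousOn πmaps
    · exact (by fun_prop : Continuous fun y => (ε * m y) • w).continuousOn
  · have half : ∀ y ∈ geomReal n K, ∀ y' ∈ geomReal n K, f (π y) + (ε * m y) • w = f (π y') + (ε * m y') • w → ¬ m y' < m y := by
      intro y hy y' hy' e hlt
      have := m0 y' hy'
      refine push2 y hy (by linarith) (π y') (πmaps y' hy') (ε * (m y - m y')) (mul_pos hε (by linarith)) ?_ ?_
      · have := m1 y hy; nlinarith
      · rw [mul_sub, sub_smul, add_sub, e, add_sub_cancel_right]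
    intro y hy y' hy' e
    have hmm : m y = m y' := le_antisymm (not_lt.1 (half y hy y' hy' e)) (not_lt.1 (half y' hy' y hy e.symm))
    dsimp only at e
    rw [hmm, add_left_inj] at e
    have := finj (πmaps y hy) (πmaps y' hy') e
    simp only [hπ, hmm, sub_left_inj] at this
    exact this
  · refine ⟨(𝒜 ×ˢ σ).image (fun p => p.1 ∘ₗ (LinearMap.id - (LinearMap.proj p.2 : EE n →ₗ[ℝ] ℝ).smulRight q) +
      ε • (LinearMap.proj p.2 : EE n →ₗ[ℝ] ℝ).smulRight w), ?_⟩
    intro y hy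
    obtain ⟨A, hA1, hA2⟩ := hA _ (πmaps y hy)
    obtain ⟨u, hu, hmu⟩ := m_mem y
    refine ⟨_, Finset.mem_image_of_mem _ (Finset.mk_mem_product hA1 hu), ?_⟩
    simp only [LinearMap.add_apply, LinearMap.comp_apply, LinearMap.sub_apply, LinearMap.id_apply, LinearMap.smulRight_apply,
      LinearMap.smul_apply, LinearMap.proj_apply]
    rw [hA2, ← hmu, smul_smul]

/-- `W` is full in `R`: all its facets are there -/
def Full {n : ℕ} (d : ℕ) (R : Finset (Finset (Fin n))) (W : Finset (Fin n)) : Prop :=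
  W.card = d + 2 ∧ ∀ F, F ⊆ W → F.card = d + 1 → F ∈ R

def skR (n d : ℕ) (R : Finset (Finset (Fin n))) : Finset (Finset (Fin n)) :=
  Finset.univ.filter (fun s => s.card ≤ d ∨ (s.card = d + 1 ∧ s ∈ R))

lemma base_label {n d : ℕ} (hd : 1 ≤ d) (R : Finset (Finset (Fin n))) (ℓ : Fin n → Fin n) (b : Finset (Fin n) → ℕ)
    (h1 : ∀ F ∈ R, ∀ v ∈ F, (ℓ v : ℕ) = b F) (h2 : ∀ F ∈ R, ∀ G ∈ R, F.card = d + 1 → G.card = d + 1 → b F = b G → ¬ Disjoint F G) :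
    EmbPL n d (skR n d R) := by
  set t : Fin n → ℝ := fun v => (ℓ v : ℕ) * (n : ℝ) + (v : ℕ) with ht
  have tinj : Function.Injective t := by
    intro v w h
    simp only [ht] at h
    have h' : (ℓ v : ℕ) * n + v = (ℓ w : ℕ) * n + w := by exact_mod_cast h
    have hv := congrArg (· % n) h'
    simp only [Nat.mul_add_mod_self_right, Nat.mod_eq_of_lt v.2, Nat.mod_eq_of_lt w.2] at hv
    exact Fin.ext hv
  set A : EE n →ₗ[ℝ] (Fin (2*d) → ℝ) := ∑ v, (LinearMap.proj v : EE n →ₗ[ℝ] ℝ).smulRight (fun j : Fin (2*d) => t v ^ (j + 1 : ℕ)) with hA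
  have Aap : ∀ x j, A x j = ∑ v, x v * t v ^ (j + 1 : ℕ) := by
    intro x j
    simp [hA, LinearMap.sum_apply, Finset.sum_apply]
  refine ⟨A, (LinearMap.continuous_of_finiteDimensional A).continuousOn, ?_, {A}, fun x _ => ⟨A, by simp, rfl⟩⟩
  intro x hx y hy e
  obtain ⟨F, hF, x0, xF, x1⟩ := (mem_geomReal _ x).1 hx
  obtain ⟨G, hG, y0, yG, y1⟩ := (mem_geomReal _ y).1 hy
  simp only [skR, Finset.mem_filter, Finset.mem_univ, true_and] at hF hG
  have hFd : F.card ≤ d + 1 := by rcases hF with h | h <;> omega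
  have hGd : G.card ≤ d + 1 := by rcases hG with h | h <;> omega
  by_cases hc : (F ∪ G).card ≤ 2 * d + 1
  · have hz : ∀ v, v ∉ F ∪ G → (x - y) v = 0 := by
      intro v hv
      rw [Finset.mem_union, not_or] at hv
      rw [Pi.sub_apply, xF v hv.1, yG v hv.2, sub_zero]
    have hdep : ∑ v ∈ F ∪ G, (x - y) v • mom (2*d+1) (t v) = 0 := by
      rw [Finset.sum_subset (Finset.subset_univ _) (fun v _ hv => by rw [hz v hv, zero_smul])]
      ext j
      simp only [Finset.sum_apply, Pi.smul_apply, smul_eq_mul, mom, Pi.zero_apply, Pi.sub_apply, sub_mul,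
        Finset.sum_sub_distrib, sub_eq_zero]
      refine Fin.cases ?_ (fun j => ?_) j
      · simp [x1, y1]
      · have := congrFun e j
        rw [Aap, Aap] at this
        simpa using this
    funext v
    by_cases hv : v ∈ F ∪ G
    · have h3 := mom_poly hdep (P := ∏ w ∈ (F ∪ G).erase v, (Polynomial.X - Polynomial.C (t w))) (by
        rw [nd_prod, Finset.card_erase_of_mem hv]
        omega)
      simp only [Polynomial.eval_prod, Polynomial.eval_sub, Polynomial.eval_X, Polynomial.eval_C] at h3
      rw [Finset.sum_eq_single_of_mem v hv] at h3
      · rcases mul_eq_zero.1 h3 with h | h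
        · exact sub_eq_zero.1 h
        · obtain ⟨w, hw, h⟩ := Finset.prod_eq_zero_iff.1 h
          exact absurd (tinj (sub_eq_zero.1 h)).symm (Finset.ne_of_mem_erase hw)
      · intro u hu huv
        rw [Finset.prod_eq_zero (i := u) (Finset.mem_erase.2 ⟨huv, hu⟩) (sub_self _), mul_zero]
    · exact sub_eq_zero.1 (hz v hv)
  · exfalso
    have hcu := Finset.card_union_add_card_inter F G
    have hFc : F.card = d + 1 := by omega
    have hGc : G.card = d + 1 := by omega
    have hdis : Disjoint F G := by
      rw [Finset.disjoint_iff_inter_eq_empty, ← Finset.card_eq_zero]; omega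
    have hFR : F ∈ R := by rcases hF with h | h; omega; exact h.2
    have hGR : G ∈ R := by rcases hG with h | h; omega; exact h.2
    have hb : b F ≠ b G := fun h => h2 F hFR G hGR hFc hGc h hdis
    have e0 : ∑ v, x v * t v = ∑ v, y v * t v := by
      have := congrFun e ⟨0, by omega⟩
      rw [Aap, Aap] at this
      simpa using this
    -- bounds for the first coordinate
    have bound : ∀ (F : Finset (Fin n)) (x : EE n), F ∈ R → (∀ i, 0 ≤ x i) → (∀ i, i ∉ F → x i = 0) → ∑ i, x i = 1 →
        ((b F : ℕ) : ℝ) * n ≤ ∑ v, x v * t v ∧ ∑ v, x v * t v ≤ ((b F : ℕ) : ℝ) * n + (n - 1) := by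
      intro F x hFR x0 xF x1
      have hv : ∀ v, x v * (((b F : ℕ) : ℝ) * n) ≤ x v * t v ∧ x v * t v ≤ x v * (((b F : ℕ) : ℝ) * n + (n - 1)) := by
        intro v
        by_cases hvF : v ∈ F
        · have : t v = ((b F : ℕ) : ℝ) * n + (v : ℕ) := by simp only [ht, h1 F hFR v hvF]
          rw [this]
          have h4 : ((v : ℕ) : ℝ) + 1 ≤ n := by exact_mod_cast v.2
          have h5 : (0:ℝ) ≤ ((v : ℕ) : ℝ) := Nat.cast_nonneg _
          constructor <;> apply mul_le_mul_of_nonneg_left _ (x0 v) <;> linarith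
        · rw [xF v hvF]; simp
      constructor
      · calc ((b F : ℕ) : ℝ) * n = ∑ v, x v * (((b F : ℕ) : ℝ) * n) := by rw [← Finset.sum_mul, x1, one_mul]
          _ ≤ _ := Finset.sum_le_sum fun v _ => (hv v).1
      · calc _ ≤ ∑ v, x v * (((b F : ℕ) : ℝ) * n + (n - 1)) := Finset.sum_le_sum fun v _ => (hv v).2
          _ = _ := by rw [← Finset.sum_mul, x1, one_mul]
    have bF := bound F x hFR x0 xF x1
    have bG := bound G y hGR y0 yG y1
    rw [e0] at bF
    have hn0 : (0:ℝ) ≤ n := Nat.cast_nonneg _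
    rcases lt_or_gt_of_ne hb with h | h
    · have h4 : ((b F : ℕ) : ℝ) + 1 ≤ (b G : ℕ) := by exact_mod_cast h
      nlinarith [bF.1, bF.2, bG.1, bG.2]
    · have h4 : ((b G : ℕ) : ℝ) + 1 ≤ (b F : ℕ) := by exact_mod_cast h
      nlinarith [bF.1, bF.2, bG.1, bG.2]

lemma base_full {n d : ℕ} (hd : 1 ≤ d) (R : Finset (Finset (Fin n)))
    (hR : ∀ F ∈ R, F.card = d + 1 → ∃ W, Full d R W ∧ F ⊆ W)
    (hdis : ∀ W W', Full d R W → Full d R W' → ¬ Disjoint W W' → W = W') :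
    EmbPL n d (skR n d R) := by
  set R' := R.filter (fun F => F.card = d + 1) with hR'
  have hsub : skR n d R ⊆ skR n d R' := by
    intro s
    simp only [skR, hR', Finset.mem_filter, Finset.mem_univ, true_and]
    tauto
  refine EmbPL.mono hsub ?_
  have hWne : ∀ W, Full d R W → W.Nonempty := fun W h => by rw [← Finset.card_pos, h.1]; omega
  set ℓ : Fin n → Fin n := fun v => if h : ∃ W, Full d R W ∧ v ∈ W then h.choose.min' (hWne _ h.choose_spec.1) else v with hℓ
  have key : ∀ W (hW : Full d R W), ∀ v ∈ W, ℓ v = W.min' (hWne W hW) := by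
    intro W hW v hv
    have h : ∃ W, Full d R W ∧ v ∈ W := ⟨W, hW, hv⟩
    have e : h.choose = W := hdis _ _ h.choose_spec.1 hW (Finset.not_disjoint_iff.2 ⟨v, h.choose_spec.2, hv⟩)
    simp only [hℓ, dif_pos h]
    congr 1
  obtain ⟨b, hb⟩ : ∃ b : Finset (Fin n) → ℕ, ∀ W (hW : Full d R W) F, F ⊆ W → F.card = d + 1 → b F = (W.min' (hWne W hW) : ℕ) := by
    refine ⟨fun F => if h : F.Nonempty then (ℓ h.choose : ℕ) else 0, fun W hW F hF hc => ?_⟩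
    have hne : F.Nonempty := by rw [← Finset.card_pos]; omega
    simp only [dif_pos hne]
    rw [key W hW _ (hF hne.choose_spec)]
  refine base_label hd R' ℓ b ?_ ?_
  · intro F hF v hv
    rw [hR', Finset.mem_filter] at hF
    obtain ⟨W, hW, hFW⟩ := hR F hF.1 hF.2
    rw [hb W hW F hFW hF.2, key W hW v (hFW hv)]
  · intro F hF G hG _ _ e hdj
    rw [hR', Finset.mem_filter] at hF hG
    obtain ⟨W, hW, hFW⟩ := hR F hF.1 hF.2
    obtain ⟨W', hW', hGW⟩ := hR G hG.1 hG.2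
    rw [hb W hW F hFW hF.2, hb W' hW' G hGW hG.2] at e
    have e2 : W = W' := by
      refine hdis W W' hW hW' (Finset.not_disjoint_iff.2 ⟨_, Finset.min'_mem W (hWne W hW), ?_⟩)
      rw [Fin.ext e]; exact Finset.min'_mem _ _
    subst e2
    have h1 := Finset.card_le_card (Finset.union_subset hFW hGW)
    rw [Finset.card_union_of_disjoint hdj, hF.2, hG.2, hW.1] at h1
    omega

end Emb

namespace Emb
open scoped Classical

lemma two_of_deg {n : ℕ} {R : Finset (Finset (Fin n))} {v : Fin n} (h : (R.filter (fun F => v ∈ F)).card = 2)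
    {F G : Finset (Fin n)} (hF : F ∈ R) (hG : G ∈ R) (vF : v ∈ F) (vG : v ∈ G) (hne : F ≠ G) :
    ∀ H ∈ R, v ∈ H → H = F ∨ H = G := by
  have e : ({F, G} : Finset (Finset (Fin n))) = R.filter (fun F => v ∈ F) := by
    apply Finset.eq_of_subset_of_card_le
    · intro H hH
      rw [Finset.mem_insert, Finset.mem_singleton] at hH
      rcases hH with rfl | rfl <;> simp [*]
    · rw [h, Finset.card_pair hne]
  intro H hH vH
  have : H ∈ ({F, G} : Finset (Finset (Fin n))) := by rw [e]; simp [hH, vH]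
  simpa using this

lemma other_of_deg {n : ℕ} {R : Finset (Finset (Fin n))} {v : Fin n} (h : (R.filter (fun F => v ∈ F)).card = 2)
    {F : Finset (Fin n)} (hF : F ∈ R) (vF : v ∈ F) : ∃ G ∈ R, v ∈ G ∧ G ≠ F := by
  obtain ⟨G, hG, hne⟩ := Finset.exists_mem_ne (by omega : 1 < (R.filter (fun F => v ∈ F)).card) F
  rw [Finset.mem_filter] at hG
  exact ⟨G, hG.1, hG.2, hne⟩

lemma pair_of_card {n : ℕ} {F : Finset (Fin n)} (h : F.card = 2) {v : Fin n} (hv : v ∈ F) : ∃ w, w ≠ v ∧ F = {v, w} := by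
  obtain ⟨w, hw⟩ := Finset.card_eq_one.1 (by rw [Finset.card_erase_of_mem hv, h] : (F.erase v).card = 1)
  refine ⟨w, ?_, ?_⟩
  · have : w ∈ F.erase v := by rw [hw]; simp
    exact Finset.ne_of_mem_erase this
  · rw [← hw, Finset.insert_erase hv]

lemma shorten {n : ℕ} (R R' : Finset (Finset (Fin n))) (u x y : Fin n) (hux : u ≠ x) (huy : u ≠ y) (hxy : x ≠ y)
    (hu : ∀ F ∈ R, u ∈ F → F ⊆ {u, x, y}) (hnxy : ({x, y} : Finset (Fin n)) ∉ R)
    (hR' : ∀ F ∈ R, u ∉ F → F ∈ R') (hxyR' : ({x, y} : Finset (Fin n)) ∈ R')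
    (h : EmbPL n 1 (skR n 1 R')) : EmbPL n 1 (skR n 1 R) := by
  obtain ⟨f, fc, fi, P, hP⟩ := h
  set w : EE n := (1/2 : ℝ) • (Pi.single x 1 + Pi.single y 1) - Pi.single u 1 with hw
  set π : EE n →ₗ[ℝ] EE n := LinearMap.id + (LinearMap.proj u : EE n →ₗ[ℝ] ℝ).smulRight w with hπ
  have πa : ∀ z v, π z v = z v + z u * w v := by intro z v; simp [hπ]
  have wu : w u = -1 := by simp [hw, hux, huy]
  have wx : w x = 1/2 := by simp [hw, hux.symm, hxy]
  have wy : w y = 1/2 := by simp [hw, huy.symm, hxy.symm]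
  have wo : ∀ v, v ≠ u → v ≠ x → v ≠ y → w v = 0 := by intro v h1 h2 h3; simp [hw, h1, h2, h3]
  have wsum : ∑ v, w v = 0 := by
    simp only [hw, Pi.sub_apply, Pi.smul_apply, Pi.add_apply, smul_eq_mul, Finset.sum_sub_distrib, ← Finset.mul_sum,
      Finset.sum_add_distrib, Finset.sum_pi_single', Finset.mem_univ, if_true]
    norm_num
  have maps : Set.MapsTo π (geomReal n (skR n 1 R)) (geomReal n (skR n 1 R')) := by
    intro z hz
    obtain ⟨F, hF, z0, zF, z1⟩ := (mem_geomReal _ z).1 hz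
    rw [mem_geomReal]
    simp only [skR, Finset.mem_filter, Finset.mem_univ, true_and] at hF ⊢
    by_cases huF : u ∈ F
    · have hFs : F ⊆ {u, x, y} := by
        rcases hF with h | h
        · intro a ha
          have := Finset.card_le_one.1 h a ha u huF
          simp [this]
        · exact hu F h.2 huF
      refine ⟨{x, y}, Or.inr ⟨by rw [Finset.card_pair hxy], hxyR'⟩, fun i => ?_, fun i hi => ?_, ?_⟩
      · rw [πa]
        by_cases h1 : i = u
        · rw [h1, wu]; linarith
        · have : 0 ≤ w i := by
            by_cases h2 : i = x
            · rw [h2, wx]; norm_num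
            by_cases h3 : i = y
            · rw [h3, wy]; norm_num
            rw [wo i h1 h2 h3]
          exact add_nonneg (z0 i) (mul_nonneg (z0 u) this)
      · simp only [Finset.mem_insert, Finset.mem_singleton, not_or] at hi
        rw [πa]
        by_cases h1 : i = u
        · rw [h1, wu]; linarith
        · rw [wo i h1 hi.1 hi.2, mul_zero, add_zero]
          apply zF
          intro h
          have := hFs h
          simp [h1, hi.1, hi.2] at this
      · simp only [πa, Finset.sum_add_distrib, ← Finset.mul_sum, wsum, z1]
        simp
    · have : π z = z := by
        funext v; rw [πa, zF u huF]; simp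
      rw [this]
      refine ⟨F, ?_, z0, zF, z1⟩
      rcases hF with h | h
      · exact Or.inl h
      · exact Or.inr ⟨h.1, hR' F h.2 huF⟩
  have aux : ∀ z ∈ geomReal n (skR n 1 R), ∀ z' ∈ geomReal n (skR n 1 R), π z = π z' → z u ≤ z' u := by
    intro z hz z' hz' e
    by_contra hlt
    push Not at hlt
    obtain ⟨F, hF, z0, zF, z1⟩ := (mem_geomReal _ z).1 hz
    obtain ⟨G, hG, y0, yG, y1⟩ := (mem_geomReal _ z').1 hz'
    have ex := congrFun e x
    have ey := congrFun e y
    rw [πa, πa, wx] at ex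
    rw [πa, πa, wy] at ey
    have px : x ∈ G := by by_contra h; have := yG x h; have := z0 x; linarith
    have py : y ∈ G := by by_contra h; have := yG y h; have := z0 y; linarith
    have hsub : ({x, y} : Finset (Fin n)) ⊆ G := by
      intro a ha; simp only [Finset.mem_insert, Finset.mem_singleton] at ha
      rcases ha with rfl | rfl <;> assumption
    have hc := Finset.card_le_card hsub
    rw [Finset.card_pair hxy] at hc
    simp only [skR, Finset.mem_filter, Finset.mem_univ, true_and] at hG
    rcases hG with h | h
    · omega
    · have : ({x, y} : Finset (Fin n)) = G := Finset.eq_of_subset_of_card_le hsub (by rw [Finset.card_pair hxy]; omega)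
      exact hnxy (this ▸ h.2)
  refine ⟨f ∘ π, fc.comp (LinearMap.continuous_of_finiteDimensional π).continuousOn maps, ?_, P.image (fun A => A.comp π), ?_⟩
  · refine fi.comp ?_ maps
    intro z hz z' hz' e
    have eu := le_antisymm (aux z hz z' hz' e) (aux z' hz' z hz e.symm)
    funext v
    have := congrFun e v
    rw [πa, πa, eu] at this
    linarith
  · intro z hz
    obtain ⟨A, hA, e⟩ := hP (π z) (maps hz)
    exact ⟨A.comp π, Finset.mem_image_of_mem _ hA, e⟩

lemma cycle_emb {n : ℕ} : ∀ (m : ℕ) (R : Finset (Finset (Fin n))), R.card = m → (∀ F ∈ R, F.card = 2) →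
    (∀ F ∈ R, ∀ v ∈ F, (R.filter (fun F => v ∈ F)).card = 2) → EmbPL n 1 (skR n 1 R) := by
  intro m
  induction m with
  | zero =>
    intro R hR _ _
    rw [Finset.card_eq_zero] at hR
    subst hR
    refine base_full le_rfl _ (by simp) ?_
    intro W W' hW
    obtain ⟨F, hF, hc⟩ := Finset.exists_subset_card_eq (show 2 ≤ W.card by rw [hW.1]; omega)
    exact absurd (hW.2 F hF hc) (by simp)
  | succ m ih =>
    intro R hR h2 hdeg
    by_cases hall : ∀ F ∈ R, F.card = 1 + 1 → ∃ W, Full 1 R W ∧ F ⊆ W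
    · refine base_full le_rfl R hall ?_
      have key : ∀ W W', Full 1 R W → Full 1 R W' → ¬ Disjoint W W' → W ⊆ W' := by
        intro W W' hW hW' hnd
        obtain ⟨v, hv, hv'⟩ := Finset.not_disjoint_iff.1 hnd
        have hc : (W'.erase v).card = 2 := by rw [Finset.card_erase_of_mem hv', hW'.1]
        obtain ⟨a, b, hab, eab⟩ := Finset.card_eq_two.1 hc
        have ha : a ∈ W'.erase v := by rw [eab]; simp
        have hb : b ∈ W'.erase v := by rw [eab]; simp
        have ha' := Finset.mem_erase.1 ha
        have hb' := Finset.mem_erase.1 hb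
        have hp : ∀ W, Full 1 R W → v ∈ W → ∀ c, c ∈ W → c ≠ v → ({v, c} : Finset (Fin n)) ∈ R := by
          intro W hW hv c hc hcv
          refine hW.2 _ ?_ (Finset.card_pair hcv.symm)
          intro z hz
          simp only [Finset.mem_insert, Finset.mem_singleton] at hz
          rcases hz with rfl | rfl <;> assumption
        have hA := hp W' hW' hv' a ha'.2 ha'.1
        have hB := hp W' hW' hv' b hb'.2 hb'.1
        have hne : ({v, a} : Finset (Fin n)) ≠ {v, b} := by
          intro h
          have : a ∈ ({v, b} : Finset (Fin n)) := by rw [← h]; simp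
          simp [ha'.1, hab] at this
        have htwo := two_of_deg (hdeg _ hA v (by simp)) hA hB (by simp) (by simp) hne
        intro c hc
        by_cases hcv : c = v
        · rw [hcv]; exact hv'
        have hC := hp W hW hv c hc hcv
        have hcm : c ∈ ({v, c} : Finset (Fin n)) := by simp
        rcases htwo _ hC (by simp) with h | h <;> rw [h] at hcm <;> simp [hcv] at hcm <;> rw [hcm]
        · exact ha'.2
        · exact hb'.2
      intro W W' hW hW' hnd
      exact Finset.Subset.antisymm (key W W' hW hW' hnd) (key W' W hW' hW (fun h => hnd h.symm))
    · push Not at hall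
      obtain ⟨F, hF, hFc, hFW⟩ := hall
      obtain ⟨u, x, hux, rfl⟩ := Finset.card_eq_two.1 hFc
      obtain ⟨G, hG, uG, hne⟩ := other_of_deg (hdeg _ hF u (by simp)) hF (by simp)
      obtain ⟨y, hyu, rfl⟩ := pair_of_card (h2 G hG) uG
      have hxy : x ≠ y := fun h => hne (by rw [h])
      have htwo := two_of_deg (hdeg _ hF u (by simp)) hF hG (by simp) (by simp) hne.symm
      have hnxy : ({x, y} : Finset (Fin n)) ∉ R := by
        intro hxyR
        refine hFW {u, x, y} ⟨?_, ?_⟩ ?_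
        · rw [Finset.card_eq_three]; exact ⟨u, x, y, hux, hyu.symm, hxy, rfl⟩
        · intro F hF3 hFc
          have : F = {u, x} ∨ F = {u, y} ∨ F = {x, y} := by
            obtain ⟨a, b, hab, rfl⟩ := Finset.card_eq_two.1 hFc
            have ha : a ∈ ({u, x, y} : Finset (Fin n)) := hF3 (by simp)
            have hb : b ∈ ({u, x, y} : Finset (Fin n)) := hF3 (by simp)
            simp only [Finset.mem_insert, Finset.mem_singleton] at ha hb
            rcases ha with rfl | rfl | rfl <;> rcases hb with rfl | rfl | rfl <;> simp_all [Finset.pair_comm]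
          rcases this with rfl | rfl | rfl <;> assumption
        · intro z; simp; tauto
      set R' := insert {x, y} ((R.erase {u, x}).erase {u, y}) with hR'
      have uR : ∀ F ∈ R, F ≠ {u, x} → F ≠ {u, y} → u ∉ F := by
        intro F hF h1 h2 huF
        rcases htwo F hF huF with h | h <;> contradiction
      refine shorten R R' u x y hux hyu.symm hxy ?_ hnxy ?_ (by simp [hR']) (ih R' ?_ ?_ ?_)
      · intro F hF huF
        rcases htwo F hF huF with h | h <;> rw [h] <;> intro z <;> simp <;> tauto
      · intro F hF huF
        refine Finset.mem_insert_of_mem (Finset.mem_erase.2 ⟨?_, Finset.mem_erase.2 ⟨?_, hF⟩⟩)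
        · rintro rfl; simp at huF
        · rintro rfl; simp at huF
      · rw [hR', Finset.card_insert_of_notMem (by simp [hnxy]), Finset.card_erase_of_mem (Finset.mem_erase.2 ⟨hne, hG⟩),
          Finset.card_erase_of_mem hF, hR]
        have : 1 < R.card := Finset.one_lt_card.2 ⟨_, hF, _, hG, hne.symm⟩
        omega
      · intro F hF
        rw [hR', Finset.mem_insert, Finset.mem_erase, Finset.mem_erase] at hF
        rcases hF with rfl | h
        · exact Finset.card_pair hxy
        · exact h2 F h.2.2
      · have degv : ∀ v, v ≠ u → (∃ F ∈ R, v ∈ F) → (R'.filter (fun F => v ∈ F)).card = 2 := by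
          rintro v hvu ⟨F, hFR, hvF⟩
          have hd := hdeg F hFR v hvF
          by_cases hvx : v = x
          · have : R'.filter (fun F => v ∈ F) = insert {x, y} ((R.filter (fun F => v ∈ F)).erase {u, x}) := by
              ext H
              simp only [hR', Finset.mem_filter, Finset.mem_insert, Finset.mem_erase]
              constructor
              · rintro ⟨h | h, h'⟩ <;> tauto
              · rintro (h | h)
                · subst h; simp [hvx]
                · refine ⟨Or.inr ⟨?_, h.1, h.2.1⟩, h.2.2⟩
                  rintro rfl
                  simp [hvx, hux.symm, hxy] at h
            rw [this, Finset.card_insert_of_notMem (by simp [hnxy]), Finset.card_erase_of_mem (by simp [hF, hvx]), hd]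
          by_cases hvy : v = y
          · have : R'.filter (fun F => v ∈ F) = insert {x, y} ((R.filter (fun F => v ∈ F)).erase {u, y}) := by
              ext H
              simp only [hR', Finset.mem_filter, Finset.mem_insert, Finset.mem_erase]
              constructor
              · rintro ⟨h | h, h'⟩ <;> tauto
              · rintro (h | h)
                · subst h; simp [hvy]
                · refine ⟨Or.inr ⟨h.1, ?_, h.2.1⟩, h.2.2⟩
                  rintro rfl
                  simp [hvy, hyu, hxy.symm] at h
            rw [this, Finset.card_insert_of_notMem (by simp [hnxy]), Finset.card_erase_of_mem (by simp [hG, hvy]), hd]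
          · rw [← hd]
            congr 1
            ext H
            simp only [hR', Finset.mem_filter, Finset.mem_insert, Finset.mem_erase]
            constructor
            · rintro ⟨h | h, h'⟩
              · subst h; simp [hvx, hvy] at h'
              · exact ⟨h.2.2, h'⟩
            · rintro ⟨h, h'⟩
              refine ⟨Or.inr ⟨?_, ?_, h⟩, h'⟩ <;> rintro rfl <;> simp [hvu, hvx, hvy] at h'
        intro F hFR' v hv
        rw [hR', Finset.mem_insert, Finset.mem_erase, Finset.mem_erase] at hFR'
        rcases hFR' with rfl | h
        · simp only [Finset.mem_insert, Finset.mem_singleton] at hv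
          rcases hv with rfl | rfl
          · exact degv _ hux.symm ⟨_, hF, by simp⟩
          · exact degv _ hyu ⟨_, hG, by simp⟩
        · refine degv v ?_ ⟨F, h.2.2, hv⟩
          rintro rfl
          exact uR F h.2.2 h.2.1 h.1 hv

end Emb

namespace Emb
open scoped Classical

def Core {n : ℕ} (k : ℕ) (R : Finset (Finset (Fin n))) : Prop :=
  ∀ F ∈ R, F.card = k ∧ ∀ v ∈ F, ∃ G ∈ R, F.erase v ⊆ G ∧ G ≠ F

lemma collapse {n d : ℕ} (hd : 1 ≤ d) (Y : Finset (Finset (Fin n)))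
    (hY : ∀ R ⊆ Y, Core (d+1) R → EmbPL n d (skR n d R)) :
    ∀ (m : ℕ) (K : Finset (Finset (Fin n))), K.card ≤ m → (∀ F ∈ K, F.card ≤ d + 1) →
      (∀ F ∈ K, ∀ G, G ⊆ F → G ∈ K) → (∀ F ∈ K, F.card = d + 1 → F ∈ Y) → EmbPL n d K := by
  intro m
  induction m with
  | zero =>
    intro K hK _ _ _
    have : K = ∅ := by rw [← Finset.card_eq_zero]; omega
    subst this
    refine EmbPL.mono (Finset.empty_subset _) (hY ∅ (Finset.empty_subset _) ?_)
    intro F hF; simp at hF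
  | succ m ih =>
    intro K hKm hK hdown hKY
    set T := K.filter (fun F => F.card = d + 1) with hT
    by_cases hc : Core (d+1) T
    · refine EmbPL.mono ?_ (hY T ?_ hc)
      · intro F hF
        have := hK F hF
        simp only [skR, hT, Finset.mem_filter, Finset.mem_univ, true_and]
        by_cases h : F.card = d + 1
        · exact Or.inr ⟨h, hF, h⟩
        · left; omega
      · intro F hF
        rw [hT, Finset.mem_filter] at hF
        exact hKY F hF.1 hF.2
    · unfold Core at hc
      push Not at hc
      obtain ⟨F, hF, hc⟩ := hc
      rw [hT, Finset.mem_filter] at hF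
      obtain ⟨v, hv, hfr⟩ := hc hF.2
      have hins : insert v (F.erase v) = F := Finset.insert_erase hv
      have hsc : (F.erase v).card = d := by rw [Finset.card_erase_of_mem hv, hF.2]; rfl
      have hfree : ∀ ρ ∈ K, F.erase v ⊆ ρ → ρ = F.erase v ∨ ρ = F := by
        intro ρ hρ hs
        by_cases h : ρ.card = d + 1
        · right
          exact hfr ρ (by rw [hT, Finset.mem_filter]; exact ⟨hρ, h⟩) hs
        · left
          have := hK ρ hρ
          exact (Finset.eq_of_subset_of_card_le hs (by omega)).symm
      refine expand hd K hK hdown (F.erase v) v (Finset.notMem_erase _ _) hsc (by rw [hins]; exact hF.1)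
        (by rw [hins]; exact hfree) ?_
      rw [hins]
      refine ih _ ?_ ?_ ?_ ?_
      · have : (K \ {F.erase v, F}).card < K.card := by
          refine Finset.card_lt_card (Finset.ssubset_iff_of_subset Finset.sdiff_subset |>.2 ⟨F, hF.1, by simp⟩)
        omega
      · intro G hG
        exact hK G (Finset.mem_sdiff.1 hG).1
      · intro G hG H hHG
        rw [Finset.mem_sdiff] at hG ⊢
        refine ⟨hdown G hG.1 H hHG, fun h => hG.2 ?_⟩
        simp only [Finset.mem_insert, Finset.mem_singleton] at h ⊢
        refine hfree G hG.1 ?_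
        rcases h with rfl | rfl
        · exact hHG
        · exact (Finset.erase_subset _ _).trans hHG
      · intro G hG
        exact hKY G (Finset.mem_sdiff.1 hG).1

lemma emb_of_cores {n d : ℕ} (hd : 1 ≤ d) (ω : FaceIdx n d → Bool)
    (h : ∀ R : Finset (Finset (Fin n)), Core (d+1) R → (∀ F ∈ R, ∃ h : F.card = d + 1, ω ⟨F, h⟩ = true) → EmbPL n d (skR n d R)) :
    EmbPL n d (Ycomplex n d ω) := by
  refine collapse hd (Finset.univ.filter (fun F => ∃ h : F.card = d + 1, ω ⟨F, h⟩ = true)) ?_ _ _ le_rfl ?_ ?_ ?_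
  · intro R hR hc
    exact h R hc (fun F hF => (Finset.mem_filter.1 (hR hF)).2)
  · intro F hF
    simp only [Ycomplex, Finset.mem_filter, Finset.mem_univ, true_and] at hF
    rcases hF with h | ⟨h, -⟩ <;> omega
  · intro F hF G hGF
    simp only [Ycomplex, Finset.mem_filter, Finset.mem_univ, true_and] at hF ⊢
    by_cases h : G = F
    · rw [h]; exact hF
    · have := Finset.card_lt_card (lt_of_le_of_ne hGF h)
      left
      rcases hF with h | ⟨h, -⟩ <;> omega
  · intro F hF hc
    simp only [Ycomplex, Finset.mem_filter, Finset.mem_univ, true_and] at hF ⊢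
    rcases hF with h | h
    · omega
    · exact h

lemma core_ge {n k : ℕ} (R : Finset (Finset (Fin n))) (hR : Core k R) (F : Finset (Fin n)) (hF : F ∈ R) :
    k + 1 ≤ R.card ∧ (1 ≤ k → R.card ≤ k + 1 → ∃ W, W.card = k + 1 ∧ (∀ S ⊆ W, S.card = k → S ∈ R) ∧ ∀ S ∈ R, S ⊆ W) := by
  have hFc := (hR F hF).1
  have ex : ∀ v : Fin n, ∃ G, v ∈ F → (G ∈ R ∧ F.erase v ⊆ G ∧ G ≠ F) := by
    intro v
    by_cases hv : v ∈ F
    · obtain ⟨G, h⟩ := (hR F hF).2 v hv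
      exact ⟨G, fun _ => h⟩
    · exact ⟨∅, fun h => absurd h hv⟩
  choose G hG using ex
  have ex2 : ∀ v : Fin n, ∃ w, v ∈ F → (w ∉ F ∧ G v = insert w (F.erase v)) := by
    intro v
    by_cases hv : v ∈ F
    · obtain ⟨h1, h2, h3⟩ := hG v hv
      have hc : (G v \ F.erase v).card = 1 := by
        rw [Finset.card_sdiff_of_subset h2, (hR _ h1).1, Finset.card_erase_of_mem hv, hFc]
        have : 0 < F.card := Finset.card_pos.2 ⟨v, hv⟩
        omega
      obtain ⟨w, hw⟩ := Finset.card_eq_one.1 hc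
      refine ⟨w, fun _ => ?_⟩
      have e : G v = insert w (F.erase v) := by
        rw [← Finset.sdiff_union_of_subset h2, hw]; rfl
      refine ⟨fun hwF => ?_, e⟩
      have hwn : w ∉ F.erase v := by
        have : w ∈ G v \ F.erase v := by rw [hw]; simp
        exact (Finset.mem_sdiff.1 this).2
      have : w = v := by
        by_contra hne
        exact hwn (Finset.mem_erase.2 ⟨hne, hwF⟩)
      rw [this, Finset.insert_erase hv] at e
      exact h3 e
    · exact ⟨v, fun h => absurd h hv⟩
  choose w hw using ex2
  have vG : ∀ v ∈ F, ∀ u ∈ F, (u ∈ G v ↔ u ≠ v) := by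
    intro v hv u hu
    rw [(hw v hv).2, Finset.mem_insert, Finset.mem_erase]
    constructor
    · rintro (h | h)
      · exact absurd (h ▸ hu) (hw v hv).1
      · exact h.1
    · exact fun h => Or.inr ⟨h, hu⟩
  have inj : Set.InjOn G F := by
    intro v hv u hu e
    by_contra hne
    have h1 := (vG v hv u hu).2 (Ne.symm hne)
    rw [e] at h1
    exact (vG u hu u hu).1 h1 rfl
  set I := insert F (F.image G) with hI
  have hIR : I ⊆ R := by
    intro S hS
    rw [hI, Finset.mem_insert, Finset.mem_image] at hS
    rcases hS with rfl | ⟨v, hv, rfl⟩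
    · exact hF
    · exact (hG v hv).1
  have hIc : I.card = k + 1 := by
    rw [hI, Finset.card_insert_of_notMem, Finset.card_image_of_injOn inj, hFc]
    rw [Finset.mem_image]
    rintro ⟨v, hv, e⟩
    exact (hG v hv).2.2 e
  refine ⟨hIc ▸ Finset.card_le_card hIR, fun hk hle => ?_⟩
  have hIe : I = R := Finset.eq_of_subset_of_card_le hIR (by omega)
  have weq : ∀ v ∈ F, ∀ v' ∈ F, v ≠ v' → w v' = w v := by
    intro v hv v' hv' hne
    obtain ⟨H, hH, hs, hHne⟩ := (hR _ (hG v hv).1).2 v' ((vG v hv v' hv').2 hne.symm)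
    have hwm : w v ∈ H := by
      apply hs
      rw [Finset.mem_erase, (hw v hv).2]
      exact ⟨fun h => (hw v hv).1 (h ▸ hv'), Finset.mem_insert_self _ _⟩
    rw [← hIe, hI, Finset.mem_insert, Finset.mem_image] at hH
    rcases hH with rfl | ⟨x, hx, rfl⟩
    · exact absurd hwm (hw v hv).1
    · have hxv : x ≠ v := fun h => hHne (by rw [h])
      have hxv' : x = v' := by
        by_contra h
        have : x ∈ G x := by
          apply hs
          rw [Finset.mem_erase]
          exact ⟨h, (vG v hv x hx).2 hxv⟩
        exact (vG x hx x hx).1 this rfl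
      subst hxv'
      rw [(hw x hx).2, Finset.mem_insert] at hwm
      rcases hwm with h | h
      · exact h.symm
      · exact absurd (Finset.mem_of_mem_erase h) (hw v hv).1
  obtain ⟨v0, hv0⟩ : F.Nonempty := by rw [← Finset.card_pos]; omega
  have wall : ∀ v ∈ F, w v = w v0 := by
    intro v hv
    by_cases h : v = v0
    · rw [h]
    · exact weq v0 hv0 v hv (Ne.symm h)
  have hw0 := (hw v0 hv0).1
  refine ⟨insert (w v0) F, by rw [Finset.card_insert_of_notMem hw0, hFc], ?_, ?_⟩
  · intro S hS hSc
    rw [← hIe, hI, Finset.mem_insert, Finset.mem_image]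
    by_cases hwS : w v0 ∈ S
    · right
      have : (insert (w v0) F \ S).card = 1 := by
        rw [Finset.card_sdiff_of_subset hS, Finset.card_insert_of_notMem hw0]; omega
      obtain ⟨a, ha⟩ := Finset.card_eq_one.1 this
      have ha' : a ∈ insert (w v0) F \ S := by rw [ha]; simp
      rw [Finset.mem_sdiff, Finset.mem_insert] at ha'
      have haF : a ∈ F := by
        rcases ha'.1 with h | h
        · exact absurd (h ▸ hwS) ha'.2
        · exact h
      refine ⟨a, haF, ?_⟩
      have hsub : S ⊆ G a := by
        rw [(hw a haF).2, wall a haF]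
        intro z hz
        have := hS hz
        rw [Finset.mem_insert] at this ⊢
        rcases this with h | h
        · exact Or.inl h
        · exact Or.inr (Finset.mem_erase.2 ⟨fun h' => ha'.2 (h' ▸ hz), h⟩)
      exact (Finset.eq_of_subset_of_card_le hsub (by rw [hSc, (hR _ (hG a haF).1).1])).symm
    · left
      refine Finset.eq_of_subset_of_card_le ?_ (by omega)
      intro z hz
      have := hS hz
      rw [Finset.mem_insert] at this
      rcases this with h | h
      · exact absurd (h ▸ hz) hwS
      · exact h
  · intro S hS
    rw [← hIe, hI, Finset.mem_insert, Finset.mem_image] at hS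
    rcases hS with rfl | ⟨v, hv, rfl⟩
    · exact Finset.subset_insert _ _
    · rw [(hw v hv).2, wall v hv]
      exact Finset.insert_subset_insert _ (Finset.erase_subset _ _)

end Emb

namespace Emb
open scoped Classical

noncomputable def lnk {n : ℕ} (R : Finset (Finset (Fin n))) (v : Fin n) : Finset (Finset (Fin n)) :=
  (R.filter (fun F => v ∈ F)).image (fun F => F.erase v)

lemma mem_lnk {n : ℕ} (R : Finset (Finset (Fin n))) (v : Fin n) (S : Finset (Fin n)) :
    S ∈ lnk R v ↔ v ∉ S ∧ insert v S ∈ R := by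
  simp only [lnk, Finset.mem_image, Finset.mem_filter]
  constructor
  · rintro ⟨F, ⟨hF, hv⟩, rfl⟩
    exact ⟨Finset.notMem_erase _ _, by rwa [Finset.insert_erase hv]⟩
  · rintro ⟨h1, h2⟩
    exact ⟨_, ⟨h2, Finset.mem_insert_self _ _⟩, Finset.erase_insert h1⟩

lemma card_lnk {n : ℕ} (R : Finset (Finset (Fin n))) (v : Fin n) :
    (lnk R v).card = (R.filter (fun F => v ∈ F)).card := by
  apply Finset.card_image_of_injOn
  intro F hF G hG e
  simp only [Finset.coe_filter, Set.mem_ofPred_eq] at hF hG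
  rw [← Finset.insert_erase hF.2, ← Finset.insert_erase hG.2]
  simp only at e
  rw [e]

lemma core_lnk {n k : ℕ} (R : Finset (Finset (Fin n))) (hR : Core (k+1) R) (v : Fin n) : Core k (lnk R v) := by
  intro S hS
  rw [mem_lnk] at hS
  have h1 := (hR _ hS.2).1
  rw [Finset.card_insert_of_notMem hS.1] at h1
  refine ⟨by omega, fun u hu => ?_⟩
  have huv : u ≠ v := fun h => hS.1 (h ▸ hu)
  obtain ⟨G, hG, hs, hne⟩ := (hR _ hS.2).2 u (Finset.mem_insert_of_mem hu)
  have hvG : v ∈ G := hs (Finset.mem_erase.2 ⟨huv.symm, Finset.mem_insert_self _ _⟩)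
  refine ⟨G.erase v, (mem_lnk _ _ _).2 ⟨Finset.notMem_erase _ _, by rwa [Finset.insert_erase hvG]⟩, ?_, ?_⟩
  · intro z hz
    rw [Finset.mem_erase] at hz ⊢
    exact ⟨fun h => hS.1 (h ▸ hz.2), hs (Finset.mem_erase.2 ⟨hz.1, Finset.mem_insert_of_mem hz.2⟩)⟩
  · intro h
    apply hne
    rw [← h, Finset.insert_erase hvG]

noncomputable def verts {n : ℕ} (L : Finset (Finset (Fin n))) : Finset (Fin n) := L.biUnion id

lemma mem_verts {n : ℕ} (L : Finset (Finset (Fin n))) (v : Fin n) : v ∈ verts L ↔ ∃ F ∈ L, v ∈ F := by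
  simp [verts]

lemma deg_eq {n d : ℕ} (L : Finset (Finset (Fin n))) (hL : Core (d+1) L) (hle : L.card ≤ (verts L).card) :
    ∀ v ∈ verts L, (L.filter (fun F => v ∈ F)).card = d + 1 := by
  have hge : ∀ v ∈ verts L, d + 1 ≤ (L.filter (fun F => v ∈ F)).card := by
    intro v hv
    obtain ⟨F, hF, hvF⟩ := (mem_verts _ _).1 hv
    rw [← card_lnk]
    exact (core_ge _ (core_lnk L hL v) (F.erase v) ((mem_lnk _ _ _).2 ⟨Finset.notMem_erase _ _, by rwa [Finset.insert_erase hvF]⟩)).1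
  have hsum : ∑ v ∈ verts L, (L.filter (fun F => v ∈ F)).card = (d+1) * L.card := by
    refine (Finset.sum_card_bipartiteAbove_eq_sum_card_bipartiteBelow (fun v F => v ∈ F) (s := verts L) (t := L)).trans ?_
    rw [Finset.sum_congr rfl (g := fun _ => d + 1), Finset.sum_const, smul_eq_mul, mul_comm]
    intro F hF
    rw [← (hL F hF).1]
    congr 1
    ext v
    simp only [Finset.bipartiteBelow, Finset.mem_filter, mem_verts]
    exact ⟨fun h => h.2, fun h => ⟨⟨F, hF, h⟩, h⟩⟩
  by_contra hcon
  push Not at hcon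
  obtain ⟨v, hv, hne⟩ := hcon
  have hlt : ∑ v ∈ verts L, (d+1) < ∑ v ∈ verts L, (L.filter (fun F => v ∈ F)).card :=
    Finset.sum_lt_sum hge ⟨v, hv, lt_of_le_of_ne (hge v hv) (Ne.symm hne)⟩
  rw [hsum, Finset.sum_const, smul_eq_mul, mul_comm] at hlt
  have := Nat.mul_le_mul_left (d+1) hle
  omega

lemma full_of_core {n d : ℕ} (hd : 2 ≤ d) (L : Finset (Finset (Fin n))) (hL : Core (d+1) L) (hle : L.card ≤ (verts L).card)
    (F : Finset (Fin n)) (hF : F ∈ L) : ∃ W, Full d L W ∧ F ⊆ W := by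
  have main : ∀ v ∈ verts L, ∃ W, v ∉ W ∧ W.card = d + 1 ∧ (∀ S ⊆ W, S.card = d → insert v S ∈ L) ∧ ∀ S ∈ lnk L v, S ⊆ W := by
    intro v hv
    obtain ⟨F, hF, hvF⟩ := (mem_verts _ _).1 hv
    obtain ⟨W, h1, h2, h3⟩ := (core_ge _ (core_lnk L hL v) (F.erase v)
      ((mem_lnk _ _ _).2 ⟨Finset.notMem_erase _ _, by rwa [Finset.insert_erase hvF]⟩)).2 (by omega)
      (by rw [card_lnk, deg_eq L hL hle v hv])
    refine ⟨W, fun hvW => ?_, h1, fun S hS hc => ((mem_lnk _ _ _).1 (h2 S hS hc)).2, h3⟩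
    obtain ⟨S, hvS, hSW, hc⟩ := Finset.exists_subsuperset_card_eq (s := {v}) (t := W) (n := d) (by simpa using hvW) (by simp; omega) (by omega)
    exact ((mem_lnk _ _ _).1 (h2 S hSW hc)).1 (by simpa using hvS)
  obtain ⟨v, hvF⟩ : F.Nonempty := by rw [← Finset.card_pos, (hL F hF).1]; omega
  obtain ⟨W, hvW, hWc, h2, h3⟩ := main v ((mem_verts _ _).2 ⟨F, hF, hvF⟩)
  have hFW : F ⊆ insert v W := by
    have := h3 (F.erase v) ((mem_lnk _ _ _).2 ⟨Finset.notMem_erase _ _, by rwa [Finset.insert_erase hvF]⟩)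
    rw [← Finset.insert_erase hvF]
    exact Finset.insert_subset_insert _ this
  have hWL : W ∈ L := by
    obtain ⟨x, hx, y, hy, z, hz, hxy, hxz, hyz⟩ := Finset.two_lt_card.1 (by omega : 2 < W.card)
    have hWy : insert v (W.erase y) ∈ L := h2 _ (Finset.erase_subset _ _) (by rw [Finset.card_erase_of_mem hy]; omega)
    have hWz : insert v (W.erase z) ∈ L := h2 _ (Finset.erase_subset _ _) (by rw [Finset.card_erase_of_mem hz]; omega)
    have hxv : x ≠ v := fun h => hvW (h ▸ hx)
    have xy : x ∈ insert v (W.erase y) := by simp [hx, hxy]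
    have xz : x ∈ insert v (W.erase z) := by simp [hx, hxz]
    obtain ⟨X, hxX, hXc, g2, g3⟩ := main x ((mem_verts _ _).2 ⟨_, hWy, xy⟩)
    have s1 := g3 ((insert v (W.erase y)).erase x) ((mem_lnk _ _ _).2 ⟨Finset.notMem_erase _ _, by rwa [Finset.insert_erase xy]⟩)
    have s2 := g3 ((insert v (W.erase z)).erase x) ((mem_lnk _ _ _).2 ⟨Finset.notMem_erase _ _, by rwa [Finset.insert_erase xz]⟩)
    have s3 : W.erase x ⊆ X := by
      intro a ha
      rw [Finset.mem_erase] at ha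
      by_cases hay : a = y
      · exact s2 (Finset.mem_erase.2 ⟨ha.1, Finset.mem_insert_of_mem (Finset.mem_erase.2 ⟨hay ▸ hyz, ha.2⟩)⟩)
      · exact s1 (by simp [ha, hay])
    have := g2 _ s3 (by rw [Finset.card_erase_of_mem hx]; omega)
    rwa [Finset.insert_erase hx] at this
  refine ⟨insert v W, ⟨by rw [Finset.card_insert_of_notMem hvW, hWc], ?_⟩, hFW⟩
  intro S hS hc
  by_cases hvS : v ∈ S
  · rw [← Finset.insert_erase hvS]
    refine h2 _ ?_ (by rw [Finset.card_erase_of_mem hvS]; omega)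
    intro a ha
    rw [Finset.mem_erase] at ha
    exact Finset.mem_of_mem_insert_of_ne (hS ha.2) ha.1
  · have : S = W := by
      refine Finset.eq_of_subset_of_card_le ?_ (by omega)
      intro a ha
      exact Finset.mem_of_mem_insert_of_ne (hS ha) (fun h => hvS (h ▸ ha))
    rw [this]; exact hWL

/-- fuelled exploration -/
def Run {n : ℕ} (d : ℕ) (ω : FaceIdx n d → Bool) (S : ℕ) : ℕ → List (Finset (Fin n)) → Finset (Finset (Fin n)) → ℕ → Prop
  | 0, _, L, e => e = d + 1 ∧ S ≤ (d + 2) * L.card ∧ ∀ F ∈ L, ∃ h : F.card = d + 1, ω ⟨F, h⟩ = true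
  | _+1, [], _, _ => False
  | s+1, φ :: st, L, e => Run d ω S s st L e ∨ ∃ u, u ∉ φ ∧ insert u φ ∉ L ∧
      Run d ω S s ((Finset.powersetCard d (insert u φ)).toList ++ φ :: st) (insert (insert u φ) L)
        (e + if u ∈ verts L then 1 else 0)

lemma verts_insert {n : ℕ} (L : Finset (Finset (Fin n))) (F : Finset (Fin n)) : verts (insert F L) = F ∪ verts L := by
  simp [verts, Finset.biUnion_insert]

lemma explore {n d : ℕ} (ω : FaceIdx n d → Bool) (R : Finset (Finset (Fin n)))
    (hR : ∀ F ∈ R, ∃ h : F.card = d + 1, ω ⟨F, h⟩ = true) (F0 : Finset (Fin n)) :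
    ∀ (m : ℕ) (L : Finset (Finset (Fin n))), (R \ L).card = m → L ⊆ R → F0 ∈ L →
    ∀ (st : List (Finset (Fin n))) (e k : ℕ), e ≤ d + 1 → (verts L).card + e = L.card + d →
      k + st.length + 1 = (d + 2) * L.card → (∀ φ ∈ st, φ.card = d ∧ φ ⊆ verts L) →
      (∀ F ∈ L, ∀ φ, φ ⊆ F → φ.card = d → φ ∈ st ∨ ∀ G ∈ R, φ ⊆ G → G ∈ L) →
      (∃ s, Run d ω (k + s) s st L e) ∨
        ∃ L' ⊆ R, F0 ∈ L' ∧ L'.card ≤ (verts L').card ∧ ∀ F ∈ L', ∀ φ, φ ⊆ F → φ.card = d → ∀ G ∈ R, φ ⊆ G → G ∈ L' := by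
  intro m
  induction m using Nat.strong_induction_on with
  | _ m ihm =>
  intro L hm hLR hF0 st
  induction st with
  | nil =>
    intro e k he hv hk hst hsat
    by_cases hed : e = d + 1
    · left
      exact ⟨0, hed, by simp at hk ⊢; omega, fun F hF => hR F (hLR hF)⟩
    · right
      refine ⟨L, hLR, hF0, by omega, fun F hF φ h1 h2 => ?_⟩
      rcases hsat F hF φ h1 h2 with h | h
      · simp at h
      · exact h
  | cons φ st ih =>
    intro e k he hv hk hst hsat
    by_cases hed : e = d + 1
    · left
      exact ⟨0, hed, by simp at hk ⊢; omega, fun F hF => hR F (hLR hF)⟩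
    by_cases hφ : ∀ G ∈ R, φ ⊆ G → G ∈ L
    · rcases ih e (k+1) he hv (by simp at hk; omega) (fun ψ hψ => hst ψ (List.mem_cons_of_mem _ hψ)) (by
        intro F hF ψ h1 h2
        rcases hsat F hF ψ h1 h2 with h | h
        · rcases List.mem_cons.1 h with h | h
          · right; rw [h]; exact hφ
          · exact Or.inl h
        · exact Or.inr h) with ⟨s, hs⟩ | h
      · left
        refine ⟨s+1, Or.inl ?_⟩
        rwa [show k + (s+1) = k + 1 + s by ring]
      · exact Or.inr h
    · push Not at hφ
      obtain ⟨G, hG, hφG, hGL⟩ := hφ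
      obtain ⟨hφc, hφv⟩ := hst φ (by simp)
      have hGc := (hR G hG).1
      obtain ⟨u, hu⟩ := Finset.card_eq_one.1 (show (G \ φ).card = 1 by rw [Finset.card_sdiff_of_subset hφG]; omega)
      have huφ : u ∉ φ := by
        have : u ∈ G \ φ := by rw [hu]; simp
        exact (Finset.mem_sdiff.1 this).2
      have hGe : G = insert u φ := by rw [← Finset.sdiff_union_of_subset hφG, hu]; rfl
      have hvL : verts (insert G L) = insert u (verts L) := by
        rw [verts_insert, hGe, Finset.insert_union, Finset.union_eq_right.2 hφv]
      have hcL : (insert G L).card = L.card + 1 := Finset.card_insert_of_notMem hGL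
      have hlen : (Finset.powersetCard d G).toList.length = d + 1 := by
        rw [Finset.length_toList, Finset.card_powersetCard, hGc, Nat.choose_succ_self_right]
      rcases ihm (R \ insert G L).card (by
          rw [← hm]
          apply Finset.card_lt_card
          refine (Finset.ssubset_iff_of_subset ?_).2 ⟨G, Finset.mem_sdiff.2 ⟨hG, hGL⟩, by simp⟩
          exact Finset.sdiff_subset_sdiff le_rfl (Finset.subset_insert _ _)) (insert G L) rfl
        (Finset.insert_subset hG hLR) (Finset.mem_insert_of_mem hF0)
        ((Finset.powersetCard d G).toList ++ φ :: st) (e + if u ∈ verts L then 1 else 0) (k+1) (by split_ifs <;> omega)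
        (by
          rw [hvL, hcL]
          split_ifs with h
          · rw [Finset.insert_eq_of_mem h]; omega
          · rw [Finset.card_insert_of_notMem h]; omega)
        (by
          rw [List.length_append, hlen, hcL]
          simp at hk ⊢
          nlinarith)
        (by
          intro ψ hψ
          rw [hvL]
          rcases List.mem_append.1 hψ with h | h
          · rw [Finset.mem_toList, Finset.mem_powersetCard] at h
            refine ⟨h.2, h.1.trans ?_⟩
            rw [hGe]
            exact Finset.insert_subset_insert _ hφv
          · exact ⟨(hst ψ h).1, (hst ψ h).2.trans (Finset.subset_insert _ _)⟩)
        (by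
          intro F hF ψ h1 h2
          rcases Finset.mem_insert.1 hF with rfl | hF
          · left
            exact List.mem_append_left _ (Finset.mem_toList.2 (Finset.mem_powersetCard.2 ⟨h1, h2⟩))
          · rcases hsat F hF ψ h1 h2 with h | h
            · left; exact List.mem_append_right _ h
            · right; exact fun G' hG' hs => Finset.mem_insert_of_mem (h G' hG' hs)) with ⟨s, hs⟩ | h
      · left
        refine ⟨s+1, Or.inr ⟨u, huφ, hGe ▸ hGL, ?_⟩⟩
        rw [← hGe, show k + (s+1) = k + 1 + s by ring]
        exact hs
      · exact Or.inr h

end Emb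

namespace Emb
open scoped Classical

def FullY {n : ℕ} (d : ℕ) (ω : FaceIdx n d → Bool) (W : Finset (Fin n)) : Prop :=
  W.card = d + 2 ∧ ∀ F, F ⊆ W → ∀ h : F.card = d + 1, ω ⟨F, h⟩ = true

lemma emb_of_good {n d : ℕ} (hd : 1 ≤ d) (ω : FaceIdx n d → Bool)
    (h1 : ∀ F0 : Finset (Fin n), F0.card = d + 1 → ∀ S, ¬ Run d ω S S (Finset.powersetCard d F0).toList {F0} 0)
    (h2 : 2 ≤ d → ∀ W W', FullY d ω W → FullY d ω W' → ¬ Disjoint W W' → W = W') :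
    EmbPL n d (Ycomplex n d ω) := by
  refine emb_of_cores hd ω fun R hc hR => ?_
  have hex : ∀ F0 ∈ R, ∃ L' ⊆ R, F0 ∈ L' ∧ L'.card ≤ (verts L').card ∧
      ∀ F ∈ L', ∀ φ, φ ⊆ F → φ.card = d → ∀ G ∈ R, φ ⊆ G → G ∈ L' := by
    intro F0 hF0
    have hF0c := (hR F0 hF0).1
    have hve : verts {F0} = F0 := by simp [verts]
    rcases explore ω R hR F0 _ {F0} rfl (by simpa using hF0) (by simp) (Finset.powersetCard d F0).toList 0 0 (by omega)
      (by rw [hve, hF0c, Finset.card_singleton]; omega)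
      (by rw [Finset.length_toList, Finset.card_powersetCard, hF0c, Nat.choose_succ_self_right, Finset.card_singleton]; omega)
      (by
        intro φ hφ
        rw [Finset.mem_toList, Finset.mem_powersetCard] at hφ
        rw [hve]; exact ⟨hφ.2, hφ.1⟩)
      (by
        intro F hF φ h1 h2
        rw [Finset.mem_singleton] at hF
        subst hF
        left
        rw [Finset.mem_toList, Finset.mem_powersetCard]
        exact ⟨h1, h2⟩) with ⟨s, hs⟩ | h
    · rw [Nat.zero_add] at hs
      exact absurd hs (h1 F0 hF0c s)
    · exact h
  have hcore : ∀ L' ⊆ R, (∀ F ∈ L', ∀ φ, φ ⊆ F → φ.card = d → ∀ G ∈ R, φ ⊆ G → G ∈ L') → Core (d+1) L' := by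
    intro L' hL' hcl F hF
    have := hc F (hL' hF)
    refine ⟨this.1, fun v hv => ?_⟩
    obtain ⟨G, hG, hs, hne⟩ := this.2 v hv
    exact ⟨G, hcl F hF (F.erase v) (Finset.erase_subset _ _) (by rw [Finset.card_erase_of_mem hv, this.1]; rfl) G hG hs, hs, hne⟩
  by_cases hd2 : 2 ≤ d
  · refine base_full hd R ?_ ?_
    · intro F hF _
      obtain ⟨L', hL', hFL, hle, hcl⟩ := hex F hF
      obtain ⟨W, hW, hFW⟩ := full_of_core hd2 L' (hcore L' hL' hcl) hle F hFL
      exact ⟨W, ⟨hW.1, fun F hF hc => hL' (hW.2 F hF hc)⟩, hFW⟩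
    · intro W W' hW hW' hnd
      exact h2 hd2 W W' ⟨hW.1, fun F hF hc => (hR F (hW.2 F hF hc)).2⟩ ⟨hW'.1, fun F hF hc => (hR F (hW'.2 F hF hc)).2⟩ hnd
  · have : d = 1 := by omega
    subst this
    refine cycle_emb _ R rfl (fun F hF => (hc F hF).1) ?_
    intro F hF v hv
    obtain ⟨L', hL', hFL, hle, hcl⟩ := hex F hF
    have := deg_eq L' (hcore L' hL' hcl) hle v ((mem_verts _ _).2 ⟨F, hFL, hv⟩)
    rw [show (2:ℕ) = 1 + 1 from rfl, ← this]
    congr 1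
    ext G
    simp only [Finset.mem_filter]
    constructor
    · rintro ⟨hG, hvG⟩
      exact ⟨hcl F hFL {v} (by simpa using hv) (by simp) G hG (by simpa using hvG), hvG⟩
    · rintro ⟨hG, hvG⟩
      exact ⟨hL' hG, hvG⟩

end Emb

namespace Emb
open scoped Classical

lemma Y_all' (n d : ℕ) (p : ℝ) (A : Finset (Finset (Fin n))) (hA : ∀ F ∈ A, F.card = d + 1) :
    YMeasure n d p {ω | ∀ F ∈ A, ∃ h : F.card = d + 1, ω ⟨F, h⟩ = true} ≤ ENNReal.ofReal (pc p ^ A.card) := by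
  set B : Finset (FaceIdx n d) := Finset.univ.filter (fun i => i.1 ∈ A) with hB
  have hc : B.card = A.card := by
    rw [← Finset.card_image_of_injective B Subtype.val_injective]
    congr 1
    ext F
    simp only [Finset.mem_image, hB, Finset.mem_filter, Finset.mem_univ, true_and]
    constructor
    · rintro ⟨i, hi, rfl⟩; exact hi
    · intro h; exact ⟨⟨F, hA F h⟩, h, rfl⟩
  rw [← hc, ← Y_all]
  apply measure_mono
  intro ω hω i hi
  rw [hB, Finset.mem_filter] at hi
  exact (hω i.1 hi.2).2

lemma union_le {Ω ι : Type*} [MeasurableSpace Ω] (μ : Measure Ω) (U : Finset ι) (A : ι → Set Ω) (b c : ℝ) (N : ℝ)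
    (hb : 0 ≤ b) (hA : ∀ u ∈ U, μ (A u) ≤ ENNReal.ofReal b) (hU : (U.card : ℝ) ≤ N) (hc : N * b ≤ c) :
    μ (⋃ u ∈ U, A u) ≤ ENNReal.ofReal c := by
  calc μ (⋃ u ∈ U, A u) ≤ ∑ u ∈ U, μ (A u) := measure_biUnion_finset_le _ _
    _ ≤ ∑ u ∈ U, ENNReal.ofReal b := Finset.sum_le_sum hA
    _ = ENNReal.ofReal (U.card * b) := by
      rw [Finset.sum_const, nsmul_eq_mul, ENNReal.ofReal_mul (Nat.cast_nonneg _), ENNReal.ofReal_natCast]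
    _ ≤ _ := ENNReal.ofReal_le_ofReal ((mul_le_mul_of_nonneg_right hU hb).trans hc)

lemma verts_card {n d : ℕ} (L : Finset (Finset (Fin n))) (hL : ∀ F ∈ L, F.card = d + 1) : (verts L).card ≤ (d + 1) * L.card := by
  rw [verts, mul_comm]
  exact Finset.card_biUnion_le_card_mul _ _ _ (fun F hF => (hL F hF).le)

lemma run_prob {n d : ℕ} (hn : 1 ≤ n) (p κ Q : ℝ) (S : ℕ) (hκ : κ = 4 ^ (d + 2)) (hQ : Q = (d + 1) * (S + 1))
    (hq : 2 * (n * κ * pc p) ≤ 1) :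
    ∀ (s : ℕ) (st : List (Finset (Fin n))) (L : Finset (Finset (Fin n))) (e : ℕ), L.card + s ≤ S + 1 →
      (∀ φ ∈ st, φ.card = d) → (∀ F ∈ L, F.card = d + 1) →
      YMeasure n d p {ω | Run d ω S s st L e} ≤
        ENNReal.ofReal (2 ^ s * (κ * pc p) ^ L.card * (n / Q) ^ e * ((1/4) ^ S * (Q / n) ^ (d + 1))) := by
  have hn0 : (0:ℝ) < n := by exact_mod_cast hn
  have hQ0 : 0 < Q := by rw [hQ]; positivity
  have hκ0 : 0 < κ := by rw [hκ]; positivity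
  have hq0 := pc_nonneg p
  set X : ℝ := (1/4) ^ S * (Q / n) ^ (d + 1) with hX
  have hX0 : 0 ≤ X := by positivity
  intro s
  induction s with
  | zero =>
    intro st L e hs _ hL
    by_cases hc : e = d + 1 ∧ S ≤ (d + 2) * L.card
    · calc YMeasure n d p {ω | Run d ω S 0 st L e}
          ≤ YMeasure n d p {ω | ∀ F ∈ L, ∃ h : F.card = d + 1, ω ⟨F, h⟩ = true} :=
            measure_mono (fun ω hω => by
              have : Run d ω S 0 st L e := hω
              unfold Run at this
              exact this.2.2)
        _ ≤ _ := Y_all' n d p L hL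
        _ ≤ _ := by
          apply ENNReal.ofReal_le_ofReal
          rw [hc.1, hX, mul_pow, hκ, ← pow_mul]
          have e1 : ((n:ℝ) / Q) ^ (d+1) * (Q / n) ^ (d+1) = 1 := by
            rw [← mul_pow, div_mul_div_comm, mul_comm Q, div_self (by positivity), one_pow]
          have e2 : (1:ℝ) ≤ 4 ^ ((d+2) * L.card) * (1/4) ^ S := by
            rw [one_div, inv_pow, ← div_eq_mul_inv, le_div_iff₀ (by positivity), one_mul]
            exact pow_le_pow_right₀ (by norm_num) hc.2
          have e3 : (2:ℝ) ^ 0 * (4 ^ ((d+2) * L.card) * pc p ^ L.card) * (n / Q) ^ (d+1) * ((1/4) ^ S * (Q / n) ^ (d + 1))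
              = pc p ^ L.card * (4 ^ ((d+2) * L.card) * (1/4) ^ S) * (((n:ℝ) / Q) ^ (d+1) * (Q / n) ^ (d+1)) := by ring
          rw [e3, e1, mul_one]
          exact le_mul_of_one_le_right (by positivity) e2
    · have : {ω : FaceIdx n d → Bool | Run d ω S 0 st L e} = ∅ := by
        ext ω
        simp only [Set.mem_ofPred_eq, Set.mem_empty_iff_false, iff_false]
        intro h
        unfold Run at h
        exact hc ⟨h.1, h.2.1⟩
      rw [this]; simp
  | succ s ih =>
    intro st L e hs hst hL
    cases st with
    | nil =>
      have : {ω : FaceIdx n d → Bool | Run d ω S (s+1) [] L e} = ∅ := by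
        ext ω
        simp only [Set.mem_ofPred_eq, Set.mem_empty_iff_false, iff_false]
        intro h
        unfold Run at h
        exact h
      rw [this]; simp
    | cons φ st =>
      set B : ℝ := 2 ^ s * (κ * pc p) ^ L.card * (n / Q) ^ e * X with hB
      have hB0 : 0 ≤ B := by positivity
      have hφ : φ.card = d := hst φ (by simp)
      set A : Fin n → Set (FaceIdx n d → Bool) := fun u => {ω | Run d ω S s ((Finset.powersetCard d (insert u φ)).toList ++ φ :: st)
        (insert (insert u φ) L) (e + if u ∈ verts L then 1 else 0)} with hA
      set U1 := (verts L).filter (fun u => u ∉ φ ∧ insert u φ ∉ L) with hU1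
      set U2 := Finset.univ.filter (fun u => u ∉ verts L ∧ u ∉ φ ∧ insert u φ ∉ L) with hU2
      have hsub : {ω : FaceIdx n d → Bool | Run d ω S (s+1) (φ :: st) L e} ⊆
          {ω | Run d ω S s st L e} ∪ ((⋃ u ∈ U1, A u) ∪ (⋃ u ∈ U2, A u)) := by
        intro ω h
        have h : Run d ω S (s+1) (φ :: st) L e := h
        unfold Run at h
        rcases h with h | ⟨u, h1, h2, h3⟩
        · exact Or.inl h
        · right
          by_cases hu : u ∈ verts L
          · left
            exact Set.mem_biUnion (show u ∈ U1 by rw [hU1, Finset.mem_filter]; exact ⟨hu, h1, h2⟩) h3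
          · right
            exact Set.mem_biUnion (show u ∈ U2 by rw [hU2, Finset.mem_filter]; exact ⟨Finset.mem_univ _, hu, h1, h2⟩) h3
      have hAu : ∀ u, u ∉ φ → insert u φ ∉ L → YMeasure n d p (A u) ≤
          ENNReal.ofReal (2 ^ s * (κ * pc p) ^ (L.card + 1) * (n / Q) ^ (e + if u ∈ verts L then 1 else 0) * X) := by
        intro u h1 h2
        have hc : (insert u φ).card = d + 1 := by rw [Finset.card_insert_of_notMem h1, hφ]
        rw [← Finset.card_insert_of_notMem h2]
        refine ih _ _ _ ?_ ?_ ?_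
        · rw [Finset.card_insert_of_notMem h2]; omega
        · intro ψ hψ
          rcases List.mem_append.1 hψ with h | h
          · exact (Finset.mem_powersetCard.1 (Finset.mem_toList.1 h)).2
          · exact hst ψ h
        · intro F hF
          rcases Finset.mem_insert.1 hF with rfl | h
          · exact hc
          · exact hL F h
      have hκq : κ * pc p * n ≤ 1/2 := by linarith
      have m1 : YMeasure n d p (⋃ u ∈ U1, A u) ≤ ENNReal.ofReal (B / 2) := by
        refine union_le _ U1 A (B * (κ * pc p * n / Q)) _ Q (by positivity) ?_ ?_ ?_
        · intro u hu
          rw [hU1, Finset.mem_filter] at hu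
          refine (hAu u hu.2.1 hu.2.2).trans (ENNReal.ofReal_le_ofReal (le_of_eq ?_))
          rw [if_pos hu.1, hB]
          ring
        · have h1 : U1.card ≤ (d+1) * L.card := (Finset.card_filter_le _ _).trans (verts_card L hL)
          have h2 : (d+1) * L.card ≤ (d+1) * (S+1) := Nat.mul_le_mul_left _ (by omega)
          rw [hQ]
          exact_mod_cast h1.trans h2
        · calc Q * (B * (κ * pc p * n / Q)) = B * (κ * pc p * n) := by field_simp
            _ ≤ B * (1/2) := mul_le_mul_of_nonneg_left hκq hB0
            _ = B / 2 := by ring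
      have m2 : YMeasure n d p (⋃ u ∈ U2, A u) ≤ ENNReal.ofReal (B / 2) := by
        refine union_le _ U2 A (B * (κ * pc p)) _ n (by positivity) ?_ ?_ ?_
        · intro u hu
          rw [hU2, Finset.mem_filter] at hu
          refine (hAu u hu.2.2.1 hu.2.2.2).trans (ENNReal.ofReal_le_ofReal (le_of_eq ?_))
          rw [if_neg hu.2.1, hB]
          ring
        · have := Finset.card_le_univ U2
          rw [Fintype.card_fin] at this
          exact_mod_cast this
        · calc n * (B * (κ * pc p)) = B * (κ * pc p * n) := by ring
            _ ≤ B * (1/2) := mul_le_mul_of_nonneg_left hκq hB0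
            _ = B / 2 := by ring
      have m0 := ih st L e (by omega) (fun ψ h => hst ψ (List.mem_cons_of_mem _ h)) hL
      calc YMeasure n d p {ω | Run d ω S (s+1) (φ :: st) L e} ≤ _ := measure_mono hsub
        _ ≤ ENNReal.ofReal B + (ENNReal.ofReal (B/2) + ENNReal.ofReal (B/2)) :=
          (measure_union_le _ _).trans (add_le_add m0 ((measure_union_le _ _).trans (add_le_add m1 m2)))
        _ = ENNReal.ofReal (2 ^ (s+1) * (κ * pc p) ^ L.card * (n / Q) ^ e * X) := by
          rw [← ENNReal.ofReal_add (by positivity) (by positivity), ← ENNReal.ofReal_add (by positivity) (by positivity)]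
          congr 1
          rw [hB]; ring

lemma run_total (d : ℕ) : ∃ C : ℝ, 0 ≤ C ∧ ∀ (n : ℕ) (p : ℝ), 1 ≤ n → 2 * (n * 4 ^ (d+2) * pc p) ≤ 1 →
    YMeasure n d p {ω | ∃ F0 : Finset (Fin n), F0.card = d + 1 ∧ ∃ S, Run d ω S S (Finset.powersetCard d F0).toList {F0} 0}
      ≤ ENNReal.ofReal (C * pc p) := by
  set a : ℕ → ℝ := fun S => (1/2) ^ S * ((d + 1) * (S + 1)) ^ (d+1) with ha
  have ha0 : ∀ S, 0 ≤ a S := fun S => by positivity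
  have hsum : Summable a := by
    have h := summable_pow_mul_geometric_of_norm_lt_one (d+1) (r := (1/2 : ℝ)) (by norm_num)
    have h' := (summable_nat_add_iff 1).2 h
    refine (h'.mul_left (2 * ((d:ℝ)+1) ^ (d+1))).congr (fun S => ?_)
    simp only [ha, mul_pow]
    push_cast
    ring
  refine ⟨4 ^ (d+2) * ∑' S, a S, mul_nonneg (by positivity) (tsum_nonneg ha0), fun n p hn hq => ?_⟩
  have hn0 : (0:ℝ) < n := by exact_mod_cast hn
  have hq0 := pc_nonneg p
  have hS : ∀ S : ℕ, YMeasure n d p (⋃ F0 ∈ Finset.powersetCard (d+1) (Finset.univ : Finset (Fin n)),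
      {ω | Run d ω S S (Finset.powersetCard d F0).toList {F0} 0}) ≤ ENNReal.ofReal (4 ^ (d+2) * pc p * a S) := by
    intro S
    refine union_le _ _ _ (2 ^ S * (4 ^ (d+2) * pc p) * ((1/4) ^ S * (((d + 1) * (S + 1)) / n) ^ (d + 1))) _ ((n:ℝ) ^ (d+1))
      (by positivity) ?_ ?_ ?_
    · intro F0 hF0
      rw [Finset.mem_powersetCard] at hF0
      have := run_prob (n := n) (d := d) hn p _ _ S rfl rfl hq S (Finset.powersetCard d F0).toList {F0} 0
        (by rw [Finset.card_singleton]; omega)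
        (fun φ hφ => (Finset.mem_powersetCard.1 (Finset.mem_toList.1 hφ)).2)
        (fun F hF => by rw [Finset.mem_singleton] at hF; rw [hF]; exact hF0.2)
      rw [Finset.card_singleton, pow_one, pow_zero, mul_one] at this
      exact this
    · rw [Finset.card_powersetCard, Finset.card_univ, Fintype.card_fin]
      exact_mod_cast Nat.choose_le_pow n (d+1)
    · apply le_of_eq
      have e1 : (2:ℝ) ^ S * (1/4) ^ S = (1/2) ^ S := by rw [← mul_pow]; norm_num
      simp only [ha]
      have e2 : (n:ℝ) ^ (d+1) * (((d + 1) * (S + 1)) / n) ^ (d + 1) = (((d:ℝ) + 1) * (S + 1)) ^ (d + 1) := by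
        rw [← mul_pow, mul_div_cancel₀ _ hn0.ne']
      rw [← e1, ← e2]
      ring
  calc _ ≤ YMeasure n d p (⋃ S : ℕ, ⋃ F0 ∈ Finset.powersetCard (d+1) (Finset.univ : Finset (Fin n)),
      {ω | Run d ω S S (Finset.powersetCard d F0).toList {F0} 0}) := by
        apply measure_mono
        rintro ω ⟨F0, hF0, S, h⟩
        refine Set.mem_iUnion.2 ⟨S, Set.mem_biUnion (x := F0) ?_ h⟩
        exact Finset.mem_powersetCard.2 ⟨Finset.subset_univ _, hF0⟩
    _ ≤ ∑' S, YMeasure n d p (⋃ F0 ∈ Finset.powersetCard (d+1) (Finset.univ : Finset (Fin n)),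
      {ω | Run d ω S S (Finset.powersetCard d F0).toList {F0} 0}) := measure_iUnion_le _
    _ ≤ ∑' S, ENNReal.ofReal (4 ^ (d+2) * pc p * a S) := ENNReal.tsum_le_tsum hS
    _ = ENNReal.ofReal (∑' S, 4 ^ (d+2) * pc p * a S) :=
      (ENNReal.ofReal_tsum_of_nonneg (fun S => mul_nonneg (by positivity) (ha0 S)) (hsum.mul_left _)).symm
    _ = _ := by rw [tsum_mul_left]; congr 1; ring

lemma full_total (d : ℕ) (hd : 1 ≤ d) : ∃ C : ℝ, 0 ≤ C ∧ ∀ (n : ℕ) (p : ℝ), n * pc p ≤ 1 →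
    YMeasure n d p {ω | ∃ W W', FullY d ω W ∧ FullY d ω W' ∧ ¬ Disjoint W W' ∧ W ≠ W'} ≤ ENNReal.ofReal (C * pc p) := by
  set M : ℝ := 2 ^ (2 ^ (2*d+3)) with hM
  refine ⟨(2*d+4) * M, by positivity, fun n p hq => ?_⟩
  have hq0 := pc_nonneg p
  have hsub : {ω : FaceIdx n d → Bool | ∃ W W', FullY d ω W ∧ FullY d ω W' ∧ ¬ Disjoint W W' ∧ W ≠ W'} ⊆
      ⋃ m ∈ Finset.range (2*d+4), ⋃ U ∈ Finset.powersetCard m (Finset.univ : Finset (Fin n)),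
        ⋃ A ∈ U.powerset.powerset.filter (fun A => A.card = m + 1 ∧ ∀ F ∈ A, F.card = d + 1),
          {ω | ∀ F ∈ A, ∃ h : F.card = d + 1, ω ⟨F, h⟩ = true} := by
    rintro ω ⟨W, W', hW, hW', hnd, hne⟩
    set A' := Finset.powersetCard (d+1) W ∪ Finset.powersetCard (d+1) W' with hA'
    have hint : Finset.powersetCard (d+1) W ∩ Finset.powersetCard (d+1) W' = Finset.powersetCard (d+1) (W ∩ W') := by
      ext F
      simp only [Finset.mem_inter, Finset.mem_powersetCard, Finset.subset_inter_iff]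
      tauto
    have hc1 := Finset.card_union_add_card_inter (Finset.powersetCard (d+1) W) (Finset.powersetCard (d+1) W')
    have hch : (d+2).choose (d+1) = d + 2 := Nat.choose_succ_self_right (d+1)
    rw [hint, Finset.card_powersetCard, Finset.card_powersetCard, Finset.card_powersetCard, hW.1, hW'.1, hch] at hc1
    have hc2 := Finset.card_union_add_card_inter W W'
    rw [hW.1, hW'.1] at hc2
    have hk1 : 1 ≤ (W ∩ W').card := by
      rw [Nat.one_le_iff_ne_zero, Ne, Finset.card_eq_zero, ← Finset.disjoint_iff_inter_eq_empty]
      exact hnd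
    have hk2 : (W ∩ W').card ≤ d + 1 := by
      by_contra hlt
      have h1 : W ∩ W' = W := Finset.eq_of_subset_of_card_le Finset.inter_subset_left (by rw [hW.1]; omega)
      have h2 : W ∩ W' = W' := Finset.eq_of_subset_of_card_le Finset.inter_subset_right (by rw [hW'.1]; omega)
      exact hne (h1.symm.trans h2)
    have hA'c : (W ∪ W').card + 1 ≤ A'.card := by
      rw [hA']
      by_cases hk : (W ∩ W').card = d + 1
      · rw [hk, Nat.choose_self] at hc1; omega
      · rw [Nat.choose_eq_zero_of_lt (by omega)] at hc1; omega
    obtain ⟨A, hAA', hAc⟩ := Finset.exists_subset_card_eq hA'c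
    have hF : ∀ F ∈ A, F.card = d + 1 ∧ F ⊆ W ∪ W' ∧ (F ⊆ W ∨ F ⊆ W') := by
      intro F hF
      have := hAA' hF
      rw [hA', Finset.mem_union, Finset.mem_powersetCard, Finset.mem_powersetCard] at this
      rcases this with h | h
      · exact ⟨h.2, h.1.trans Finset.subset_union_left, Or.inl h.1⟩
      · exact ⟨h.2, h.1.trans Finset.subset_union_right, Or.inr h.1⟩
    refine Set.mem_biUnion (x := (W ∪ W').card) (Finset.mem_range.2 (by omega)) ?_
    refine Set.mem_biUnion (x := W ∪ W') (Finset.mem_powersetCard.2 ⟨Finset.subset_univ _, rfl⟩) ?_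
    refine Set.mem_biUnion (x := A) ?_ ?_
    · refine Finset.mem_filter.2 ⟨Finset.mem_powerset.2 fun F h => Finset.mem_powerset.2 (hF F h).2.1, hAc, fun F h => (hF F h).1⟩
    · intro F h
      refine ⟨(hF F h).1, ?_⟩
      rcases (hF F h).2.2 with h' | h'
      · exact hW.2 F h' _
      · exact hW'.2 F h' _
  refine (measure_mono hsub).trans ?_
  refine union_le _ _ _ (M * pc p) _ (2*d+4) (by positivity) ?_ (by rw [Finset.card_range]; push_cast; exact le_rfl) (le_of_eq (by ring))
  intro m hm
  rw [Finset.mem_range] at hm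
  refine union_le _ _ _ (M * pc p ^ (m+1)) _ ((n:ℝ)^m) (by positivity) ?_ ?_ ?_
  · intro U hU
    rw [Finset.mem_powersetCard] at hU
    refine union_le _ _ _ (pc p ^ (m+1)) _ M (by positivity) ?_ ?_ le_rfl
    · intro A hA
      rw [Finset.mem_filter] at hA
      rw [← hA.2.1]
      exact Y_all' n d p A hA.2.2
    · have h1 := Finset.card_filter_le U.powerset.powerset (fun A => A.card = m + 1 ∧ ∀ F ∈ A, F.card = d + 1)
      rw [Finset.card_powerset, Finset.card_powerset, hU.2] at h1
      have h2 : 2 ^ (2 ^ m) ≤ 2 ^ (2 ^ (2*d+3)) :=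
        Nat.pow_le_pow_right (by norm_num) (Nat.pow_le_pow_right (by norm_num) (by omega))
      rw [hM]
      exact_mod_cast h1.trans h2
  · rw [Finset.card_powersetCard, Finset.card_univ, Fintype.card_fin]
    exact_mod_cast Nat.choose_le_pow n m
  · have h1 : ((n:ℝ) * pc p) ^ m ≤ 1 := pow_le_one₀ (by positivity) hq
    calc (n:ℝ)^m * (M * pc p ^ (m+1)) = (M * pc p) * ((n:ℝ) * pc p) ^ m := by ring
      _ ≤ (M * pc p) * 1 := mul_le_mul_of_nonneg_left h1 (by positivity)
      _ = _ := mul_one _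

theorem part1 (d : ℕ) (hd : 1 ≤ d) : ∃ c₁ : ℝ, 0 < c₁ ∧ ∀ p : ℕ → ℝ, (∀ n : ℕ, p n ≤ c₁ / n) →
    Tendsto (fun n : ℕ => YMeasure n d (p n)
      {ω | ∃ φ : ↥(geomReal n (Ycomplex n d ω)) → (Fin (2 * d) → ℝ), Topology.IsEmbedding φ}) atTop (nhds (1 : ENNReal)) := by
  obtain ⟨C1, hC1, h1⟩ := run_total d
  obtain ⟨C2, hC2, h2⟩ := full_total d hd
  set c : ℝ := 1 / (2 * 4 ^ (d+2)) with hc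
  have hc0 : 0 < c := by positivity
  have hc1 : c ≤ 1 := by
    rw [hc, div_le_one (by positivity)]
    have : (1:ℝ) ≤ 4 ^ (d+2) := one_le_pow₀ (by norm_num)
    linarith
  refine ⟨c, hc0, fun p hp => ?_⟩
  refine whp d p _ (fun n => (C1 + C2) * (c / n)) ?_ ?_
  · have := tendsto_const_div_atTop_nhds_zero_nat c
    simpa using this.const_mul (C1 + C2)
  filter_upwards [eventually_ge_atTop 1] with n hn
  have hn0 : (0:ℝ) < n := by exact_mod_cast hn
  have hq : pc (p n) ≤ c / n := max_le (by positivity) ((min_le_left _ _).trans (hp n))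
  have hq' : n * pc (p n) ≤ c := by rw [le_div_iff₀ hn0] at hq; linarith
  have hq0 := pc_nonneg (p n)
  have b1 := h1 n (p n) hn (by
    have : 2 * ((n:ℝ) * 4 ^ (d+2) * pc (p n)) = (n * pc (p n)) * (2 * 4 ^ (d+2)) := by ring
    rw [this]
    calc n * pc (p n) * (2 * 4 ^ (d+2)) ≤ c * (2 * 4 ^ (d+2)) := mul_le_mul_of_nonneg_right hq' (by positivity)
      _ = 1 := by rw [hc]; field_simp)
  have b2 := h2 n (p n) (hq'.trans hc1)
  calc _ ≤ YMeasure n d (p n) ({ω | ∃ F0 : Finset (Fin n), F0.card = d + 1 ∧ ∃ S, Run d ω S S (Finset.powersetCard d F0).toList {F0} 0} ∪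
        {ω | ∃ W W', FullY d ω W ∧ FullY d ω W' ∧ ¬ Disjoint W W' ∧ W ≠ W'}) := by
        apply measure_mono
        intro ω hω
        by_contra hcon
        apply hω
        rw [Set.mem_union, not_or] at hcon
        refine (emb_of_good hd ω ?_ ?_).isEmb
        · intro F0 hF0 S hS
          exact hcon.1 ⟨F0, hF0, S, hS⟩
        · intro _ W W' hW hW' hnd
          by_contra hne
          exact hcon.2 ⟨W, W', hW, hW', hnd, hne⟩
    _ ≤ ENNReal.ofReal (C1 * pc (p n)) + ENNReal.ofReal (C2 * pc (p n)) := (measure_union_le _ _).trans (add_le_add b1 b2)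
    _ = ENNReal.ofReal ((C1 + C2) * pc (p n)) := by
      rw [← ENNReal.ofReal_add (by positivity) (by positivity)]; congr 1; ring
    _ ≤ _ := ENNReal.ofReal_le_ofReal (mul_le_mul_of_nonneg_left hq (by positivity))

end Emb

noncomputable section
/-- **The threshold for embeddability in `ℝ^{2d}`** (Wagner). Fix `d ≥ 1`. There
are constants `c₁, c₂ > 0` depending only on `d` such that: if `p ≤ c₁/n` then
w.h.p. the geometric realization of `Y_d(n,p)` embeds topologically in `ℝ^{2d}`,
and if `p ≥ c₂/n` then w.h.p. it does not. -/
theorem embeddability_threshold (d : ℕ) (hd : 1 ≤ d) :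
    ∃ c₁ c₂ : ℝ, 0 < c₁ ∧ 0 < c₂ ∧ ∀ p : ℕ → ℝ,
      ((∀ n : ℕ, p n ≤ c₁ / n) →
        Tendsto (fun n : ℕ => YMeasure n d (p n)
            {ω | ∃ φ : ↥(geomReal n (Ycomplex n d ω)) → (Fin (2 * d) → ℝ),
              Topology.IsEmbedding φ})
          atTop (nhds (1 : ENNReal))) ∧
      ((∀ n : ℕ, c₂ / n ≤ p n) →
        Tendsto (fun n : ℕ => YMeasure n d (p n)
            {ω | ¬ ∃ φ : ↥(geomReal n (Ycomplex n d ω)) → (Fin (2 * d) → ℝ),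
              Topology.IsEmbedding φ})
          atTop (nhds (1 : ENNReal))) := by
  obtain ⟨c₁, h1, H1⟩ := Emb.part1 d hd
  obtain ⟨c₂, h2, H2⟩ := Emb.part2 d hd
  exact ⟨c₁, c₂, h1, h2, fun p => ⟨H1 p, H2 p⟩⟩
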